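/- arXiv:1309.2479 — 3 statements merged into one kernel-verified Lean document; each statement's English description precedes it below -/
import Mathlib

section
/- Let $K$ be an algebraically closed field complete with respect to a non-trivial (possibly non-archimedean) absolute value $|\cdot|$. On $K^2$ let $\|(p_0,p_1)\|$ be $\max\{|p_0|,|p_1|\}$ if $K$ is non-archimedean and $\sqrt{|p_0|^2+|p_1|^2}$ if $K$ is archimedean, and for $z,w\in\mathbb{P}^1=\mathbb{P}^1(K)$ with lifts $p=(p_0,p_1),\,q=(q_0,q_1)\in K^2\setminus\{0\}$ let $[z,w]:=|p_0q_1-p_1q_0|/(\|p\|\cdot\|q\|)$ be the normalized chordal metric. Let $\mathsf{P}^1=\mathsf{P}^1(K)$ be the Berkovich projective line over $K$, which contains $\mathbb{P}^1$ as a dense subset: its points are the classes of multiplicative seminorms $N$ on $K[X,Y]$ that extend $|\cdot|$ and do not vanish identically on the ideal $(X,Y)$, where $N\sim N'$ if there is $c>0$ such that $N(G)=c^{d}N'(G)$ for every $d\ge 0$ and every homogeneous $G$ of degree $d$; its topology is the quotient of the topology of pointwise convergence; and $\pi(p)\in\mathbb{P}^1$ is identified with the class of $G\mapsto|G(p)|$,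 where $\pi:K^2\setminus\{0\}\to\mathbb{P}^1$ is the canonical projection. Then for rational functions $\phi_1,\phi_2\in K(z)$ of degrees $d_1,d_2$ respectively, satisfying $\phi_1\not\equiv\phi_2$ and $\max\{d_1,d_2\}>0$, the function $z\mapsto[\phi_1(z),\phi_2(z)]$ on $\mathbb{P}^1$ extends continuously to a function $\mathcal{S}\mapsto[\phi_1,\phi_2]_{\mathrm{can}}(\mathcal{S})$ on $\mathsf{P}^1$. -/
open scoped LinearAlgebra.Projectivization

noncomputable section

namespace BerkovichChordal

/-! ### The chordal metric on the classical projective line -/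

section Chordal

variable {K : Type*} [NormedField K]

open Classical in
/-- The norm on `K²`: the maximum norm if `K` is non-archimedean, the Euclidean norm otherwise. -/
def norm2 (p : Fin 2 → K) : ℝ :=
  if IsUltrametricDist K then max ‖p 0‖ ‖p 1‖ else Real.sqrt (‖p 0‖ ^ 2 + ‖p 1‖ ^ 2)

/-- The wedge product on `K²`. -/
def wedge (p q : Fin 2 → K) : K := p 0 * q 1 - p 1 * q 0

theorem norm2_smul (t : K) (p : Fin 2 → K) : norm2 (t • p) = ‖t‖ * norm2 p := by
  unfold norm2
  split_ifs
  · simp [mul_max_of_nonneg]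
  · rw [show ‖(t • p) 0‖ ^ 2 + ‖(t • p) 1‖ ^ 2 = ‖t‖ ^ 2 * (‖p 0‖ ^ 2 + ‖p 1‖ ^ 2) by
      simp; ring, Real.sqrt_mul (by positivity), Real.sqrt_sq (norm_nonneg t)]

theorem wedge_smul_left (t : K) (p q : Fin 2 → K) : wedge (t • p) q = t * wedge p q := by
  simp [wedge]; ring

theorem wedge_smul_right (t : K) (p q : Fin 2 → K) : wedge p (t • q) = t * wedge p q := by
  simp [wedge]; ring

theorem ne_zero_of_eq_smul {a b : {v : Fin 2 → K // v ≠ 0}} {t : K}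
    (h : (a : Fin 2 → K) = t • (b : Fin 2 → K)) : t ≠ 0 := by
  rintro rfl
  exact a.2 (by simpa using h)

/-- The normalized chordal metric `[z, w] = |p ∧ q| / (‖p‖ ‖q‖)` on `ℙ¹(K)`, where `p`, `q` are
arbitrary lifts of `z`, `w` to `K² ∖ {0}`. -/
def chordal (z w : ℙ K (Fin 2 → K)) : ℝ :=
  Projectivization.lift
    (fun p : {v : Fin 2 → K // v ≠ 0} =>
      Projectivization.lift
        (fun q : {v : Fin 2 → K // v ≠ 0} => ‖wedge p.1 q.1‖ / (norm2 p.1 * norm2 q.1))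
        (by
          intro a b t h
          have ht : ‖t‖ ≠ 0 := norm_ne_zero_iff.2 (ne_zero_of_eq_smul h)
          simp only [h, wedge_smul_right, norm2_smul, norm_mul]
          rw [mul_left_comm, mul_div_mul_left _ _ ht])
        w)
    (by
      intro a b t h
      have ht : ‖t‖ ≠ 0 := norm_ne_zero_iff.2 (ne_zero_of_eq_smul h)
      induction w using Projectivization.ind with
      | h q hq =>
        simp only [Projectivization.lift_mk, h, wedge_smul_left, norm2_smul, norm_mul]
        rw [mul_assoc, mul_div_mul_left _ _ ht])
    z

end Chordal

/-! ### Rational functions as self-maps of the projective line -/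

section Rational

variable {K : Type*} [Field K]

/-- The degree of a rational function. -/
def ratDegree (φ : RatFunc K) : ℕ := max φ.num.natDegree φ.denom.natDegree

/-- A homogeneous lift `K² → K²` of a rational function `φ = P / Q` (in lowest terms) of degree
`d`: `(x, y) ↦ (y ^ d P(x / y), y ^ d Q(x / y))`. -/
def ratLift (φ : RatFunc K) (v : Fin 2 → K) : Fin 2 → K :=
  ![MvPolynomial.eval v (φ.num.homogenize (ratDegree φ)),
    MvPolynomial.eval v (φ.denom.homogenize (ratDegree φ))]

theorem eval_smul_of_isHomogeneous {G : MvPolynomial (Fin 2) K} {d : ℕ} (hG : G.IsHomogeneous d)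
    (t : K) (v : Fin 2 → K) :
    MvPolynomial.eval (t • v) G = t ^ d * MvPolynomial.eval v G := by
  rw [MvPolynomial.eval_eq', MvPolynomial.eval_eq', Finset.mul_sum]
  refine Finset.sum_congr rfl fun m hm => ?_
  have hd : m.weight 1 = d := hG (MvPolynomial.mem_support_iff.1 hm)
  rw [← hd]
  simp only [Finsupp.weight_apply, Finsupp.sum_fintype, Fin.prod_univ_two, Fin.sum_univ_two,
    Pi.smul_apply, smul_eq_mul, Pi.one_apply, mul_one, implies_true]
  ring

theorem ratLift_smul (φ : RatFunc K) (t : K) (v : Fin 2 → K) :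
    ratLift φ (t • v) = t ^ ratDegree φ • ratLift φ v := by
  unfold ratLift
  rw [eval_smul_of_isHomogeneous (Polynomial.isHomogeneous_homogenize _),
    eval_smul_of_isHomogeneous (Polynomial.isHomogeneous_homogenize _)]
  ext i
  fin_cases i <;> simp

theorem eval_homogenize_one (p : Polynomial K) {n : ℕ} (hn : p.natDegree ≤ n) (x : K) :
    MvPolynomial.eval ![x, 1] (p.homogenize n) = p.eval x := by
  have := Polynomial.eval₂_homogenize_of_eq_one hn (RingHom.id K) ![x, 1] rfl
  simpa [MvPolynomial.eval₂_id] using this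

theorem eval_homogenize_zero (p : Polynomial K) (n : ℕ) :
    MvPolynomial.eval ![1, 0] (p.homogenize n) = p.coeff n := by
  rw [Polynomial.homogenize, map_sum, Finset.sum_eq_single (n, 0)]
  · simp [MvPolynomial.eval_monomial, Finsupp.prod_fintype, Fin.prod_univ_two]
  · rintro ⟨a, b⟩ hab hne
    have hb : b ≠ 0 := by
      rintro rfl
      simp at hab
      exact hne (by simp [hab])
    simp [MvPolynomial.eval_monomial, Finsupp.prod_fintype, Fin.prod_univ_two, hb]
  · simp

theorem ratLift_ne_zero (φ : RatFunc K) {v : Fin 2 → K} (hv : v ≠ 0) : ratLift φ v ≠ 0 := by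
  by_cases h1 : v 1 = 0
  · have h0 : v 0 ≠ 0 := fun h0 => hv (by ext i; fin_cases i <;> simp [h0, h1])
    have e : v = v 0 • ![1, 0] := by ext i; fin_cases i <;> simp [h1]
    rw [e, ratLift_smul]
    refine smul_ne_zero (pow_ne_zero _ h0) fun h => ?_
    have hn := congrFun h 0
    have hd := congrFun h 1
    simp only [ratLift, Matrix.cons_val_zero, Matrix.cons_val_one, Pi.zero_apply,
      eval_homogenize_zero] at hn hd
    rcases le_total φ.num.natDegree φ.denom.natDegree with hle | hle
    · rw [ratDegree, max_eq_right hle, Polynomial.coeff_natDegree,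
        Polynomial.leadingCoeff_eq_zero] at hd
      exact φ.denom_ne_zero hd
    · rw [ratDegree, max_eq_left hle] at hn hd
      rw [Polynomial.coeff_natDegree, Polynomial.leadingCoeff_eq_zero] at hn
      rw [hn, Polynomial.natDegree_zero] at hle hd
      rw [← Nat.le_zero.1 hle, Polynomial.coeff_natDegree, Polynomial.leadingCoeff_eq_zero] at hd
      exact φ.denom_ne_zero hd
  · have e : v = v 1 • ![v 0 / v 1, 1] := by
      ext i; fin_cases i <;> simp [mul_div_cancel₀ _ h1]
    rw [e, ratLift_smul]
    refine smul_ne_zero (pow_ne_zero _ h1) fun h => ?_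
    have hn := congrFun h 0
    have hd := congrFun h 1
    simp only [ratLift, Matrix.cons_val_zero, Matrix.cons_val_one, Pi.zero_apply] at hn hd
    rw [ratDegree, eval_homogenize_one _ (le_max_left _ _)] at hn
    rw [ratDegree, eval_homogenize_one _ (le_max_right _ _)] at hd
    obtain ⟨a, b, hab⟩ := φ.isCoprime_num_denom
    have := congrArg (Polynomial.eval (v 0 / v 1)) hab
    simp [hn, hd] at this

/-- The self-map of `ℙ¹(K)` given by a rational function; `[x : 1]` is the point `x ∈ K` and
`[1 : 0]` is the point at infinity. -/
def ratMap (φ : RatFunc K) : ℙ K (Fin 2 → K) → ℙ K (Fin 2 → K) :=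
  Projectivization.lift
    (fun v : {v : Fin 2 → K // v ≠ 0} =>
      Projectivization.mk K (ratLift φ v.1) (ratLift_ne_zero φ v.2))
    (by
      intro a b t h
      rw [Projectivization.mk_eq_mk_iff']
      exact ⟨t ^ ratDegree φ, by rw [h, ratLift_smul]⟩)

end Rational

/-! ### The Berkovich projective line -/

section Berkovich

variable (K : Type*) [NormedField K]

/-- The multiplicative seminorms on `K[X, Y]` which extend the absolute value of `K` and do not
vanish identically on the ideal `(X, Y)`; that is, the points of the Berkovich affine plane other
than the origin. -/
def ConeSeminorm : Type _ :=
  {N : MulRingSeminorm (MvPolynomial (Fin 2) K) //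
    (∀ c : K, N (MvPolynomial.C c) = ‖c‖) ∧ ∃ i : Fin 2, N (MvPolynomial.X i) ≠ 0}

/-- The topology of pointwise convergence. -/
instance : TopologicalSpace (ConeSeminorm K) :=
  TopologicalSpace.induced (fun N (G : MvPolynomial (Fin 2) K) => N.1 G) inferInstance

/-- Two seminorms define the same point of the Berkovich projective line if for some `c > 0` they
differ by the factor `c ^ d` on all homogeneous polynomials of degree `d`, for every `d`. -/
def coneSetoid : Setoid (ConeSeminorm K) where
  r N M := ∃ c : ℝ, 0 < c ∧ ∀ (d : ℕ) (G : MvPolynomial (Fin 2) K), G.IsHomogeneous d →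
    N.1 G = c ^ d * M.1 G
  iseqv :=
    { refl := fun N => ⟨1, one_pos, by simp⟩
      symm := by
        rintro N M ⟨c, hc, h⟩
        refine ⟨c⁻¹, inv_pos.2 hc, fun d G hG => ?_⟩
        rw [h d G hG, ← mul_assoc, ← mul_pow, inv_mul_cancel₀ hc.ne', one_pow, one_mul]
      trans := by
        rintro N M L ⟨c, hc, h⟩ ⟨c', hc', h'⟩
        refine ⟨c * c', mul_pos hc hc', fun d G hG => ?_⟩
        rw [h d G hG, h' d G hG, mul_pow, mul_assoc] }

/-- The Berkovich projective line over `K`: classes of multiplicative seminorms on `K[X, Y]`. -/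
def BerkovichP1 : Type _ := Quotient (coneSetoid K)

/-- The Berkovich topology, the quotient of the topology of pointwise convergence. -/
instance : TopologicalSpace (BerkovichP1 K) :=
  inferInstanceAs (TopologicalSpace (Quotient (coneSetoid K)))

variable {K}

/-- The seminorm `G ↦ |G(v)|` attached to a point `v` of `K² ∖ {0}`. -/
def evalSeminorm (v : {v : Fin 2 → K // v ≠ 0}) : ConeSeminorm K :=
  ⟨{ toFun := fun G => ‖MvPolynomial.eval v.1 G‖
     map_zero' := by simp
     add_le' := fun F G => by simpa using norm_add_le _ _
     neg' := fun G => by simp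
     map_one' := by simp
     map_mul' := fun F G => by simp },
    fun c => by
      change ‖MvPolynomial.eval v.1 (MvPolynomial.C c)‖ = ‖c‖
      simp,
    by
      obtain ⟨i, hi⟩ := Function.ne_iff.1 v.2
      refine ⟨i, ?_⟩
      change ‖MvPolynomial.eval v.1 (MvPolynomial.X i)‖ ≠ 0
      simpa using hi⟩

/-- The canonical inclusion of `ℙ¹(K)` into the Berkovich projective line. -/
def toBerkovich : ℙ K (Fin 2 → K) → BerkovichP1 K :=
  Projectivization.lift (fun v => Quotient.mk (coneSetoid K) (evalSeminorm v))
    (by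
      intro a b t h
      refine Quotient.sound ⟨‖t‖, norm_pos_iff.2 (ne_zero_of_eq_smul h), fun d G hG => ?_⟩
      change ‖MvPolynomial.eval a.1 G‖ = ‖t‖ ^ d * ‖MvPolynomial.eval b.1 G‖
      rw [h, eval_smul_of_isHomogeneous hG, norm_mul, norm_pow])

end Berkovich

end BerkovichChordal

end

open scoped LinearAlgebra.Projectivization

noncomputable section

namespace BerkovichChordal

/-! ### The norm on pairs of nonnegative reals underlying `norm2` -/

section PairNorm

variable (K : Type*) [NormedField K]

open Classical in
/-- The norm `norm2` as a function of the absolute values of the two coordinates. -/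
def pairNorm (a b : ℝ) : ℝ :=
  if IsUltrametricDist K then max a b else Real.sqrt (a ^ 2 + b ^ 2)

theorem pairNorm_mul {c : ℝ} (hc : 0 ≤ c) (a b : ℝ) :
    pairNorm K (c * a) (c * b) = c * pairNorm K a b := by
  unfold pairNorm
  split_ifs
  · rw [mul_max_of_nonneg _ _ hc]
  · rw [show (c * a) ^ 2 + (c * b) ^ 2 = c ^ 2 * (a ^ 2 + b ^ 2) by ring,
      Real.sqrt_mul (by positivity), Real.sqrt_sq hc]

theorem pairNorm_ne_zero {a b : ℝ} (ha : 0 ≤ a) (hb : 0 ≤ b) (h : ¬(a = 0 ∧ b = 0)) :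
    pairNorm K a b ≠ 0 := by
  unfold pairNorm
  split_ifs
  · intro hm
    exact h ⟨le_antisymm (hm ▸ le_max_left a b) ha, le_antisymm (hm ▸ le_max_right a b) hb⟩
  · intro hs
    rw [Real.sqrt_eq_zero (by positivity)] at hs
    exact h ⟨by nlinarith, by nlinarith⟩

theorem continuous_pairNorm : Continuous fun x : ℝ × ℝ => pairNorm K x.1 x.2 := by
  unfold pairNorm
  split_ifs <;> fun_prop

end PairNorm

/-! ### The homogeneous lift of a rational function has no common zero on the cone -/

section Homogenize

variable {K : Type*} [Field K]

theorem X_one_dvd_homogenize_sub (p : Polynomial K) (n : ℕ) :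
    (MvPolynomial.X 1 : MvPolynomial (Fin 2) K) ∣
      p.homogenize n - MvPolynomial.C (p.coeff n) * MvPolynomial.X 0 ^ n := by
  rw [Polynomial.homogenize, Finset.Nat.sum_antidiagonal_eq_sum_range_succ_mk,
    Finset.sum_range_succ]
  have hlast : (MvPolynomial.monomial ((Finsupp.single (0 : Fin 2) n).update 1 (n - n))
      (p.coeff n) : MvPolynomial (Fin 2) K) =
        MvPolynomial.C (p.coeff n) * MvPolynomial.X 0 ^ n := by
    rw [MvPolynomial.C_mul_X_pow_eq_monomial]
    refine congrArg (fun m => MvPolynomial.monomial m (p.coeff n)) ?_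
    ext i
    fin_cases i <;> simp
  rw [hlast, add_sub_cancel_right]
  refine Finset.dvd_sum fun k hk => MvPolynomial.X_dvd_monomial.2 (Or.inr ?_)
  have := Finset.mem_range.1 hk
  simp
  omega

theorem exists_X_one_pow_eq_homogenize (φ : RatFunc K) :
    ∃ (k : ℕ) (A B : MvPolynomial (Fin 2) K),
      A * φ.num.homogenize (ratDegree φ) + B * φ.denom.homogenize (ratDegree φ) =
        MvPolynomial.X 1 ^ k := by
  obtain ⟨a, b, hab⟩ := φ.isCoprime_num_denom
  refine ⟨max a.natDegree b.natDegree + ratDegree φ, a.homogenize (max a.natDegree b.natDegree),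
    b.homogenize (max a.natDegree b.natDegree), ?_⟩
  rw [← Polynomial.homogenize_mul _ _ (le_max_left _ _)
      (show _ ≤ ratDegree φ from le_max_left _ _),
    ← Polynomial.homogenize_mul _ _ (le_max_right _ _)
      (show _ ≤ ratDegree φ from le_max_right _ _),
    ← Polynomial.homogenize_add, hab, Polynomial.homogenize_one]

theorem coeff_ratDegree_ne_zero (φ : RatFunc K) :
    ¬(φ.num.coeff (ratDegree φ) = 0 ∧ φ.denom.coeff (ratDegree φ) = 0) := by
  rintro ⟨hn, hd⟩
  have hv : (![1, 0] : Fin 2 → K) ≠ 0 := fun h => one_ne_zero (congrFun h 0)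
  refine ratLift_ne_zero φ hv ?_
  ext i
  fin_cases i <;> simp [ratLift, eval_homogenize_zero, hn, hd]

end Homogenize

/-! ### Extension to the Berkovich projective line -/

section Extension

variable {K : Type*} [NormedField K]

theorem seminorm_add_eq_zero {R : Type*} [Ring R] (N : MulRingSeminorm R) {F G : R}
    (hF : N F = 0) (hG : N G = 0) : N (F + G) = 0 :=
  le_antisymm ((map_add_le_add N F G).trans (by simp [hF, hG])) (apply_nonneg N _)

theorem continuous_coneSeminorm_apply (G : MvPolynomial (Fin 2) K) :
    Continuous fun N : ConeSeminorm K => N.1 G :=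
  (continuous_apply G).comp continuous_induced_dom

/-- The two homogeneous components of a lift of `φ` do not vanish simultaneously at any point of
the Berkovich cone. -/
theorem coneSeminorm_ratLift_ne_zero (N : ConeSeminorm K) (φ : RatFunc K) :
    ¬(N.1 (φ.num.homogenize (ratDegree φ)) = 0 ∧
      N.1 (φ.denom.homogenize (ratDegree φ)) = 0) := by
  rintro ⟨hP, hQ⟩
  have hY : N.1 (MvPolynomial.X 1) = 0 := by
    obtain ⟨k, A, B, h⟩ := exists_X_one_pow_eq_homogenize φ
    have h0 : N.1 (MvPolynomial.X 1 ^ k) = 0 := by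
      rw [← h]
      exact seminorm_add_eq_zero _ (by simp [hP]) (by simp [hQ])
    rw [map_pow] at h0
    exact eq_zero_of_pow_eq_zero h0
  have hX : N.1 (MvPolynomial.X 0) ≠ 0 := by
    obtain ⟨i, hi⟩ := N.2.2
    fin_cases i
    · exact hi
    · exact absurd hY hi
  have key : ∀ p : Polynomial K, N.1 (p.homogenize (ratDegree φ)) = 0 →
      p.coeff (ratDegree φ) = 0 := by
    intro p hp
    obtain ⟨R, hR⟩ := X_one_dvd_homogenize_sub p (ratDegree φ)
    have h0 : N.1 (MvPolynomial.C (p.coeff (ratDegree φ)) *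
        MvPolynomial.X 0 ^ ratDegree φ) = 0 := by
      rw [← sub_sub_cancel (p.homogenize (ratDegree φ)) (MvPolynomial.C _ * _), hR,
        sub_eq_add_neg]
      exact seminorm_add_eq_zero _ hp (by rw [map_neg_eq_map, map_mul, hY, zero_mul])
    rw [map_mul, map_pow, N.2.1] at h0
    simpa [hX] using h0
  exact coeff_ratDegree_ne_zero φ ⟨key _ hP, key _ hQ⟩

/-- The norm of the homogeneous lift of `φ`, as a function on the Berkovich cone. -/
def coneLiftNorm (φ : RatFunc K) (N : ConeSeminorm K) : ℝ :=
  pairNorm K (N.1 (φ.num.homogenize (ratDegree φ))) (N.1 (φ.denom.homogenize (ratDegree φ)))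

theorem coneLiftNorm_ne_zero (φ : RatFunc K) (N : ConeSeminorm K) : coneLiftNorm φ N ≠ 0 :=
  pairNorm_ne_zero K (apply_nonneg _ _) (apply_nonneg _ _) (coneSeminorm_ratLift_ne_zero N φ)

theorem continuous_coneLiftNorm (φ : RatFunc K) :
    Continuous (coneLiftNorm φ : ConeSeminorm K → ℝ) :=
  (continuous_pairNorm K).comp
    ((continuous_coneSeminorm_apply _).prodMk (continuous_coneSeminorm_apply _))

/-- The wedge product of the homogeneous lifts of two rational functions. -/
def wedgeLift (φ₁ φ₂ : RatFunc K) : MvPolynomial (Fin 2) K :=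
  φ₁.num.homogenize (ratDegree φ₁) * φ₂.denom.homogenize (ratDegree φ₂) -
    φ₁.denom.homogenize (ratDegree φ₁) * φ₂.num.homogenize (ratDegree φ₂)

theorem isHomogeneous_wedgeLift (φ₁ φ₂ : RatFunc K) :
    (wedgeLift φ₁ φ₂).IsHomogeneous (ratDegree φ₁ + ratDegree φ₂) :=
  ((Polynomial.isHomogeneous_homogenize _).mul (Polynomial.isHomogeneous_homogenize _)).sub
    ((Polynomial.isHomogeneous_homogenize _).mul (Polynomial.isHomogeneous_homogenize _))

/-- The chordal proximity of two rational functions as a function on the Berkovich cone. -/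
def coneProximity (φ₁ φ₂ : RatFunc K) (N : ConeSeminorm K) : ℝ :=
  N.1 (wedgeLift φ₁ φ₂) / (coneLiftNorm φ₁ N * coneLiftNorm φ₂ N)

theorem continuous_coneProximity (φ₁ φ₂ : RatFunc K) :
    Continuous (coneProximity φ₁ φ₂ : ConeSeminorm K → ℝ) :=
  (continuous_coneSeminorm_apply _).div₀
    ((continuous_coneLiftNorm φ₁).mul (continuous_coneLiftNorm φ₂))
    fun N => mul_ne_zero (coneLiftNorm_ne_zero φ₁ N) (coneLiftNorm_ne_zero φ₂ N)

theorem coneProximity_eq_of_rel (φ₁ φ₂ : RatFunc K) {N M : ConeSeminorm K}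
    (h : (coneSetoid K).r N M) : coneProximity φ₁ φ₂ N = coneProximity φ₁ φ₂ M := by
  obtain ⟨c, hc, h⟩ := h
  have hnorm : ∀ φ : RatFunc K, coneLiftNorm φ N = c ^ ratDegree φ * coneLiftNorm φ M := by
    intro φ
    unfold coneLiftNorm
    rw [h _ _ (Polynomial.isHomogeneous_homogenize φ.num),
      h _ _ (Polynomial.isHomogeneous_homogenize φ.denom), pairNorm_mul K (by positivity)]
  unfold coneProximity
  rw [h _ _ (isHomogeneous_wedgeLift φ₁ φ₂), hnorm, hnorm, mul_mul_mul_comm, ← pow_add,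
    mul_div_mul_left _ _ (by positivity)]

/-- The continuous extension of `z ↦ [φ₁(z), φ₂(z)]` to the Berkovich projective line. -/
def canProximity (φ₁ φ₂ : RatFunc K) : BerkovichP1 K → ℝ :=
  Quotient.lift (coneProximity φ₁ φ₂) fun _ _ h => coneProximity_eq_of_rel φ₁ φ₂ h

theorem continuous_canProximity (φ₁ φ₂ : RatFunc K) :
    Continuous (canProximity φ₁ φ₂ : BerkovichP1 K → ℝ) :=
  (continuous_coneProximity φ₁ φ₂).quotient_lift _

theorem canProximity_toBerkovich (φ₁ φ₂ : RatFunc K) (z : ℙ K (Fin 2 → K)) :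
    canProximity φ₁ φ₂ (toBerkovich z) = chordal (ratMap φ₁ z) (ratMap φ₂ z) := by
  induction z using Projectivization.ind with
  | h v hv =>
    have hw : (evalSeminorm ⟨v, hv⟩).1 (wedgeLift φ₁ φ₂) =
        ‖wedge (ratLift φ₁ v) (ratLift φ₂ v)‖ := by
      change ‖MvPolynomial.eval v (wedgeLift φ₁ φ₂)‖ = _
      simp [wedgeLift, wedge, ratLift]
    change (evalSeminorm ⟨v, hv⟩).1 (wedgeLift φ₁ φ₂) /
        (norm2 (ratLift φ₁ v) * norm2 (ratLift φ₂ v)) =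
      ‖wedge (ratLift φ₁ v) (ratLift φ₂ v)‖ / (norm2 (ratLift φ₁ v) * norm2 (ratLift φ₂ v))
    rw [hw]

end Extension

end BerkovichChordal

end

/-- For rational functions `φ₁ ≠ φ₂` over `K`, not both constant, the function
`z ↦ [φ₁(z), φ₂(z)]` on `ℙ¹(K)` extends to a continuous function on the Berkovich projective
line. -/
theorem chordal_proximity_extends_continuously {K : Type*} [NontriviallyNormedField K]
    [CompleteSpace K] [IsAlgClosed K] (φ₁ φ₂ : RatFunc K) (hne : φ₁ ≠ φ₂)
    (hdeg : 0 < max (BerkovichChordal.ratDegree φ₁) (BerkovichChordal.ratDegree φ₂)) :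
    ∃ g : BerkovichChordal.BerkovichP1 K → ℝ, Continuous g ∧
      ∀ z : ℙ K (Fin 2 → K), g (BerkovichChordal.toBerkovich z) =
        BerkovichChordal.chordal (BerkovichChordal.ratMap φ₁ z) (BerkovichChordal.ratMap φ₂ z) := by
  exact ⟨BerkovichChordal.canProximity φ₁ φ₂, BerkovichChordal.continuous_canProximity φ₁ φ₂,
    BerkovichChordal.canProximity_toBerkovich φ₁ φ₂⟩
end

section
/- Let $K$ be an algebraically closed field of characteristic $0$, complete with respect to a non-trivial (possibly non-archimedean) absolute value $|\cdot|$, and let $f\in K(z)$ be a rational function of degree $d>1$, acting on $\mathbb{P}^1=\mathbb{P}^1(K)$ with iterates $f^n$. Let $\|\cdot\|$ be the maximum norm on $K^2$ if $K$ is non-archimedean and the Euclidean norm $\sqrt{|p_0|^2+|p_1|^2}$ if $K$ is archimedean, and let $[z,w]=|p_0q_1-p_1q_0|/(\|p\|\,\|q\|)$, for $p,q\in K^2\setminus\{0\}$ over $z,w\in\mathbb{P}^1$, be the normalized chordal metric. Let $\mathsf{P}^1$ be the Berkovich projective line over $K$ (equal to $\mathbb{P}^1$ for archimedean $K$), and $[\cdot,\cdot]_{\mathrm{can}}$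 the generalized Hsia kernel on $\mathsf{P}^1$ extending $[\cdot,\cdot]$. For a continuous function $g$ on $\mathsf{P}^1$ put $\Phi_g(\mathcal S,\mathcal S')=\log[\mathcal S,\mathcal S']_{\mathrm{can}}-g(\mathcal S)-g(\mathcal S')$, and let $V_g$ be the supremum of $\int\Phi_g\,\mathrm d(\nu\times\nu)$ over all probability Radon measures $\nu$ on $\mathsf{P}^1$. Let $F=(F_0,F_1)$ be a non-degenerate homogeneous lift of $f$ to $K^2$, i.e. a pair of homogeneous polynomials of degree $d$ over $K$ without common zero in $K^2\setminus\{0\}$ which induces $f$ on $\mathbb{P}^1$. Let $g_F=\lim_{n\to\infty}d^{-n}(\log\|F^n\|-d^n\log\|\cdot\|)$, a function on $\mathbb{P}^1$ extended continuously to $\mathsf{P}^1$, and let $g_f=g_F+V_{g_F}/2$ be the dynamical Green function of $f$, which does not depend on the choice of $F$. For $n\ge 1$ let $\mathrm{Fix}(f^n)$ be the set of fixed points and $C(f^n)$ the set of critical points of $f^n$ in $\mathbb{P}^1$, the multiplicity of $c\in C(f^n)$ being the order of vanishing at $c$ of the Jacobian determinant $\det D(F^n)$ (so that $f^n$ has $2d^n-2$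 critical points with multiplicity), and let $\mathit{SAT}(f)=\bigcup_{n\ge 1}(\mathrm{Fix}(f^n)\cap C(f^n))$ be the set of superattracting periodic points of $f$. Then $$\frac{1}{n d^n}\sum_{c\in (C(f^n)\setminus \mathrm{Fix}(f^n))\,\cap\,\bigcup_{j=0}^{n-1}f^{-j}(C(f)\setminus \mathit{SAT}(f))}\Phi_{g_f}(f^n(c),c)=O(1)\quad\text{as }n\to\infty,$$ where each $c$ in the sum is counted with its multiplicity as a critical point of $f^n$. -/
open scoped OnePoint ENNReal
open MeasureTheory Filter

noncomputable section

namespace BerkDyn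

variable (K : Type*) [NontriviallyNormedField K]

/-! ### The classical and the Berkovich projective line -/

/-- The classical projective line `ℙ¹(K) = K ∪ {∞}`. -/
abbrev P1 : Type _ := OnePoint K

/-- The Berkovich affine line: the multiplicative seminorms on the polynomial ring `K[z]`
which extend the absolute value of `K`. -/
def BerkA1 : Type _ :=
  {x : MulRingSeminorm (Polynomial K) // ∀ a : K, x (Polynomial.C a) = ‖a‖}

/-- The topology of pointwise convergence. -/
instance : TopologicalSpace (BerkA1 K) :=
  TopologicalSpace.induced (fun x (p : Polynomial K) => x.1 p) inferInstance

/-- The Berkovich projective line, the one-point compactification of the Berkovich affine line.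
For archimedean `K`, every point of the Berkovich affine line is the evaluation seminorm
`p ↦ ‖p(a)‖` at a unique `a ∈ K`, so that this is `ℙ¹(K)`. -/
abbrev BerkP1 : Type _ := OnePoint (BerkA1 K)

instance : MeasurableSpace (BerkP1 K) := borel _

instance : BorelSpace (BerkP1 K) := ⟨rfl⟩

variable {K}

/-- The evaluation seminorm `p ↦ ‖p(a)‖` at `a ∈ K`. -/
def evalSeminorm (a : K) : BerkA1 K :=
  ⟨{ toFun := fun p => ‖p.eval a‖
     map_zero' := by simp
     add_le' := fun p q => by simpa using norm_add_le _ _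
     neg' := fun p => by simp
     map_one' := by simp
     map_mul' := fun p q => by simp },
   fun b => by change ‖(Polynomial.C b).eval a‖ = ‖b‖; simp⟩

/-- The inclusion of `ℙ¹` in the Berkovich projective line. -/
def incl (z : P1 K) : BerkP1 K := OnePoint.map evalSeminorm z

/-- A point of `K² \ {0}` over `z ∈ ℙ¹`: `(a, 1)` over `a ∈ K` and `(1, 0)` over `∞`. -/
def rep (z : P1 K) : Fin 2 → K := z.elim ![1, 0] fun a => ![a, 1]

/-- The canonical projection `π : K² \ {0} → ℙ¹`. -/
def proj (p : Fin 2 → K) : P1 K :=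
  open Classical in if p 1 = 0 then ∞ else ((p 0 / p 1 : K) : P1 K)

/-- For a homogeneous polynomial `G` in two variables and a point `x` of the Berkovich
projective line, the value at `x` of `|G|` in homogeneous coordinates, which are normalized to
`(z, 1)` on the affine line and to `(1, 0)` at `∞`. -/
def hval (x : BerkP1 K) (G : MvPolynomial (Fin 2) K) : ℝ :=
  x.elim ‖MvPolynomial.eval ![1, 0] G‖
    fun y => y.1 (MvPolynomial.aeval ![Polynomial.X, 1] G)

variable (K) in
/-- The norm of a vector of `K²` whose coordinates have absolute values `s` and `t`: the maximum
norm for non-archimedean `K`, the Euclidean norm for archimedean `K`. -/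
def nrm (s t : ℝ) : ℝ :=
  open Classical in if IsUltrametricDist K then max s t else √(s ^ 2 + t ^ 2)

/-! ### The chordal metric and the generalized Hsia kernel -/

/-- The normalized chordal metric `[z, w] = |p ∧ q| / (‖p‖ ‖q‖)` on `ℙ¹`. -/
def chordal (z w : P1 K) : ℝ :=
  ‖rep z 0 * rep w 1 - rep z 1 * rep w 0‖ /
    (nrm K ‖rep z 0‖ ‖rep z 1‖ * nrm K ‖rep w 0‖ ‖rep w 1‖)

/-- The Hsia kernel relative to `∞` on the Berkovich affine line. For non-archimedean `K`, it is
the diameter of the smallest disk containing both points, where `|z - a|_x` is the diameter of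
the smallest disk containing `x` and `a`. For archimedean `K`, it is the distance of the two
points. -/
def hsiaInfty (x y : BerkA1 K) : ℝ :=
  open Classical in
  if IsUltrametricDist K then
    ⨅ a : K, max (x.1 (Polynomial.X - Polynomial.C a)) (y.1 (Polynomial.X - Polynomial.C a))
  else
    ⨅ a : K, (x.1 (Polynomial.X - Polynomial.C a) + y.1 (Polynomial.X - Polynomial.C a))

/-- The norm of the homogeneous coordinates `(z, 1)` at a point of the Berkovich affine line. -/
def affNrm (x : BerkA1 K) : ℝ := nrm K (x.1 Polynomial.X) 1

/-- The generalized Hsia kernel `[x, y]_can` on the Berkovich projective line. -/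
def hsia (x y : BerkP1 K) : ℝ :=
  x.elim
    (y.elim 0 fun y' => 1 / affNrm y')
    fun x' => y.elim (1 / affNrm x') fun y' => hsiaInfty x' y' / (affNrm x' * affNrm y')

theorem hsiaInfty_evalSeminorm (a b : K) :
    hsiaInfty (evalSeminorm a) (evalSeminorm b) = ‖a - b‖ := by
  have h : ∀ a c : K, (evalSeminorm a).1 (Polynomial.X - Polynomial.C c) = ‖a - c‖ := by
    intro a c
    change ‖(Polynomial.X - Polynomial.C c).eval a‖ = _
    simp
  unfold hsiaInfty
  simp only [h]
  split_ifs with hK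
  · apply le_antisymm
    · refine (ciInf_le ⟨0, ?_⟩ b).trans (by simp)
      rintro _ ⟨c, rfl⟩
      positivity
    · refine le_ciInf fun c => ?_
      have := dist_triangle_max a c b
      rw [dist_eq_norm, dist_eq_norm, dist_comm, dist_eq_norm] at this
      simpa using this
  · apply le_antisymm
    · refine (ciInf_le ⟨0, ?_⟩ b).trans (by simp)
      rintro _ ⟨c, rfl⟩
      positivity
    · refine le_ciInf fun c => ?_
      have := norm_sub_le (a - c) (b - c)
      simpa using this

/-- The generalized Hsia kernel extends the normalized chordal metric. -/
theorem hsia_incl (z w : P1 K) : hsia (incl z) (incl w) = chordal z w := by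
  have hX : ∀ a : K, affNrm (evalSeminorm a) = nrm K ‖a‖ 1 := by
    intro a
    change nrm K ‖(Polynomial.X : Polynomial K).eval a‖ 1 = _
    simp
  have h1 : nrm K 1 0 = 1 := by unfold nrm; split_ifs <;> simp
  induction z using OnePoint.rec <;> induction w using OnePoint.rec <;>
    simp [hsia, incl, chordal, rep, hX, h1, hsiaInfty_evalSeminorm]

/-! ### Weighted potential theory -/

/-- The potential kernel `Φ_g(x, y) = log [x, y]_can - g(x) - g(y)`. It is used only
for `[x, y]_can ≠ 0`. -/
def Phi (g : BerkP1 K → ℝ) (x y : BerkP1 K) : ℝ := Real.log (hsia x y) - g x - g y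

/-- `-log [x, y]_can ∈ [0, ∞]`. -/
def negLogHsia (x y : BerkP1 K) : ℝ≥0∞ :=
  open Classical in if hsia x y = 0 then ⊤ else ENNReal.ofReal (-Real.log (hsia x y))

/-- The energy `∫∫ Φ_g d(ν × ν) = ∫∫ log [x, y]_can dν(x) dν(y) - 2 ∫ g dν ∈ [-∞, ∞)` of a
probability measure `ν`. -/
def energy (g : BerkP1 K → ℝ) (ν : Measure (BerkP1 K)) : EReal :=
  -((∫⁻ x, ∫⁻ y, negLogHsia x y ∂ν ∂ν : ℝ≥0∞) : EReal) - ((2 * ∫ x, g x ∂ν : ℝ) : EReal)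

/-- The equilibrium energy `V_g`: the supremum of the energies of all probability Radon measures
on the Berkovich projective line (it is finite for continuous `g`). -/
def eqEnergy (g : BerkP1 K → ℝ) : ℝ :=
  (⨆ ν : {ν : Measure (BerkP1 K) // IsProbabilityMeasure ν ∧ ν.Regular},
    energy g ν.1).toReal

/-! ### Rational functions -/

/-- The degree of a rational function. -/
def deg (f : RatFunc K) : ℕ := max f.num.natDegree f.denom.natDegree

/-- The non-degenerate homogeneous lift `F = (F₀, F₁)` of `f` given by its reduced numerator and
denominator, homogenized in degree `deg f`. -/
def homLift (f : RatFunc K) : Fin 2 → MvPolynomial (Fin 2) K :=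
  ![f.num.homogenize (deg f), f.denom.homogenize (deg f)]

/-- The `n`-th iterate `Fⁿ` of the lift `F` of `f`, a lift of `fⁿ`. -/
def homLiftIter (f : RatFunc K) : ℕ → Fin 2 → MvPolynomial (Fin 2) K
  | 0 => MvPolynomial.X
  | n + 1 => fun i => MvPolynomial.bind₁ (homLiftIter f n) (homLift f i)

/-- The action of `f` on `ℙ¹`, `f ∘ π = π ∘ F`. -/
def ratMap (f : RatFunc K) (z : P1 K) : P1 K :=
  proj fun i => MvPolynomial.eval (rep z) (homLift f i)

/-- `T_{Fⁿ} = log ‖Fⁿ‖ - dⁿ log ‖·‖` on the Berkovich projective line. -/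
def TIter (f : RatFunc K) (n : ℕ) (x : BerkP1 K) : ℝ :=
  Real.log (nrm K (hval x (homLiftIter f n 0)) (hval x (homLiftIter f n 1))) -
    (deg f : ℝ) ^ n *
      Real.log (nrm K (hval x (MvPolynomial.X 0)) (hval x (MvPolynomial.X 1)))

/-- `g_F = lim_n T_{Fⁿ} / dⁿ` on the Berkovich projective line. -/
def liftGreen (f : RatFunc K) (x : BerkP1 K) : ℝ :=
  limUnder atTop fun n : ℕ => TIter f n x / (deg f : ℝ) ^ n

/-- The dynamical Green function `g_f = g_F + V_{g_F} / 2`, the normalized weight with the same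
curvature measure as `g_F`, that is, the equilibrium measure of `f`. -/
def dynGreen (f : RatFunc K) (x : BerkP1 K) : ℝ := liftGreen f x + eqEnergy (liftGreen f) / 2

/-! ### Fixed points and critical points -/

/-- `Fix(fⁿ)`, the set of fixed points of `fⁿ` in `ℙ¹`. -/
def Fix (f : RatFunc K) (n : ℕ) : Set (P1 K) := {z | (ratMap f)^[n] z = z}

/-- The Jacobian determinant `det D(Fⁿ)` of the lift of `fⁿ`. -/
def jacobian (f : RatFunc K) (n : ℕ) : MvPolynomial (Fin 2) K :=
  Matrix.det (Matrix.of fun i j => MvPolynomial.pderiv j (homLiftIter f n i))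

/-- `C(fⁿ)`, the set of critical points of `fⁿ` in `ℙ¹`. -/
def Crit (f : RatFunc K) (n : ℕ) : Set (P1 K) :=
  {z | MvPolynomial.eval (rep z) (jacobian f n) = 0}

/-- The multiplicity of `c` as a critical point of `fⁿ`: the multiplicity of the linear form
`· ∧ rep c` as a factor of `det D(Fⁿ)`. -/
def critMult (f : RatFunc K) (n : ℕ) (c : P1 K) : ℕ :=
  multiplicity
    (MvPolynomial.X 0 * MvPolynomial.C (rep c 1) - MvPolynomial.X 1 * MvPolynomial.C (rep c 0))
    (jacobian f n)

/-- `SAT(f)`, the set of superattracting periodic points of `f` in `ℙ¹`. -/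
def SAT (f : RatFunc K) : Set (P1 K) := ⋃ n ≥ 1, Fix f n ∩ Crit f n

end BerkDyn

end

noncomputable section

namespace BerkDyn

open MvPolynomial in
/-- Chain rule for a derivation and a polynomial in several variables. -/
theorem derivation_aeval {R A σ : Type*} [CommRing R] [CommRing A] [Algebra R A] [Fintype σ]
    (D : Derivation R A A) (g : σ → A) (φ : MvPolynomial σ R) :
    D (aeval g φ) = ∑ i, aeval g (pderiv i φ) * D (g i) := by
  classical
  induction φ using MvPolynomial.induction_on with
  | C a => simp
  | add p q hp hq => simp [hp, hq, add_mul, Finset.sum_add_distrib]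
  | mul_X p j hp =>
    simp only [map_mul, Derivation.leibniz, hp, aeval_X, smul_eq_mul, pderiv_X, map_add,
      add_mul, Finset.sum_add_distrib, Finset.mul_sum]
    congr 1
    · rw [Finset.sum_eq_single j]
      · simp
      · intro i _ hi
        simp [hi.symm]
      · simp
    · exact Finset.sum_congr rfl fun i _ => by ring

/-- The value of a homogeneous polynomial at a multiple of a point. -/
theorem eval_smul_of_isHomogeneous {R σ : Type*} [CommRing R] [Fintype σ]
    {φ : MvPolynomial σ R} {d : ℕ} (h : φ.IsHomogeneous d) (a : R) (p : σ → R) :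
    MvPolynomial.eval (a • p) φ = a ^ d * MvPolynomial.eval p φ := by
  rw [MvPolynomial.eval_eq', MvPolynomial.eval_eq', Finset.mul_sum]
  refine Finset.sum_congr rfl fun m hm => ?_
  have hd : ∑ i, m i = d := by
    rw [h.degree_eq_sum_deg_support hm]
    exact (Finset.sum_subset (Finset.subset_univ _) fun i _ hi => by simpa using hi).symm
  simp only [Pi.smul_apply, smul_eq_mul, mul_pow, Finset.prod_mul_distrib,
    Finset.prod_pow_eq_pow_sum, hd]
  ring

/-- A homogeneous polynomial in two variables, in terms of its dehomogenization. -/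
theorem eval_eq_sum_range_of_isHomogeneous {R : Type*} [CommRing R]
    {φ : MvPolynomial (Fin 2) R} {d : ℕ} (h : φ.IsHomogeneous d) (p : Fin 2 → R) :
    MvPolynomial.eval p φ = ∑ k ∈ Finset.range (d + 1),
      (MvPolynomial.aeval ![Polynomial.X, 1] φ).coeff k * (p 0 ^ k * p 1 ^ (d - k)) := by
  conv_lhs => rw [← Polynomial.homogenize_eq_of_isHomogeneous h rfl]
  rw [Polynomial.homogenize, Finset.Nat.sum_antidiagonal_eq_sum_range_succ_mk, map_sum]
  refine Finset.sum_congr rfl fun k _ => ?_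
  rw [MvPolynomial.eval_monomial, Finsupp.update_eq_add_single (by simp),
    Finsupp.prod_add_index' (by simp) (by simp [pow_add])]
  simp

/-- The determinant of a pair of vectors of `K²`. -/
def wedge {R : Type*} [CommRing R] (p q : Fin 2 → R) : R := p 0 * q 1 - p 1 * q 0

/-- The polynomial map `K² → K²` with components `G`. -/
def evalMap {R : Type*} [CommRing R] (G : Fin 2 → MvPolynomial (Fin 2) R) (p : Fin 2 → R) :
    Fin 2 → R :=
  fun i => MvPolynomial.eval p (G i)

/-- The Jacobian determinant of a pair of polynomials. -/
def jac {R : Type*} [CommRing R] (G : Fin 2 → MvPolynomial (Fin 2) R) : MvPolynomial (Fin 2) R :=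
  Matrix.det (Matrix.of fun i j => MvPolynomial.pderiv j (G i))

section Ring

variable {R : Type*} [CommRing R]

theorem wedge_smul_left (a : R) (p q : Fin 2 → R) : wedge (a • p) q = a * wedge p q := by
  simp [wedge]; ring

theorem jac_eq (G : Fin 2 → MvPolynomial (Fin 2) R) :
    jac G = MvPolynomial.pderiv 0 (G 0) * MvPolynomial.pderiv 1 (G 1) -
      MvPolynomial.pderiv 1 (G 0) * MvPolynomial.pderiv 0 (G 1) := by
  simp [jac, Matrix.det_fin_two]

theorem evalMap_smul {G : Fin 2 → MvPolynomial (Fin 2) R} {d : ℕ}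
    (hG : ∀ i, (G i).IsHomogeneous d) (a : R) (p : Fin 2 → R) :
    evalMap G (a • p) = a ^ d • evalMap G p := by
  ext i
  simp [evalMap, eval_smul_of_isHomogeneous (hG i)]

theorem isHomogeneous_jac {G : Fin 2 → MvPolynomial (Fin 2) R} {d : ℕ}
    (hG : ∀ i, (G i).IsHomogeneous d) : (jac G).IsHomogeneous ((d - 1) + (d - 1)) := by
  rw [jac_eq]
  exact ((hG 0).pderiv.mul (hG 1).pderiv).sub ((hG 0).pderiv.mul (hG 1).pderiv)

/-- Chain rule for Jacobian determinants. -/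
theorem jac_bind₁ (G H : Fin 2 → MvPolynomial (Fin 2) R) :
    jac (fun i => MvPolynomial.bind₁ H (G i)) = MvPolynomial.bind₁ H (jac G) * jac H := by
  have h : ∀ i j, MvPolynomial.pderiv j (MvPolynomial.bind₁ H (G i)) =
      MvPolynomial.bind₁ H (MvPolynomial.pderiv 0 (G i)) * MvPolynomial.pderiv j (H 0) +
        MvPolynomial.bind₁ H (MvPolynomial.pderiv 1 (G i)) * MvPolynomial.pderiv j (H 1) := by
    intro i j
    have := derivation_aeval (MvPolynomial.pderiv j) H (G i)
    rwa [Fin.sum_univ_two] at this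
  simp only [jac_eq, h, map_sub, map_mul]
  ring

theorem euler_eval {φ : MvPolynomial (Fin 2) R} {d : ℕ} (h : φ.IsHomogeneous d)
    {A : Type*} [CommRing A] [Algebra R A] (p : Fin 2 → A) :
    p 0 * MvPolynomial.aeval p (MvPolynomial.pderiv 0 φ) +
      p 1 * MvPolynomial.aeval p (MvPolynomial.pderiv 1 φ) =
        (d : A) * MvPolynomial.aeval p φ := by
  have := congrArg (MvPolynomial.aeval p) h.sum_X_mul_pderiv
  simpa [Fin.sum_univ_two] using this

end Ring

section Norm

variable {K : Type*} [NontriviallyNormedField K]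

theorem norm_eq_max (p : Fin 2 → K) : ‖p‖ = max ‖p 0‖ ‖p 1‖ := by
  apply le_antisymm
  · refine (pi_norm_le_iff_of_nonneg (by positivity)).2 fun i => ?_
    fin_cases i <;> simp
  · exact max_le (norm_le_pi_norm p 0) (norm_le_pi_norm p 1)

theorem norm_wedge_le (p q : Fin 2 → K) : ‖wedge p q‖ ≤ 2 * (‖p‖ * ‖q‖) := by
  have h := norm_sub_le (p 0 * q 1) (p 1 * q 0)
  rw [norm_mul, norm_mul] at h
  have h1 := mul_le_mul (norm_le_pi_norm p 0) (norm_le_pi_norm q 1) (norm_nonneg _) (norm_nonneg _)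
  have h2 := mul_le_mul (norm_le_pi_norm p 1) (norm_le_pi_norm q 0) (norm_nonneg _) (norm_nonneg _)
  unfold wedge
  linarith

theorem wedge_smul_eq (p q r : Fin 2 → K) :
    wedge p q • r = wedge r q • p + wedge p r • q := by
  ext i
  fin_cases i <;> simp [wedge] <;> ring

theorem exists_norm_eval_le (P : Polynomial K) :
    ∃ B : ℝ, 0 < B ∧ ∀ t : K, ‖t‖ ≤ 1 → ‖P.eval t‖ ≤ B := by
  refine ⟨∑ i ∈ Finset.range (P.natDegree + 1), ‖P.coeff i‖ + 1, by positivity, fun t ht => ?_⟩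
  rw [Polynomial.eval_eq_sum_range]
  refine (norm_sum_le _ _).trans ?_
  refine le_add_of_le_of_nonneg (Finset.sum_le_sum fun i _ => ?_) zero_le_one
  rw [norm_mul, norm_pow]
  exact mul_le_of_le_one_right (norm_nonneg _) (pow_le_one₀ (norm_nonneg _) ht)

theorem norm_pow_sub_pow_le {x y : K} {C : ℝ} (hx : ‖x‖ ≤ C) (hy : ‖y‖ ≤ C) (e : ℕ) :
    ‖x ^ e - y ^ e‖ ≤ e * C ^ (e - 1) * ‖x - y‖ := by
  have hC : 0 ≤ C := (norm_nonneg _).trans hx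
  rw [← geom_sum₂_mul, norm_mul]
  refine mul_le_mul_of_nonneg_right ?_ (norm_nonneg _)
  calc ‖∑ i ∈ Finset.range e, x ^ i * y ^ (e - 1 - i)‖
      ≤ ∑ i ∈ Finset.range e, C ^ (e - 1) := by
        refine norm_sum_le_of_le _ fun i hi => ?_
        have hi' : i ≤ e - 1 := by have := Finset.mem_range.1 hi; omega
        calc ‖x ^ i * y ^ (e - 1 - i)‖ ≤ C ^ i * C ^ (e - 1 - i) := by
              rw [norm_mul, norm_pow, norm_pow]; gcongr
          _ = C ^ (e - 1) := by rw [← pow_add, Nat.add_sub_cancel' hi']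
    _ = e * C ^ (e - 1) := by simp

theorem norm_monomial_wedge_le (p q : Fin 2 → K) {d k l : ℕ} (hk : k ≤ d) (hl : l ≤ d) :
    ‖p 0 ^ k * p 1 ^ (d - k) * (q 0 ^ l * q 1 ^ (d - l)) -
      p 0 ^ l * p 1 ^ (d - l) * (q 0 ^ k * q 1 ^ (d - k))‖ ≤
        d * ‖wedge p q‖ * (‖p‖ * ‖q‖) ^ (d - 1) := by
  wlog hlk : l ≤ k generalizing k l
  · rw [norm_sub_rev]
    exact this hl hk (by omega)
  obtain ⟨e, rfl⟩ := Nat.exists_eq_add_of_le hlk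
  obtain ⟨s, rfl⟩ := Nat.exists_eq_add_of_le hk
  have hb : ∀ i j, ‖p i * q j‖ ≤ ‖p‖ * ‖q‖ := fun i j => by
    rw [norm_mul]
    exact mul_le_mul (norm_le_pi_norm _ _) (norm_le_pi_norm _ _) (norm_nonneg _) (norm_nonneg _)
  rcases Nat.eq_zero_or_pos e with rfl | he
  · simp; positivity
  have h1 : l + e + s - (l + e) = s := by omega
  have h2 : l + e + s - l = e + s := by omega
  have key : p 0 ^ (l + e) * p 1 ^ s * (q 0 ^ l * q 1 ^ (e + s)) -
      p 0 ^ l * p 1 ^ (e + s) * (q 0 ^ (l + e) * q 1 ^ s) =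
      (p 0 * q 0) ^ l * (p 1 * q 1) ^ s * ((p 0 * q 1) ^ e - (p 1 * q 0) ^ e) := by ring
  rw [h1, h2, key, norm_mul, norm_mul, norm_pow, norm_pow]
  calc ‖p 0 * q 0‖ ^ l * ‖p 1 * q 1‖ ^ s * ‖(p 0 * q 1) ^ e - (p 1 * q 0) ^ e‖
      ≤ (‖p‖ * ‖q‖) ^ l * (‖p‖ * ‖q‖) ^ s *
          (e * (‖p‖ * ‖q‖) ^ (e - 1) * ‖p 0 * q 1 - p 1 * q 0‖) := by
        gcongr
        · exact hb _ _
        · exact hb _ _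
        · exact norm_pow_sub_pow_le (hb _ _) (hb _ _) e
    _ = e * ‖wedge p q‖ * (‖p‖ * ‖q‖) ^ (l + e + s - 1) := by
        rw [show l + e + s - 1 = l + s + (e - 1) by omega, wedge]; ring
    _ ≤ _ := by
        gcongr
        omega

variable {G : Fin 2 → MvPolynomial (Fin 2) K} {d : ℕ}

theorem exists_norm_evalMap_le (hG : ∀ i, (G i).IsHomogeneous d) :
    ∃ M : ℝ, 0 < M ∧ ∀ p, ‖evalMap G p‖ ≤ M * ‖p‖ ^ d := by
  set a : Fin 2 → ℕ → K := fun i k => (MvPolynomial.aeval ![Polynomial.X, 1] (G i)).coeff k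
  set S : ℝ := ∑ i, ∑ k ∈ Finset.range (d + 1), ‖a i k‖
  refine ⟨S + 1, by positivity, fun p => ?_⟩
  refine (pi_norm_le_iff_of_nonneg (by positivity)).2 fun i => ?_
  change ‖MvPolynomial.eval p (G i)‖ ≤ _
  rw [eval_eq_sum_range_of_isHomogeneous (hG i)]
  calc _ ≤ ∑ k ∈ Finset.range (d + 1), ‖a i k‖ * ‖p‖ ^ d := by
        refine norm_sum_le_of_le _ fun k hk => ?_
        have hk' : k ≤ d := by have := Finset.mem_range.1 hk; omega
        rw [norm_mul, norm_mul, norm_pow, norm_pow]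
        refine mul_le_mul_of_nonneg_left ?_ (norm_nonneg _)
        calc _ ≤ ‖p‖ ^ k * ‖p‖ ^ (d - k) := by
              gcongr <;> exact norm_le_pi_norm _ _
          _ = _ := by rw [← pow_add, Nat.add_sub_cancel' hk']
    _ ≤ S * ‖p‖ ^ d := by
        rw [← Finset.sum_mul]
        refine mul_le_mul_of_nonneg_right ?_ (by positivity)
        exact Finset.single_le_sum (f := fun i => ∑ k ∈ Finset.range (d + 1), ‖a i k‖)
          (fun _ _ => by positivity) (Finset.mem_univ i)
    _ ≤ _ := by gcongr; linarith

theorem exists_norm_wedge_evalMap_le (hG : ∀ i, (G i).IsHomogeneous d) :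
    ∃ M : ℝ, 0 < M ∧ ∀ p q, ‖wedge (evalMap G p) (evalMap G q)‖ ≤
      M * ‖wedge p q‖ * (‖p‖ * ‖q‖) ^ (d - 1) := by
  set a : Fin 2 → ℕ → K := fun i k => (MvPolynomial.aeval ![Polynomial.X, 1] (G i)).coeff k
  set S : ℝ := ∑ k ∈ Finset.range (d + 1), ∑ l ∈ Finset.range (d + 1), ‖a 0 k * a 1 l‖
  refine ⟨S * d + 1, by positivity, fun p q => ?_⟩
  have h : wedge (evalMap G p) (evalMap G q) =
      ∑ k ∈ Finset.range (d + 1), ∑ l ∈ Finset.range (d + 1), a 0 k * a 1 l *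
        (p 0 ^ k * p 1 ^ (d - k) * (q 0 ^ l * q 1 ^ (d - l)) -
          p 0 ^ l * p 1 ^ (d - l) * (q 0 ^ k * q 1 ^ (d - k))) := by
    simp only [wedge, evalMap, eval_eq_sum_range_of_isHomogeneous (hG _)]
    rw [Finset.sum_mul_sum, mul_comm (∑ k ∈ _, _) (∑ k ∈ _, _), Finset.sum_mul_sum,
      ← Finset.sum_sub_distrib]
    refine Finset.sum_congr rfl fun k _ => ?_
    rw [← Finset.sum_sub_distrib]
    exact Finset.sum_congr rfl fun l _ => by simp only [a]; ring
  rw [h]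
  calc _ ≤ ∑ k ∈ Finset.range (d + 1), ∑ l ∈ Finset.range (d + 1), ‖a 0 k * a 1 l‖ *
        (d * ‖wedge p q‖ * (‖p‖ * ‖q‖) ^ (d - 1)) := by
        refine norm_sum_le_of_le _ fun k hk => norm_sum_le_of_le _ fun l hl => ?_
        rw [norm_mul]
        refine mul_le_mul_of_nonneg_left ?_ (norm_nonneg _)
        exact norm_monomial_wedge_le p q (by have := Finset.mem_range.1 hk; omega)
          (by have := Finset.mem_range.1 hl; omega)
    _ = S * d * ‖wedge p q‖ * (‖p‖ * ‖q‖) ^ (d - 1) := by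
        simp only [← Finset.sum_mul]; ring
    _ ≤ _ := by gcongr; linarith

theorem exists_smul_norm_one {p : Fin 2 → K} (hp : p ≠ 0) :
    ∃ a : K, a ≠ 0 ∧ ‖a • p‖ = 1 := by
  obtain ⟨i, hi⟩ : ∃ i, ‖p i‖ = ‖p‖ := by
    rw [norm_eq_max]
    rcases max_choice ‖p 0‖ ‖p 1‖ with h | h
    exacts [⟨0, h.symm⟩, ⟨1, h.symm⟩]
  have hp' : ‖p‖ ≠ 0 := norm_ne_zero_iff.2 hp
  have h0 : p i ≠ 0 := norm_ne_zero_iff.1 (hi ▸ hp')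
  exact ⟨(p i)⁻¹, inv_ne_zero h0, by rw [norm_smul, norm_inv, hi, inv_mul_cancel₀ hp']⟩

theorem exists_le_max_norm_eval {P Q : Polynomial K} (h : IsCoprime P Q) :
    ∃ m : ℝ, 0 < m ∧ ∀ t : K, ‖t‖ ≤ 1 → m ≤ max ‖P.eval t‖ ‖Q.eval t‖ := by
  obtain ⟨u, v, huv⟩ := h
  obtain ⟨B, hB, hu⟩ := exists_norm_eval_le u
  obtain ⟨C, hC, hv⟩ := exists_norm_eval_le v
  refine ⟨1 / (B + C), by positivity, fun t ht => ?_⟩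
  rw [div_le_iff₀ (by positivity)]
  have h1 : (1 : K) = u.eval t * P.eval t + v.eval t * Q.eval t := by
    simpa using congrArg (Polynomial.eval t) huv.symm
  calc (1 : ℝ) = ‖u.eval t * P.eval t + v.eval t * Q.eval t‖ := by rw [← h1, norm_one]
    _ ≤ ‖u.eval t‖ * ‖P.eval t‖ + ‖v.eval t‖ * ‖Q.eval t‖ := by
        simpa using norm_add_le (u.eval t * P.eval t) (v.eval t * Q.eval t)
    _ ≤ B * max ‖P.eval t‖ ‖Q.eval t‖ + C * max ‖P.eval t‖ ‖Q.eval t‖ := by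
        gcongr
        exacts [hu t ht, le_max_left _ _, hv t ht, le_max_right _ _]
    _ = _ := by ring

theorem eval_aeval (g : Fin 2 → Polynomial K) (φ : MvPolynomial (Fin 2) K) (t : K) :
    (MvPolynomial.aeval g φ).eval t = MvPolynomial.eval (fun i => (g i).eval t) φ := by
  exact MvPolynomial.comp_aeval_apply g (Polynomial.aeval t) φ

theorem isCoprime_aeval [IsAlgClosed K] (h0 : ∀ p, evalMap G p = 0 → p = 0)
    (g : Fin 2 → Polynomial K) (hg : ∀ t, (fun i => (g i).eval t) ≠ 0) :
    IsCoprime (MvPolynomial.aeval g (G 0)) (MvPolynomial.aeval g (G 1)) := by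
  refine (Polynomial.isCoprime_iff_aeval_ne_zero_of_isAlgClosed K K _ _).2 fun t => ?_
  by_contra! h
  apply hg t
  apply h0
  ext i
  have := h.1
  have := h.2
  fin_cases i <;> simp_all [evalMap, Polynomial.coe_aeval_eq_eval, eval_aeval]

theorem exists_le_norm_evalMap [IsAlgClosed K] (hG : ∀ i, (G i).IsHomogeneous d)
    (h0 : ∀ p, evalMap G p = 0 → p = 0) :
    ∃ m : ℝ, 0 < m ∧ ∀ p, m * ‖p‖ ^ d ≤ ‖evalMap G p‖ := by
  obtain ⟨m₁, hm₁, h₁⟩ := exists_le_max_norm_eval (isCoprime_aeval h0 ![Polynomial.X, 1]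
    fun t ht => by simpa using congrFun ht 1)
  obtain ⟨m₂, hm₂, h₂⟩ := exists_le_max_norm_eval (isCoprime_aeval h0 ![1, Polynomial.X]
    fun t ht => by simpa using congrFun ht 0)
  have e₁ : ∀ t : K, (fun i => ((![Polynomial.X, 1] : Fin 2 → Polynomial K) i).eval t) = ![t, 1] :=
    fun t => by ext i; fin_cases i <;> simp
  have e₂ : ∀ t : K, (fun i => ((![1, Polynomial.X] : Fin 2 → Polynomial K) i).eval t) = ![1, t] :=
    fun t => by ext i; fin_cases i <;> simp
  simp only [eval_aeval, e₁] at h₁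
  simp only [eval_aeval, e₂] at h₂
  refine ⟨min m₁ m₂, lt_min hm₁ hm₂, fun p => ?_⟩
  have key : ∀ (a : K) (q : Fin 2 → K) (m : ℝ), ‖p‖ = ‖a‖ → p = a • q → min m₁ m₂ ≤ m →
      m ≤ ‖evalMap G q‖ → min m₁ m₂ * ‖p‖ ^ d ≤ ‖evalMap G p‖ := by
    intro a q m hpa hpq hm hq
    have hn : ‖evalMap G p‖ = ‖a‖ ^ d * ‖evalMap G q‖ := by
      rw [hpq, evalMap_smul hG, norm_smul, norm_pow]
    rw [hn, hpa, mul_comm]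
    exact mul_le_mul_of_nonneg_left (hm.trans hq) (by positivity)
  have hdiv : ∀ x y : K, ‖x‖ ≤ ‖y‖ → ‖x / y‖ ≤ 1 := fun x y h => by
    rw [norm_div]; exact div_le_one_of_le₀ h (norm_nonneg _)
  rcases le_total ‖p 0‖ ‖p 1‖ with h | h
  · refine key (p 1) ![p 0 / p 1, 1] m₁ (by rw [norm_eq_max, max_eq_right h]) ?_ (min_le_left _ _)
      (by rw [norm_eq_max]; exact h₁ _ (hdiv _ _ h))
    by_cases h1 : p 1 = 0
    · have h2 : p 0 = 0 := by simpa [h1] using h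
      ext i; fin_cases i <;> simp [h1, h2]
    · ext i; fin_cases i <;> simp [mul_div_cancel₀ _ h1]
  · refine key (p 0) ![1, p 1 / p 0] m₂ (by rw [norm_eq_max, max_eq_left h]) ?_ (min_le_right _ _)
      (by rw [norm_eq_max]; exact h₂ _ (hdiv _ _ h))
    by_cases h1 : p 0 = 0
    · have h2 : p 1 = 0 := by simpa [h1] using h
      ext i; fin_cases i <;> simp [h1, h2]
    · ext i; fin_cases i <;> simp [mul_div_cancel₀ _ h1]

end Norm

section Critical

variable {K : Type*} [NontriviallyNormedField K] {G : Fin 2 → MvPolynomial (Fin 2) K} {d : ℕ}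

/-- Near a zero of the Jacobian determinant, `G` is quadratically contracting along each line. -/
theorem exists_norm_wedge_evalMap_line_le [CharZero K] (hd : d ≠ 0)
    (hG : ∀ i, (G i).IsHomogeneous d) {q : Fin 2 → K} (hq : MvPolynomial.eval q (jac G) = 0)
    (r : Fin 2 → K) :
    ∃ B : ℝ, 0 < B ∧ ∀ t : K, ‖t‖ ≤ 1 →
      ‖wedge (evalMap G (q + t • r)) (evalMap G q)‖ ≤ B * ‖t‖ ^ 2 := by
  set g : Fin 2 → Polynomial K := fun i =>
    Polynomial.C (q i) + Polynomial.X * Polynomial.C (r i) with hg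
  have hgt : ∀ t, (fun i => (g i).eval t) = q + t • r := fun t => by
    ext i; simp [hg]; ring
  set P : Polynomial K := MvPolynomial.aeval g (G 0) * Polynomial.C (evalMap G q 1) -
    MvPolynomial.aeval g (G 1) * Polynomial.C (evalMap G q 0) with hP
  have hPt : ∀ t, P.eval t = wedge (evalMap G (q + t • r)) (evalMap G q) := fun t => by
    simp [hP, eval_aeval, hgt, wedge, evalMap]
  have hder : ∀ i, (Polynomial.derivative (MvPolynomial.aeval g (G i))).eval 0 =
      MvPolynomial.eval q (MvPolynomial.pderiv 0 (G i)) * r 0 +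
        MvPolynomial.eval q (MvPolynomial.pderiv 1 (G i)) * r 1 := fun i => by
    have := derivation_aeval Polynomial.derivative' g (G i)
    rw [Polynomial.derivative'_apply] at this
    rw [this]
    simp [Fin.sum_univ_two, eval_aeval, hg, Polynomial.derivative'_apply]
  have hP0 : P.eval 0 = 0 := by
    rw [hPt]; simp [wedge]; ring
  have hP1 : P.derivative.eval 0 = 0 := by
    have e : ∀ i, q 0 * MvPolynomial.eval q (MvPolynomial.pderiv 0 (G i)) +
        q 1 * MvPolynomial.eval q (MvPolynomial.pderiv 1 (G i)) =
          (d : K) * MvPolynomial.eval q (G i) := fun i => euler_eval (hG i) q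
    rw [jac_eq] at hq
    simp only [map_sub, map_mul] at hq
    have hd' : (d : K) ≠ 0 := Nat.cast_ne_zero.2 hd
    apply mul_left_cancel₀ hd'
    simp only [hP, Polynomial.derivative_sub, Polynomial.derivative_mul, Polynomial.derivative_C,
      mul_zero, add_zero, Polynomial.eval_sub, Polynomial.eval_mul, Polynomial.eval_C, hder, evalMap]
    linear_combination (-(MvPolynomial.eval q (MvPolynomial.pderiv 0 (G 0)) * r 0 +
        MvPolynomial.eval q (MvPolynomial.pderiv 1 (G 0)) * r 1)) * e 1 +
        (MvPolynomial.eval q (MvPolynomial.pderiv 0 (G 1)) * r 0 +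
        MvPolynomial.eval q (MvPolynomial.pderiv 1 (G 1)) * r 1) * e 0 + (r 0 * q 1 - r 1 * q 0) * hq
  have hdvd : (Polynomial.X : Polynomial K) ^ 2 ∣ P := by
    rw [Polynomial.X_pow_dvd_iff]
    intro k hk
    interval_cases k
    · rwa [Polynomial.coeff_zero_eq_eval_zero]
    · rw [← Polynomial.coeff_zero_eq_eval_zero, Polynomial.coeff_derivative] at hP1
      simpa using hP1
  obtain ⟨H, hH⟩ := hdvd
  obtain ⟨B, hB, hHB⟩ := exists_norm_eval_le H
  refine ⟨B, hB, fun t ht => ?_⟩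
  rw [← hPt, hH, Polynomial.eval_mul, norm_mul, mul_comm]
  simp only [Polynomial.eval_pow, Polynomial.eval_X, norm_pow]
  exact mul_le_mul_of_nonneg_right (hHB t ht) (by positivity)

theorem exists_wedge_ne_zero {q : Fin 2 → K} (hq : q ≠ 0) : ∃ r, wedge q r ≠ 0 := by
  by_cases h : q 1 = 0
  · refine ⟨![0, 1], fun h' => hq ?_⟩
    ext i; fin_cases i
    · simpa [wedge] using h'
    · exact h
  · exact ⟨![1, 0], by simpa [wedge] using h⟩

theorem exists_norm_wedge_evalMap_le_sq [CharZero K] (hd : 2 ≤ d)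
    (hG : ∀ i, (G i).IsHomogeneous d) {q : Fin 2 → K} (hq0 : q ≠ 0)
    (hq : MvPolynomial.eval q (jac G) = 0) :
    ∃ A : ℝ, 0 < A ∧ ∀ p, ‖p‖ = 1 →
      ‖wedge (evalMap G p) (evalMap G q)‖ ≤ A * ‖wedge p q‖ ^ 2 := by
  obtain ⟨r, hr⟩ := exists_wedge_ne_zero hq0
  obtain ⟨B, hB, hline⟩ := exists_norm_wedge_evalMap_line_le (by omega) hG hq r
  obtain ⟨M, hM, hlip⟩ := exists_norm_wedge_evalMap_le hG
  set w := ‖wedge q r‖ with hw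
  have hw0 : 0 < w := norm_pos_iff.2 hr
  set s := ‖q‖ + ‖r‖ with hs
  have hs0 : 0 < s := add_pos_of_pos_of_nonneg (norm_pos_iff.2 hq0) (norm_nonneg _)
  set b := 2 * ‖r‖ / w with hb
  refine ⟨b ^ (d - 2) * B / w ^ 2 + M * ‖q‖ ^ (d - 1) * s / w, by positivity, fun p hp => ?_⟩
  set α := wedge p r / wedge q r with hα
  set β := wedge q p / wedge q r with hβ
  have hp' : p = α • q + β • r := by
    have h := wedge_smul_eq q r p
    rw [hα, hβ, div_eq_inv_mul, div_eq_inv_mul, mul_smul, mul_smul, ← smul_add, ← h,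
      inv_smul_smul₀ hr]
  have hβn : ‖β‖ = ‖wedge p q‖ / w := by
    rw [hβ, norm_div, ← hw, ← norm_neg (wedge q p)]
    congr 2
    simp [wedge]; ring
  have hαn : ‖α‖ ≤ b := by
    rw [hα, norm_div, ← hw, hb]
    gcongr
    simpa [hp] using norm_wedge_le p r
  clear_value α β
  rcases le_or_gt ‖β‖ ‖α‖ with h | h
  · have hα0 : α ≠ 0 := by
      rintro hα0
      have : β = 0 := by simpa [hα0] using h
      rw [hp', hα0, this] at hp
      simp at hp
    have hpl : p = α • (q + (β / α) • r) := by
      rw [smul_add, smul_smul, mul_div_cancel₀ _ hα0, ← hp']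
    have ht : ‖β / α‖ ≤ 1 := by
      rw [norm_div]; exact div_le_one_of_le₀ h (norm_nonneg _)
    have hα1 : 0 < ‖α‖ := norm_pos_iff.2 hα0
    calc ‖wedge (evalMap G p) (evalMap G q)‖
        = ‖α‖ ^ d * ‖wedge (evalMap G (q + (β / α) • r)) (evalMap G q)‖ := by
          conv_lhs => rw [hpl, evalMap_smul hG, wedge_smul_left, norm_mul, norm_pow]
      _ ≤ ‖α‖ ^ d * (B * ‖β / α‖ ^ 2) := by gcongr; exact hline _ ht
      _ = ‖α‖ ^ (d - 2) * B * ‖β‖ ^ 2 := by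
          rw [norm_div, div_pow, ← Nat.sub_add_cancel hd, pow_add]
          simp only [Nat.add_sub_cancel]
          field_simp
      _ ≤ b ^ (d - 2) * B * ‖β‖ ^ 2 := by gcongr
      _ = b ^ (d - 2) * B / w ^ 2 * ‖wedge p q‖ ^ 2 := by rw [hβn]; ring
      _ ≤ _ := by gcongr; exact le_add_of_nonneg_right (by positivity)
  · have h1 : 1 ≤ s * ‖β‖ := by
      calc 1 = ‖α • q + β • r‖ := by rw [← hp', hp]
        _ ≤ ‖α‖ * ‖q‖ + ‖β‖ * ‖r‖ := by simpa [norm_smul] using norm_add_le (α • q) (β • r)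
        _ ≤ ‖β‖ * ‖q‖ + ‖β‖ * ‖r‖ := by gcongr
        _ = _ := by rw [hs]; ring
    calc ‖wedge (evalMap G p) (evalMap G q)‖ ≤ M * ‖wedge p q‖ * ‖q‖ ^ (d - 1) := by
          simpa [hp] using hlip p q
      _ ≤ M * ‖wedge p q‖ * ‖q‖ ^ (d - 1) * (s * ‖β‖) :=
          le_mul_of_one_le_right (by positivity) h1
      _ = M * ‖q‖ ^ (d - 1) * s / w * ‖wedge p q‖ ^ 2 := by rw [hβn]; ring
      _ ≤ _ := by gcongr; exact le_add_of_nonneg_left (by positivity)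

/-- The Jacobian determinant of a non-degenerate homogeneous map does not vanish identically on
the affine line. -/
theorem aeval_jac_ne_zero [CharZero K] [IsAlgClosed K] (hd : d ≠ 0)
    (hG : ∀ i, (G i).IsHomogeneous d) (h0 : ∀ p, evalMap G p = 0 → p = 0) :
    MvPolynomial.aeval ![Polynomial.X, (1 : Polynomial K)] (jac G) ≠ 0 := by
  intro hj
  set g : Fin 2 → Polynomial K := ![Polynomial.X, 1] with hg
  have hgt : ∀ t : K, (fun i => (g i).eval t) = ![t, 1] :=
    fun t => by ext i; fin_cases i <;> simp [hg]
  have hcop := isCoprime_aeval h0 g fun t ht => by simpa [hg] using congrFun ht 1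
  have hder : ∀ i, Polynomial.derivative (MvPolynomial.aeval g (G i)) =
      MvPolynomial.aeval g (MvPolynomial.pderiv 0 (G i)) := fun i => by
    have := derivation_aeval Polynomial.derivative' g (G i)
    rw [Polynomial.derivative'_apply] at this
    rw [this]
    simp [Fin.sum_univ_two, hg, Polynomial.derivative'_apply]
  have hW : Polynomial.wronskian (MvPolynomial.aeval g (G 0)) (MvPolynomial.aeval g (G 1)) = 0 := by
    have e0 := euler_eval (hG 0) g
    have e1 := euler_eval (hG 1) g
    rw [jac_eq] at hj
    simp only [map_sub, map_mul] at hj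
    have hd' : (d : Polynomial K) ≠ 0 := Nat.cast_ne_zero.2 hd
    have hg1 : g 1 = 1 := by simp [hg]
    rw [hg1] at e0 e1
    apply mul_left_cancel₀ hd'
    rw [Polynomial.wronskian, hder, hder]
    linear_combination (-MvPolynomial.aeval g (MvPolynomial.pderiv 0 (G 1))) * e0 +
      MvPolynomial.aeval g (MvPolynomial.pderiv 0 (G 0)) * e1 - hj
  obtain ⟨hc0, hc1⟩ := hcop.wronskian_eq_zero_iff.1 hW
  have hc : ∀ i, Polynomial.derivative (MvPolynomial.aeval g (G i)) = 0 := by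
    intro i; fin_cases i; exacts [hc0, hc1]
  have h10 : evalMap G ![1, 0] = 0 := by
    ext i
    have hconst := Polynomial.derivative_eq_zero.1 (hc i)
    change MvPolynomial.eval ![1, 0] (G i) = 0
    rw [eval_eq_sum_range_of_isHomogeneous (hG i)]
    refine Finset.sum_eq_zero fun k hk => ?_
    by_cases hkd : k = d
    · rw [Polynomial.coeff_eq_zero_of_natDegree_lt (by rw [← hg, hconst]; omega), zero_mul]
    · have : d - k ≠ 0 := by have := Finset.mem_range.1 hk; omega
      simp [this]
  simpa using congrFun (h0 _ h10) 0

end Critical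

section Recurrence

variable {X : Type*} {δ : X → X → ℝ} {f : X → X} {L A : ℝ}

theorem iterate_le_pow_mul (hL : 0 ≤ L) (hf : ∀ z w, δ (f z) (f w) ≤ L * δ z w) (n : ℕ) (z w : X) :
    δ (f^[n] z) (f^[n] w) ≤ L ^ n * δ z w := by
  induction n with
  | zero => simp
  | succ n ih =>
    rw [Function.iterate_succ_apply', Function.iterate_succ_apply', pow_succ', mul_assoc]
    exact (hf _ _).trans (mul_le_mul_of_nonneg_left ih hL)

variable {c : X}

theorem iterate_le_sq (hL : 1 ≤ L) (hA : 0 < A)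
    (hf : ∀ z w, δ (f z) (f w) ≤ L * δ z w) (hc : ∀ z, δ (f z) (f c) ≤ A * δ z c ^ 2)
    {n : ℕ} (hn : 1 ≤ n) (z : X) :
    δ (f^[n] z) (f^[n] c) ≤ L ^ n * A * δ z c ^ 2 := by
  obtain ⟨m, rfl⟩ := Nat.exists_eq_add_of_le' hn
  have hL0 : 0 ≤ L := zero_le_one.trans hL
  calc δ (f^[m + 1] z) (f^[m + 1] c) ≤ L ^ m * δ (f z) (f c) := iterate_le_pow_mul hL0 hf m _ _
    _ ≤ L ^ m * (A * δ z c ^ 2) := by gcongr; exact hc z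
    _ ≤ L ^ (m + 1) * (A * δ z c ^ 2) := by gcongr; simp
    _ = _ := by ring

/-- If `c` returns very close to itself after time `n`, then at all multiples of `n` its
distance to `c` is comparable to that at time `n`. -/
theorem dist_iterate_mul_bounds (hδ : ∀ z w, 0 ≤ δ z w) (hcomm : ∀ z w, δ z w = δ w z)
    (htri : ∀ x y z, δ x z ≤ δ x y + δ y z) (hself : ∀ z, δ z z = 0)
    (hL : 1 ≤ L) (hA : 0 < A)
    (hf : ∀ z w, δ (f z) (f w) ≤ L * δ z w) (hc : ∀ z, δ (f z) (f c) ≤ A * δ z c ^ 2)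
    {n : ℕ} (hn : 1 ≤ n) (hε : 8 * (L ^ n * A) * δ (f^[n] c) c ≤ 1) {k : ℕ} (hk : 1 ≤ k) :
    δ (f^[n * k] c) c ≤ 4 / 3 * δ (f^[n] c) c ∧
      2 / 3 * δ (f^[n] c) c ≤ δ (f^[n * k] c) c := by
  set ε := δ (f^[n] c) c with hεdef
  have hε0 : 0 ≤ ε := hδ _ _
  have step : ∀ z, δ z c ≤ 4 / 3 * ε → δ (f^[n] z) (f^[n] c) ≤ 1 / 3 * ε := by
    intro z hz
    have hA' : 0 < L ^ n * A := by positivity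
    calc δ (f^[n] z) (f^[n] c) ≤ L ^ n * A * δ z c ^ 2 := iterate_le_sq hL hA hf hc hn z
      _ ≤ L ^ n * A * (4 / 3 * ε) ^ 2 := by gcongr; exact hδ _ _
      _ = 8 * (L ^ n * A) * ε * (2 / 9 * ε) := by ring
      _ ≤ 1 * (2 / 9 * ε) := by gcongr
      _ ≤ 1 / 3 * ε := by linarith
  have upper : ∀ k, δ (f^[n * k] c) c ≤ 4 / 3 * ε := by
    intro k
    induction k with
    | zero => simpa [hself] using hε0
    | succ k ih =>
      have h := step _ ih
      rw [← Function.iterate_add_apply, show n + n * k = n * (k + 1) by ring] at h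
      linarith [htri (f^[n * (k + 1)] c) (f^[n] c) c]
  refine ⟨upper k, ?_⟩
  obtain ⟨m, rfl⟩ := Nat.exists_eq_add_of_le' hk
  have h := step _ (upper m)
  rw [← Function.iterate_add_apply, show n + n * m = n * (m + 1) by ring] at h
  have := htri (f^[n] c) (f^[n * (m + 1)] c) c
  rw [hcomm (f^[n] c) (f^[n * (m + 1)] c)] at this
  linarith

/-- A non-periodic critical point returns to itself at most exponentially close. -/
theorem exists_pow_le_dist_iterate (hδ : ∀ z w, 0 ≤ δ z w) (hcomm : ∀ z w, δ z w = δ w z)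
    (htri : ∀ x y z, δ x z ≤ δ x y + δ y z) (hself : ∀ z, δ z z = 0)
    (hL : 1 ≤ L) (hA : 0 < A)
    (hf : ∀ z w, δ (f z) (f w) ≤ L * δ z w) (hc : ∀ z, δ (f z) (f c) ≤ A * δ z c ^ 2)
    (hper : ∀ n, 1 ≤ n → 0 < δ (f^[n] c) c) :
    ∃ B : ℝ, 0 < B ∧ B ≤ 1 ∧ ∀ n, 1 ≤ n → B ^ n ≤ δ (f^[n] c) c := by
  have hL0 : 0 < L := zero_lt_one.trans_le hL
  obtain ⟨η, hη, hη'⟩ : ∃ η : ℝ, 0 < η ∧ ∀ n, 1 ≤ n →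
      8 * (L ^ n * A) * δ (f^[n] c) c ≤ 1 → η ≤ δ (f^[n] c) c := by
    by_cases h : ∃ m, 1 ≤ m ∧ 8 * (L ^ m * A) * δ (f^[m] c) c ≤ 1
    · obtain ⟨m, hm, hm'⟩ := h
      refine ⟨δ (f^[m] c) c / 2, half_pos (hper m hm), fun n hn hn' => ?_⟩
      have h1 := (dist_iterate_mul_bounds hδ hcomm htri hself hL hA hf hc hm hm' hn).2
      have h2 := (dist_iterate_mul_bounds hδ hcomm htri hself hL hA hf hc hn hn' hm).1
      rw [mul_comm n m] at h2
      linarith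
    · push Not at h
      exact ⟨1, one_pos, fun n hn hn' => absurd hn' (not_le.2 (h n hn))⟩
  set b := min 1 (min (1 / (8 * A)) η) with hb
  have hb0 : 0 < b := by positivity
  have hb1 : b ≤ 1 := min_le_left _ _
  have hbL : b / L ≤ b := div_le_self hb0.le hL
  refine ⟨b / L, by positivity, hbL.trans hb1, fun n hn => ?_⟩
  have hbn : b ^ n ≤ b := pow_le_of_le_one hb0.le hb1 (by omega)
  by_cases h : 8 * (L ^ n * A) * δ (f^[n] c) c ≤ 1
  · calc (b / L) ^ n ≤ b ^ n := by gcongr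
      _ ≤ b := hbn
      _ ≤ η := (min_le_right _ _).trans (min_le_right _ _)
      _ ≤ _ := hη' n hn h
  · push Not at h
    calc (b / L) ^ n = b ^ n / L ^ n := div_pow _ _ _
      _ ≤ (1 / (8 * A)) / L ^ n := by
          gcongr
          exact hbn.trans ((min_le_right _ _).trans (min_le_left _ _))
      _ = 1 / (8 * (L ^ n * A)) := by rw [div_div]; congr 1; ring
      _ ≤ _ := by
          rw [div_le_iff₀ (by positivity), mul_comm]
          exact h.le

end Recurrence

section Lift

variable {K : Type*} [NontriviallyNormedField K] (f : RatFunc K)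

theorem isHomogeneous_homLift (i : Fin 2) : (homLift f i).IsHomogeneous (deg f) := by
  fin_cases i <;> exact Polynomial.isHomogeneous_homogenize _

theorem isHomogeneous_homLiftIter (n : ℕ) (i : Fin 2) :
    (homLiftIter f n i).IsHomogeneous (deg f ^ n) := by
  induction n generalizing i with
  | zero => simpa [homLiftIter] using MvPolynomial.isHomogeneous_X K i
  | succ n ih =>
    rw [pow_succ]
    exact (isHomogeneous_homLift f i).aeval _ ih

theorem evalMap_homLift_ne_zero (hf : 1 < deg f) (p : Fin 2 → K)
    (hp : evalMap (homLift f) p = 0) : p = 0 := by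
  have h0 : MvPolynomial.eval p (f.num.homogenize (deg f)) = 0 := congrFun hp 0
  have h1 : MvPolynomial.eval p (f.denom.homogenize (deg f)) = 0 := congrFun hp 1
  have hd0 : f.num.natDegree ≤ deg f := le_max_left _ _
  have hd1 : f.denom.natDegree ≤ deg f := le_max_right _ _
  by_cases h : p 1 = 0
  · have key : ∀ P : Polynomial K, P.natDegree ≤ deg f →
        MvPolynomial.eval p (P.homogenize (deg f)) = P.coeff (deg f) * p 0 ^ deg f := by
      intro P hP
      rw [eval_eq_sum_range_of_isHomogeneous (Polynomial.isHomogeneous_homogenize P),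
        Polynomial.aeval_homogenize_X_one P hP, Finset.sum_eq_single (deg f)]
      · simp
      · intro k hk hk'
        have : deg f - k ≠ 0 := by have := Finset.mem_range.1 hk; omega
        simp [h, this]
      · simp
    rw [key _ hd0] at h0
    rw [key _ hd1] at h1
    have hcoeff : f.num.coeff (deg f) ≠ 0 ∨ f.denom.coeff (deg f) ≠ 0 := by
      have hlead : ∀ P : Polynomial K, deg f = P.natDegree → P.coeff (deg f) ≠ 0 := by
        intro P hP h
        rw [hP, Polynomial.coeff_natDegree, Polynomial.leadingCoeff_eq_zero] at h
        rw [hP, h] at hf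
        simp at hf
      exact (max_choice f.num.natDegree f.denom.natDegree).imp (hlead _) (hlead _)
    have h00 : p 0 = 0 := by
      rcases hcoeff with hc | hc
      · exact eq_zero_of_pow_eq_zero ((mul_eq_zero.1 h0).resolve_left hc)
      · exact eq_zero_of_pow_eq_zero ((mul_eq_zero.1 h1).resolve_left hc)
    ext i; fin_cases i
    exacts [h00, h]
  · rw [Polynomial.eval_homogenize hd0 p h] at h0
    rw [Polynomial.eval_homogenize hd1 p h] at h1
    have hpow : p 1 ^ deg f ≠ 0 := pow_ne_zero _ h
    obtain ⟨u, v, huv⟩ := f.isCoprime_num_denom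
    have := congrArg (Polynomial.eval (p 0 / p 1)) huv
    simp [(mul_eq_zero.1 h0).resolve_right hpow, (mul_eq_zero.1 h1).resolve_right hpow] at this

theorem evalMap_homLiftIter (n : ℕ) (p : Fin 2 → K) :
    evalMap (homLiftIter f n) p = (evalMap (homLift f))^[n] p := by
  induction n with
  | zero => ext i; simp [evalMap, homLiftIter]
  | succ n ih =>
    rw [Function.iterate_succ_apply', ← ih]
    ext i
    change MvPolynomial.eval p (MvPolynomial.bind₁ (homLiftIter f n) (homLift f i)) = _
    rw [← MvPolynomial.aeval_eq_bind₁]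
    exact MvPolynomial.comp_aeval_apply (homLiftIter f n) (MvPolynomial.aeval p) (homLift f i)

theorem evalMap_homLiftIter_ne_zero (hf : 1 < deg f) (n : ℕ) (p : Fin 2 → K)
    (hp : evalMap (homLiftIter f n) p = 0) : p = 0 := by
  rw [evalMap_homLiftIter] at hp
  induction n with
  | zero => simpa using hp
  | succ n ih =>
    rw [Function.iterate_succ_apply'] at hp
    exact ih (evalMap_homLift_ne_zero f hf _ hp)

theorem homLiftIter_one : homLiftIter f 1 = homLift f := by
  ext1 i
  simp [homLiftIter]

theorem Crit_one_subset_Crit {n : ℕ} (hn : 1 ≤ n) : Crit f 1 ⊆ Crit f n := by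
  intro c hc
  induction n, hn using Nat.le_induction with
  | base => exact hc
  | succ n _ ih =>
    have h : jacobian f (n + 1) =
        MvPolynomial.bind₁ (homLiftIter f n) (jac (homLift f)) * jacobian f n :=
      jac_bind₁ (homLift f) (homLiftIter f n)
    change MvPolynomial.eval (rep c) (jacobian f (n + 1)) = 0
    rw [h, map_mul, show MvPolynomial.eval (rep c) (jacobian f n) = 0 from ih, mul_zero]

theorem notMem_Fix_of_notMem_SAT {c : P1 K} (hc : c ∈ Crit f 1 \ SAT f) {n : ℕ} (hn : 1 ≤ n) :
    (ratMap f)^[n] c ≠ c := fun h =>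
  hc.2 (Set.mem_iUnion₂.2 ⟨n, hn, h, Crit_one_subset_Crit f hn hc.1⟩)

/-- The restriction of the Jacobian determinant to the affine line. -/
def affJacobian (n : ℕ) : Polynomial K :=
  MvPolynomial.aeval ![Polynomial.X, 1] (jacobian f n)

theorem isHomogeneous_jacobian (n : ℕ) :
    (jacobian f n).IsHomogeneous ((deg f ^ n - 1) + (deg f ^ n - 1)) :=
  isHomogeneous_jac (isHomogeneous_homLiftIter f n)

theorem natDegree_affJacobian_le (n : ℕ) : (affJacobian f n).natDegree ≤ 2 * deg f ^ n := by
  have h : (affJacobian f n).natDegree ≤ (deg f ^ n - 1) + (deg f ^ n - 1) := by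
    unfold affJacobian
    rw [MvPolynomial.aeval_def, MvPolynomial.eval₂_eq']
    refine Polynomial.natDegree_sum_le_of_forall_le _ _ fun m hm => ?_
    have hd := (isHomogeneous_jacobian f n).degree_eq_sum_deg_support hm
    have hm0 : m 0 ≤ (deg f ^ n - 1) + (deg f ^ n - 1) := by
      rw [hd]
      by_cases h0 : m 0 = 0
      · simp [h0]
      · exact Finset.single_le_sum (f := fun i => m i) (fun _ _ => Nat.zero_le _)
          (Finsupp.mem_support_iff.2 h0)
    refine le_trans ?_ hm0
    simp only [Fin.prod_univ_two, Matrix.cons_val_zero, Matrix.cons_val_one, one_pow, mul_one]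
    exact (Polynomial.natDegree_C_mul_X_pow_le _ _)
  omega

end Lift

section Counting

variable {K : Type*} [NontriviallyNormedField K] [IsAlgClosed K] [CharZero K] (f : RatFunc K)

theorem affJacobian_ne_zero (hf : 1 < deg f) (n : ℕ) : affJacobian f n ≠ 0 :=
  aeval_jac_ne_zero (pow_ne_zero _ (by omega)) (isHomogeneous_homLiftIter f n)
    (evalMap_homLiftIter_ne_zero f hf n)

theorem Crit_finite (hf : 1 < deg f) (n : ℕ) : (Crit f n).Finite := by
  classical
  refine ((Set.finite_singleton (∞ : P1 K)).union
    ((affJacobian f n).roots.toFinset.finite_toSet.image ((↑) : K → P1 K))).subset fun z hz => ?_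
  induction z using OnePoint.rec with
  | infty => exact Or.inl rfl
  | coe a =>
    refine Or.inr ⟨a, ?_, rfl⟩
    have : (affJacobian f n).eval a = MvPolynomial.eval (rep (a : P1 K)) (jacobian f n) := by
      rw [affJacobian, eval_aeval]
      congr 2
      ext i; fin_cases i <;> simp [rep]
    simp only [Finset.mem_coe, Multiset.mem_toFinset,
      Polynomial.mem_roots (affJacobian_ne_zero f hf n), Polynomial.IsRoot, this]
    exact hz

theorem critMult_coe_le (hf : 1 < deg f) (n : ℕ) (a : K) :
    critMult f n (a : P1 K) ≤ (affJacobian f n).rootMultiplicity a := by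
  rw [Polynomial.le_rootMultiplicity_iff (affJacobian_ne_zero f hf n)]
  have h := map_dvd (MvPolynomial.aeval ![Polynomial.X, (1 : Polynomial K)])
    (pow_multiplicity_dvd (MvPolynomial.X 0 * MvPolynomial.C (rep (a : P1 K) 1) -
      MvPolynomial.X 1 * MvPolynomial.C (rep (a : P1 K) 0)) (jacobian f n))
  rw [map_pow] at h
  have hX : MvPolynomial.aeval ![Polynomial.X, (1 : Polynomial K)]
      (MvPolynomial.X 0 * MvPolynomial.C (rep (a : P1 K) 1) -
        MvPolynomial.X 1 * MvPolynomial.C (rep (a : P1 K) 0)) =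
      Polynomial.X - Polynomial.C a := by
    simp [rep]
  rwa [hX] at h

theorem critMult_infty_le (hf : 1 < deg f) (n : ℕ) : critMult f n ∞ ≤ 2 * deg f ^ n := by
  have h := pow_multiplicity_dvd (MvPolynomial.X 0 * MvPolynomial.C (rep (∞ : P1 K) 1) -
      MvPolynomial.X 1 * MvPolynomial.C (rep (∞ : P1 K) 0)) (jacobian f n)
  obtain ⟨H, hH⟩ := h
  have hj : jacobian f n ≠ 0 := fun h => affJacobian_ne_zero f hf n (by rw [affJacobian, h, map_zero])
  have hdeg := (isHomogeneous_jacobian f n).totalDegree_le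
  have hl : (MvPolynomial.X 0 * MvPolynomial.C (rep (∞ : P1 K) 1) -
      MvPolynomial.X 1 * MvPolynomial.C (rep (∞ : P1 K) 0)) =
      -(MvPolynomial.X 1 : MvPolynomial (Fin 2) K) := by
    simp [rep]
  have hH' : jacobian f n = (-(MvPolynomial.X 1 : MvPolynomial (Fin 2) K)) ^ critMult f n ∞ * H := by
    rw [← hl]; exact hH
  rw [hH'] at hj hdeg
  rw [MvPolynomial.totalDegree_mul_of_isDomain (left_ne_zero_of_mul hj) (right_ne_zero_of_mul hj),
    neg_pow, show ((-1 : MvPolynomial (Fin 2) K)) = MvPolynomial.C (-1) by simp,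
    ← MvPolynomial.C_pow, MvPolynomial.totalDegree_mul_of_isDomain
      (by simp) (by simp), MvPolynomial.totalDegree_X_pow] at hdeg
  omega

/-- `fⁿ` has `O(dⁿ)` critical points with multiplicity. -/
theorem sum_critMult_le (hf : 1 < deg f) (n : ℕ) (T : Finset (P1 K)) :
    ∑ c ∈ T, critMult f n c ≤ 4 * deg f ^ n := by
  classical
  have h1 : ∑ a ∈ T.preimage ((↑) : K → P1 K) OnePoint.coe_injective.injOn,
      critMult f n (a : P1 K) ≤ 2 * deg f ^ n := by
    refine le_trans ?_ ((affJacobian f n).card_roots'.trans (natDegree_affJacobian_le f n))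
    calc _ ≤ ∑ a ∈ T.preimage ((↑) : K → P1 K) OnePoint.coe_injective.injOn,
          (affJacobian f n).roots.count a := by
          refine Finset.sum_le_sum fun a _ => ?_
          rw [Polynomial.count_roots]
          exact critMult_coe_le f hf n a
      _ ≤ ∑ a ∈ T.preimage ((↑) : K → P1 K) OnePoint.coe_injective.injOn ∪
            (affJacobian f n).roots.toFinset, (affJacobian f n).roots.count a :=
          Finset.sum_le_sum_of_subset Finset.subset_union_left
      _ = _ := Multiset.sum_count_eq_card fun a ha =>
          Finset.mem_union_right _ (Multiset.mem_toFinset.2 ha)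
  have h2 : ∑ c ∈ T, critMult f n c ≤ critMult f n ∞ +
      ∑ a ∈ T.preimage ((↑) : K → P1 K) OnePoint.coe_injective.injOn, critMult f n (a : P1 K) := by
    have hmap := Finset.sum_map (T.preimage ((↑) : K → P1 K) OnePoint.coe_injective.injOn)
      ⟨((↑) : K → P1 K), OnePoint.coe_injective⟩ (critMult f n)
    simp only [Function.Embedding.coeFn_mk] at hmap
    rw [← hmap, ← Finset.sum_insert (by simp)]
    refine Finset.sum_le_sum_of_subset fun z hz => ?_
    induction z using OnePoint.rec with
    | infty => simp
    | coe a => simpa using hz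
  have := critMult_infty_le f hf n
  omega

end Counting

section Distance

variable {K : Type*} [NontriviallyNormedField K]

/-- The chordal distance of the points of `ℙ¹` below two vectors, relative to the maximum norm. -/
def vdist (p q : Fin 2 → K) : ℝ := ‖wedge p q‖ / (‖p‖ * ‖q‖)

/-- The chordal distance on `ℙ¹` relative to the maximum norm. -/
def pdist (z w : P1 K) : ℝ := vdist (rep z) (rep w)

theorem vdist_nonneg (p q : Fin 2 → K) : 0 ≤ vdist p q := by unfold vdist; positivity

theorem vdist_comm (p q : Fin 2 → K) : vdist p q = vdist q p := by
  have : wedge p q = -wedge q p := by simp [wedge]; ring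
  rw [vdist, vdist, this, norm_neg, mul_comm ‖p‖]

theorem vdist_smul_left {a : K} (ha : a ≠ 0) (p q : Fin 2 → K) :
    vdist (a • p) q = vdist p q := by
  have : ‖a‖ ≠ 0 := norm_ne_zero_iff.2 ha
  rw [vdist, vdist, wedge_smul_left, norm_mul, norm_smul, mul_assoc ‖a‖,
    mul_div_mul_left _ _ this]

theorem vdist_smul_right {a : K} (ha : a ≠ 0) (p q : Fin 2 → K) :
    vdist p (a • q) = vdist p q := by
  rw [vdist_comm, vdist_smul_left ha, vdist_comm]

theorem vdist_triangle (p q : Fin 2 → K) {r : Fin 2 → K} (hr : r ≠ 0) :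
    vdist p q ≤ vdist p r + vdist r q := by
  rcases eq_or_ne p 0 with rfl | hp
  · have := vdist_nonneg r q
    simpa [vdist] using this
  rcases eq_or_ne q 0 with rfl | hq
  · have := vdist_nonneg p r
    simpa [vdist] using this
  have hp' := norm_pos_iff.2 hp
  have hq' := norm_pos_iff.2 hq
  have hr' := norm_pos_iff.2 hr
  have h : ‖wedge p q‖ * ‖r‖ ≤ ‖wedge r q‖ * ‖p‖ + ‖wedge p r‖ * ‖q‖ := by
    simp only [← norm_smul, wedge_smul_eq p q r]
    exact norm_add_le _ _
  unfold vdist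
  rw [div_add_div _ _ (by positivity) (by positivity),
    div_le_div_iff₀ (by positivity) (by positivity)]
  nlinarith [mul_le_mul_of_nonneg_right h (by positivity : 0 ≤ ‖p‖ * ‖q‖ * ‖r‖)]

theorem rep_ne_zero (z : P1 K) : rep z ≠ 0 := by
  intro h
  induction z using OnePoint.rec with
  | infty => simpa [rep] using congrFun h 0
  | coe a => simpa [rep] using congrFun h 1

theorem exists_rep_proj_eq_smul {p : Fin 2 → K} (hp : p ≠ 0) :
    ∃ a : K, a ≠ 0 ∧ rep (proj p) = a • p := by
  by_cases h : p 1 = 0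
  · have h0 : p 0 ≠ 0 := fun h0 => hp (by ext i; fin_cases i; exacts [h0, h])
    refine ⟨(p 0)⁻¹, inv_ne_zero h0, ?_⟩
    ext i; fin_cases i <;> simp [proj, rep, h, h0]
  · refine ⟨(p 1)⁻¹, inv_ne_zero h, ?_⟩
    ext i; fin_cases i <;> simp [proj, rep, h, div_eq_inv_mul]

theorem pdist_proj {p q : Fin 2 → K} (hp : p ≠ 0) (hq : q ≠ 0) :
    pdist (proj p) (proj q) = vdist p q := by
  obtain ⟨a, ha, hap⟩ := exists_rep_proj_eq_smul hp
  obtain ⟨b, hb, hbq⟩ := exists_rep_proj_eq_smul hq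
  rw [pdist, hap, hbq, vdist_smul_left ha, vdist_smul_right hb]

theorem pdist_nonneg (z w : P1 K) : 0 ≤ pdist z w := vdist_nonneg _ _

theorem pdist_comm (z w : P1 K) : pdist z w = pdist w z := vdist_comm _ _

theorem pdist_triangle (x y z : P1 K) : pdist x z ≤ pdist x y + pdist y z :=
  vdist_triangle _ _ (rep_ne_zero y)

theorem pdist_self (z : P1 K) : pdist z z = 0 := by
  have : wedge (rep z) (rep z) = 0 := by simp [wedge]; ring
  simp [pdist, vdist, this]

theorem pdist_le_two (z w : P1 K) : pdist z w ≤ 2 :=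
  div_le_of_le_mul₀ (by positivity) zero_le_two (norm_wedge_le _ _)

theorem pdist_pos {z w : P1 K} (h : z ≠ w) : 0 < pdist z w := by
  have hz := norm_pos_iff.2 (rep_ne_zero z)
  have hw := norm_pos_iff.2 (rep_ne_zero w)
  refine div_pos (norm_pos_iff.2 fun h0 => h ?_) (by positivity)
  induction z using OnePoint.rec <;> induction w using OnePoint.rec <;>
    simp_all [wedge, rep, sub_eq_zero]

theorem le_nrm_and_nrm_le (p : Fin 2 → K) :
    ‖p‖ ≤ nrm K ‖p 0‖ ‖p 1‖ ∧ nrm K ‖p 0‖ ‖p 1‖ ≤ 2 * ‖p‖ := by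
  have h0 := norm_le_pi_norm p 0
  have h1 := norm_le_pi_norm p 1
  have hp := norm_nonneg p
  unfold nrm
  split_ifs
  · rw [← norm_eq_max]
    exact ⟨le_rfl, by linarith⟩
  · constructor
    · rw [norm_eq_max]
      refine max_le (Real.le_sqrt_of_sq_le ?_) (Real.le_sqrt_of_sq_le ?_)
      · exact le_add_of_nonneg_right (by positivity)
      · exact le_add_of_nonneg_left (by positivity)
    · refine Real.sqrt_le_iff.2 ⟨by positivity, ?_⟩
      have := pow_le_pow_left₀ (norm_nonneg _) h0 2
      have := pow_le_pow_left₀ (norm_nonneg _) h1 2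
      nlinarith

theorem pdist_le_four_mul_chordal (z w : P1 K) : pdist z w ≤ 4 * chordal z w := by
  obtain ⟨hz, hz'⟩ := le_nrm_and_nrm_le (rep z)
  obtain ⟨hw, hw'⟩ := le_nrm_and_nrm_le (rep w)
  have pz := norm_pos_iff.2 (rep_ne_zero z)
  have pw := norm_pos_iff.2 (rep_ne_zero w)
  have qz := pz.trans_le hz
  have qw := pw.trans_le hw
  unfold pdist vdist chordal
  rw [← mul_div_assoc, div_le_div_iff₀ (by positivity) (by positivity)]
  change ‖wedge _ _‖ * _ ≤ 4 * ‖wedge _ _‖ * _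
  calc _ ≤ ‖wedge (rep z) (rep w)‖ * ((2 * ‖rep z‖) * (2 * ‖rep w‖)) := by gcongr
    _ = _ := by ring

theorem chordal_le_pdist (z w : P1 K) : chordal z w ≤ pdist z w := by
  have pz := norm_pos_iff.2 (rep_ne_zero z)
  have pw := norm_pos_iff.2 (rep_ne_zero w)
  unfold pdist vdist chordal wedge
  gcongr
  exacts [pz.le.trans (le_nrm_and_nrm_le (rep z)).1, (le_nrm_and_nrm_le (rep z)).1,
    (le_nrm_and_nrm_le (rep w)).1]

theorem abs_log_chordal_le {z w : P1 K} {b : ℝ} (hb : 0 < b) (hb1 : b ≤ 1) {n : ℕ} (hn : 1 ≤ n)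
    (h : b ^ n ≤ pdist z w) : |Real.log (chordal z w)| ≤ (-Real.log b + Real.log 4) * n := by
  have hlow : b ^ n / 4 ≤ chordal z w := by
    have := pdist_le_four_mul_chordal z w
    linarith
  have hpos : 0 < chordal z w := lt_of_lt_of_le (by positivity) hlow
  have h1 : n * Real.log b - Real.log 4 ≤ Real.log (chordal z w) := by
    rw [← Real.log_pow, ← Real.log_div (by positivity) (by norm_num)]
    exact Real.log_le_log (by positivity) hlow
  have h2 : Real.log (chordal z w) ≤ Real.log 4 :=
    Real.log_le_log hpos (by linarith [chordal_le_pdist z w, pdist_le_two z w])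
  have hlb : Real.log b ≤ 0 := Real.log_nonpos hb.le hb1
  have hn' : (1 : ℝ) ≤ n := by exact_mod_cast hn
  have h4 : 0 ≤ Real.log 4 := Real.log_nonneg (by norm_num)
  rw [abs_le]
  constructor <;> nlinarith

end Distance

section RatMap

variable {K : Type*} [NontriviallyNormedField K] (f : RatFunc K)

theorem pdist_ratMap (hf : 1 < deg f)
    (z w : P1 K) : pdist (ratMap f z) (ratMap f w) =
      vdist (evalMap (homLift f) (rep z)) (evalMap (homLift f) (rep w)) :=
  pdist_proj (fun h => rep_ne_zero z (evalMap_homLift_ne_zero f hf _ h))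
    (fun h => rep_ne_zero w (evalMap_homLift_ne_zero f hf _ h))

variable [IsAlgClosed K]

theorem exists_pdist_ratMap_le (hf : 1 < deg f) :
    ∃ L : ℝ, 1 ≤ L ∧ ∀ z w, pdist (ratMap f z) (ratMap f w) ≤ L * pdist z w := by
  obtain ⟨M, hM, hle⟩ := exists_norm_wedge_evalMap_le (isHomogeneous_homLift f)
  obtain ⟨m, hm, hlow⟩ := exists_le_norm_evalMap (isHomogeneous_homLift f)
    (evalMap_homLift_ne_zero f hf)
  refine ⟨max 1 (M / m ^ 2), le_max_left _ _, fun z w => ?_⟩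
  refine le_trans ?_ (mul_le_mul_of_nonneg_right (le_max_right 1 _) (pdist_nonneg z w))
  rw [pdist_ratMap f hf, pdist, vdist, vdist]
  have pz := norm_pos_iff.2 (rep_ne_zero z)
  have pw := norm_pos_iff.2 (rep_ne_zero w)
  calc _ ≤ M * ‖wedge (rep z) (rep w)‖ * (‖rep z‖ * ‖rep w‖) ^ (deg f - 1) /
        ((m * ‖rep z‖ ^ deg f) * (m * ‖rep w‖ ^ deg f)) := by
        gcongr
        exacts [hle _ _, hlow _, hlow _]
    _ = _ := by
        obtain ⟨k, hk⟩ := Nat.exists_eq_add_of_le' hf.le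
        rw [hk, Nat.add_sub_cancel]
        field_simp
        ring

theorem exists_pdist_ratMap_le_sq [CharZero K] (hf : 1 < deg f) {c : P1 K} (hc : c ∈ Crit f 1) :
    ∃ A : ℝ, 0 < A ∧ ∀ z, pdist (ratMap f z) (ratMap f c) ≤ A * pdist z c ^ 2 := by
  have hc' : MvPolynomial.eval (rep c) (jac (homLift f)) = 0 := by
    rw [← homLiftIter_one]; exact hc
  obtain ⟨A, hA, hle⟩ := exists_norm_wedge_evalMap_le_sq (by omega) (isHomogeneous_homLift f)
    (rep_ne_zero c) hc'
  obtain ⟨m, hm, hlow⟩ := exists_le_norm_evalMap (isHomogeneous_homLift f)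
    (evalMap_homLift_ne_zero f hf)
  have pc := norm_pos_iff.2 (rep_ne_zero c)
  have pFc : 0 < ‖evalMap (homLift f) (rep c)‖ :=
    norm_pos_iff.2 fun h => rep_ne_zero c (evalMap_homLift_ne_zero f hf _ h)
  refine ⟨A * ‖rep c‖ ^ 2 / (m * ‖evalMap (homLift f) (rep c)‖), by positivity, fun z => ?_⟩
  obtain ⟨a, ha, hap⟩ := exists_smul_norm_one (rep_ne_zero z)
  have hFz : vdist (evalMap (homLift f) (rep z)) (evalMap (homLift f) (rep c)) =
      vdist (evalMap (homLift f) (a • rep z)) (evalMap (homLift f) (rep c)) := by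
    rw [evalMap_smul (isHomogeneous_homLift f), vdist_smul_left (pow_ne_zero _ ha)]
  rw [pdist_ratMap f hf, hFz, pdist, ← vdist_smul_left ha (rep z) (rep c), vdist, vdist, hap, one_mul]
  have hl := hlow (a • rep z)
  rw [hap, one_pow, mul_one] at hl
  calc _ ≤ A * ‖wedge (a • rep z) (rep c)‖ ^ 2 / (m * ‖evalMap (homLift f) (rep c)‖) := by
        gcongr
        exact hle _ hap
    _ = _ := by field_simp

theorem exists_pow_le_pdist_iterate [CharZero K] (hf : 1 < deg f) {c : P1 K}
    (hc : c ∈ Crit f 1 \ SAT f) :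
    ∃ B : ℝ, 0 < B ∧ B ≤ 1 ∧ ∀ n, 1 ≤ n → B ^ n ≤ pdist ((ratMap f)^[n] c) c := by
  obtain ⟨L, hL, hlip⟩ := exists_pdist_ratMap_le f hf
  obtain ⟨A, hA, hsq⟩ := exists_pdist_ratMap_le_sq f hf hc.1
  exact exists_pow_le_dist_iterate pdist_nonneg pdist_comm pdist_triangle pdist_self hL hA hlip hsq
    fun n hn => pdist_pos (notMem_Fix_of_notMem_SAT f hc hn)

theorem exists_pow_le_pow_of_finite {X : Type*} {E : Set X} (hE : E.Finite) {u : X → ℕ → ℝ}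
    (h : ∀ c ∈ E, ∃ B : ℝ, 0 < B ∧ B ≤ 1 ∧ ∀ n, 1 ≤ n → B ^ n ≤ u c n) :
    ∃ B : ℝ, 0 < B ∧ B ≤ 1 ∧ ∀ c ∈ E, ∀ n, 1 ≤ n → B ^ n ≤ u c n := by
  induction E, hE using Set.Finite.induction_on with
  | empty => exact ⟨1, one_pos, le_rfl, by simp⟩
  | @insert a s _ _ ih =>
    obtain ⟨B, hB, hB1, hBs⟩ := ih fun c hc => h c (Set.mem_insert_of_mem _ hc)
    obtain ⟨C, hC, hC1, hCa⟩ := h a (Set.mem_insert _ _)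
    refine ⟨min B C, lt_min hB hC, (min_le_left _ _).trans hB1, ?_⟩
    rintro c (rfl | hc) n hn
    · exact (pow_le_pow_left₀ (lt_min hB hC).le (min_le_right _ _) n).trans (hCa n hn)
    · exact (pow_le_pow_left₀ (lt_min hB hC).le (min_le_left _ _) n).trans (hBs c hc n hn)

/-- Preimages of non-periodic critical points return to themselves at most exponentially close. -/
theorem exists_pow_le_pdist_iterate_preimage [CharZero K] (hf : 1 < deg f) :
    ∃ b : ℝ, 0 < b ∧ b ≤ 1 ∧ ∀ n, 1 ≤ n → ∀ c,
      c ∈ ⋃ j < n, (ratMap f)^[j] ⁻¹' (Crit f 1 \ SAT f) →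
        b ^ n ≤ pdist ((ratMap f)^[n] c) c := by
  obtain ⟨B, hB, hB1, hBn⟩ := exists_pow_le_pow_of_finite
    ((Crit_finite f hf 1).subset Set.sdiff_subset)
    fun c (hc : c ∈ Crit f 1 \ SAT f) => exists_pow_le_pdist_iterate f hf hc
  obtain ⟨L, hL, hlip⟩ := exists_pdist_ratMap_le f hf
  have hL0 : 0 < L := zero_lt_one.trans_le hL
  refine ⟨B / L, by positivity, (div_le_self hB.le hL).trans hB1, fun n hn c hc => ?_⟩
  obtain ⟨j, hj, hcj⟩ := Set.mem_iUnion₂.1 hc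
  have h1 := hBn _ hcj n hn
  have h2 := iterate_le_pow_mul hL0.le hlip j ((ratMap f)^[n] c) c
  rw [← Function.iterate_add_apply, add_comm, Function.iterate_add_apply] at h2
  have h3 : L ^ j ≤ L ^ n := pow_le_pow_right₀ hL hj.le
  rw [div_pow, div_le_iff₀ (by positivity), mul_comm]
  exact (h1.trans h2).trans (mul_le_mul_of_nonneg_right h3 (pdist_nonneg _ _))

end RatMap

section Green

variable {K : Type*} [NontriviallyNormedField K] (f : RatFunc K)

theorem hval_incl (z : P1 K) (G : MvPolynomial (Fin 2) K) :
    hval (incl z) G = ‖MvPolynomial.eval (rep z) G‖ := by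
  induction z using OnePoint.rec with
  | infty => rfl
  | coe a =>
    change ‖(MvPolynomial.aeval ![Polynomial.X, 1] G).eval a‖ = _
    rw [eval_aeval]
    congr 3
    ext i; fin_cases i <;> simp [rep]

theorem TIter_incl (n : ℕ) (z : P1 K) :
    TIter f n (incl z) =
      Real.log (nrm K ‖(evalMap (homLift f))^[n] (rep z) 0‖ ‖(evalMap (homLift f))^[n] (rep z) 1‖) -
        (deg f : ℝ) ^ n * Real.log (nrm K ‖rep z 0‖ ‖rep z 1‖) := by
  simp only [TIter, hval_incl, ← evalMap_homLiftIter, MvPolynomial.eval_X]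
  rfl

theorem exists_abs_log_nrm_sub_le [IsAlgClosed K] (hf : 1 < deg f) :
    ∃ C : ℝ, ∀ p : Fin 2 → K, p ≠ 0 →
      |Real.log (nrm K ‖evalMap (homLift f) p 0‖ ‖evalMap (homLift f) p 1‖) -
        deg f * Real.log (nrm K ‖p 0‖ ‖p 1‖)| ≤ C := by
  obtain ⟨M, hM, hup⟩ := exists_norm_evalMap_le (isHomogeneous_homLift f)
  obtain ⟨m, hm, hlow⟩ := exists_le_norm_evalMap (isHomogeneous_homLift f)
    (evalMap_homLift_ne_zero f hf)
  refine ⟨|Real.log (2 * M)| + |Real.log (m / 2 ^ deg f)|, fun p hp => ?_⟩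
  have hp' := norm_pos_iff.2 hp
  obtain ⟨a1, a2⟩ := le_nrm_and_nrm_le p
  obtain ⟨b1, b2⟩ := le_nrm_and_nrm_le (evalMap (homLift f) p)
  set u := nrm K ‖p 0‖ ‖p 1‖
  set v := nrm K ‖evalMap (homLift f) p 0‖ ‖evalMap (homLift f) p 1‖
  have hu : 0 < u := hp'.trans_le a1
  have hv1 : v ≤ 2 * M * u ^ deg f := by
    calc v ≤ 2 * (M * ‖p‖ ^ deg f) := b2.trans (by gcongr; exact hup p)
      _ ≤ 2 * (M * u ^ deg f) := by gcongr
      _ = _ := by ring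
  have hv2 : m / 2 ^ deg f * u ^ deg f ≤ v := by
    calc m / 2 ^ deg f * u ^ deg f ≤ m / 2 ^ deg f * (2 * ‖p‖) ^ deg f := by gcongr
      _ = m * ‖p‖ ^ deg f := by rw [mul_pow]; field_simp
      _ ≤ v := (hlow p).trans b1
  have hv : 0 < v := lt_of_lt_of_le (by positivity) hv2
  have l1 := Real.log_le_log hv hv1
  have l2 := Real.log_le_log (by positivity) hv2
  rw [Real.log_mul (by positivity) (by positivity), Real.log_pow] at l1 l2
  have c1 := le_abs_self (Real.log (2 * M))
  have c2 := neg_abs_le (Real.log (m / 2 ^ deg f))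
  have c3 := abs_nonneg (Real.log (2 * M))
  have c4 := abs_nonneg (Real.log (m / 2 ^ deg f))
  rw [abs_le]
  constructor <;> linarith

/-- The Green function of the lift is bounded on `ℙ¹`. -/
theorem exists_abs_liftGreen_incl_le [IsAlgClosed K] (hf : 1 < deg f) :
    ∃ C : ℝ, ∀ z : P1 K, |liftGreen f (incl z)| ≤ C := by
  obtain ⟨C, hC⟩ := exists_abs_log_nrm_sub_le f hf
  have hd : (1 : ℝ) < deg f := by exact_mod_cast hf
  have hd0 : (0 : ℝ) < deg f := zero_lt_one.trans hd
  have hr : (deg f : ℝ)⁻¹ < 1 := inv_lt_one_of_one_lt₀ hd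
  refine ⟨C / (1 - (deg f : ℝ)⁻¹), fun z => ?_⟩
  have hstep : ∀ n : ℕ, dist (TIter f n (incl z) / (deg f : ℝ) ^ n)
      (TIter f (n + 1) (incl z) / (deg f : ℝ) ^ (n + 1)) ≤ C * (deg f : ℝ)⁻¹ ^ n := by
    intro n
    have hne : (evalMap (homLift f))^[n] (rep z) ≠ 0 := fun h =>
      rep_ne_zero z (evalMap_homLiftIter_ne_zero f hf n _ ((evalMap_homLiftIter f n _).trans h))
    have h := hC _ hne
    have hC0 : 0 ≤ C := (abs_nonneg _).trans h
    rw [dist_comm, Real.dist_eq, TIter_incl, TIter_incl, Function.iterate_succ_apply']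
    set x := Real.log (nrm K ‖evalMap (homLift f) ((evalMap (homLift f))^[n] (rep z)) 0‖
      ‖evalMap (homLift f) ((evalMap (homLift f))^[n] (rep z)) 1‖)
    set y := Real.log (nrm K ‖(evalMap (homLift f))^[n] (rep z) 0‖
      ‖(evalMap (homLift f))^[n] (rep z) 1‖)
    set w := Real.log (nrm K ‖rep z 0‖ ‖rep z 1‖)
    have e : (x - (deg f : ℝ) ^ (n + 1) * w) / (deg f : ℝ) ^ (n + 1) -
        (y - (deg f : ℝ) ^ n * w) / (deg f : ℝ) ^ n =
        (x - deg f * y) / (deg f : ℝ) ^ (n + 1) := by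
      field_simp; ring
    rw [e, abs_div, abs_of_pos (by positivity : (0 : ℝ) < (deg f : ℝ) ^ (n + 1)), inv_pow,
      ← div_eq_mul_inv]
    gcongr
    · exact hd.le
    · omega
  obtain ⟨g, hg⟩ := cauchySeq_tendsto_of_complete (cauchySeq_of_le_geometric _ C hr hstep)
  have hlim : liftGreen f (incl z) = g := hg.limUnder_eq
  have := dist_le_of_le_geometric_of_tendsto₀ _ C hr hstep hg
  rw [hlim]
  simpa [TIter_incl, Real.dist_eq] using this

end Green

end BerkDyn

end

theorem recurrence_term_bounded {K : Type*} [NontriviallyNormedField K] [IsAlgClosed K]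
    [CharZero K] [CompleteSpace K] (f : RatFunc K) (hf : 1 < BerkDyn.deg f) :
    (fun n : ℕ => 1 / ((n : ℝ) * (BerkDyn.deg f : ℝ) ^ n) *
        ∑ᶠ c ∈ (BerkDyn.Crit f n \ BerkDyn.Fix f n) ∩
            ⋃ j < n, (BerkDyn.ratMap f)^[j] ⁻¹' (BerkDyn.Crit f 1 \ BerkDyn.SAT f),
          (BerkDyn.critMult f n c : ℝ) *
            BerkDyn.Phi (BerkDyn.dynGreen f)
              (BerkDyn.incl ((BerkDyn.ratMap f)^[n] c)) (BerkDyn.incl c))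
      =O[Filter.atTop] (fun _ : ℕ => (1 : ℝ)) := by
  obtain ⟨b, hb, hb1, hbn⟩ := BerkDyn.exists_pow_le_pdist_iterate_preimage f hf
  obtain ⟨C, hC⟩ := BerkDyn.exists_abs_liftGreen_incl_le f hf
  set V := BerkDyn.eqEnergy (BerkDyn.liftGreen f) / 2 with hV
  set D : ℝ := -Real.log b + Real.log 4 + 2 * (C + |V|) with hD
  have hd0 : (0 : ℝ) < BerkDyn.deg f := by exact_mod_cast zero_lt_one.trans hf
  have hg : ∀ z : BerkDyn.P1 K, |BerkDyn.dynGreen f (BerkDyn.incl z)| ≤ C + |V| := fun z =>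
    (abs_add_le _ _).trans (by gcongr; exact hC z)
  have hCV : 0 ≤ C + |V| := (abs_nonneg _).trans (hg (OnePoint.infty))
  refine Asymptotics.IsBigO.of_bound (4 * D) ?_
  filter_upwards [Filter.eventually_ge_atTop 1] with n hn
  have hn1 : (1 : ℝ) ≤ n := by exact_mod_cast hn
  set S := (BerkDyn.Crit f n \ BerkDyn.Fix f n) ∩
    ⋃ j < n, (BerkDyn.ratMap f)^[j] ⁻¹' (BerkDyn.Crit f 1 \ BerkDyn.SAT f) with hS
  have hSfin : S.Finite := (BerkDyn.Crit_finite f hf n).subset fun c hc => hc.1.1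
  have hPhi : ∀ c ∈ S, |BerkDyn.Phi (BerkDyn.dynGreen f)
      (BerkDyn.incl ((BerkDyn.ratMap f)^[n] c)) (BerkDyn.incl c)| ≤ D * n := by
    intro c hc
    have h1 := BerkDyn.abs_log_chordal_le hb hb1 hn (hbn n hn c hc.2)
    have h2 := hg ((BerkDyn.ratMap f)^[n] c)
    have h3 := hg c
    rw [BerkDyn.Phi, BerkDyn.hsia_incl]
    refine (abs_sub _ _).trans ((add_le_add (abs_sub _ _) le_rfl).trans ?_)
    rw [hD]
    nlinarith
  have hsum : |∑ᶠ c ∈ S, (BerkDyn.critMult f n c : ℝ) * BerkDyn.Phi (BerkDyn.dynGreen f)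
      (BerkDyn.incl ((BerkDyn.ratMap f)^[n] c)) (BerkDyn.incl c)| ≤
      4 * (BerkDyn.deg f : ℝ) ^ n * (D * n) := by
    rw [finsum_mem_eq_finite_toFinset_sum _ hSfin]
    have hcount : ∑ c ∈ hSfin.toFinset, (BerkDyn.critMult f n c : ℝ) ≤
        4 * (BerkDyn.deg f : ℝ) ^ n := by
      exact_mod_cast BerkDyn.sum_critMult_le f hf n hSfin.toFinset
    have hD0 : 0 ≤ D := by
      have := Real.log_nonpos hb.le hb1
      have : 0 ≤ Real.log 4 := Real.log_nonneg (by norm_num)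
      rw [hD]; linarith
    calc _ ≤ ∑ c ∈ hSfin.toFinset, (BerkDyn.critMult f n c : ℝ) * (D * n) := by
          refine (Finset.abs_sum_le_sum_abs _ _).trans (Finset.sum_le_sum fun c hc => ?_)
          rw [abs_mul, Nat.abs_cast]
          exact mul_le_mul_of_nonneg_left (hPhi c (hSfin.mem_toFinset.1 hc)) (Nat.cast_nonneg _)
      _ ≤ _ := by
          rw [← Finset.sum_mul]
          exact mul_le_mul_of_nonneg_right hcount (by positivity)
  rw [norm_mul, Real.norm_eq_abs, Real.norm_eq_abs, norm_one, mul_one,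
    abs_of_nonneg (by positivity), one_div_mul_eq_div, div_le_iff₀ (by positivity)]
  exact hsum.trans (le_of_eq (by ring))
end

section
/- Let $K$ be an algebraically closed field of characteristic $0$ that is complete with respect to a non-trivial (possibly non-archimedean) absolute value $|\cdot|$, and let $f\in K(z)$ be a rational function of degree $d>1$. Let $\mathbb{P}^1=\mathbb{P}^1(K)$, with the normalized chordal metric $[z,w]=|p\wedge q|/(\|p\|\,\|q\|)$ for lifts $p,q\in K^2\setminus\{0\}$ of $z,w$, where $\|\cdot\|$ is the maximum norm if $K$ is non-archimedean and the Euclidean norm if $K$ is archimedean. Let $\mathsf{P}^1$ be the Berkovich projective line over $K$ and $[\cdot,\cdot]_{\mathrm{can}}$ the generalized Hsia kernel on $\mathsf{P}^1$ with respect to the canonical (Gauss) point, which extends the chordal metric (for archimedean $K$, $\mathsf{P}^1=\mathbb{P}^1$ and $[\cdot,\cdot]_{\mathrm{can}}=[\cdot,\cdot]$). For a continuous weight $g$ on $\mathsf{P}^1$ put $\Phi_g(\mathcal{S},\mathcal{S}'):=\log[\mathcal{S},\mathcal{S}']_{\mathrm{can}}-g(\mathcal{S})-g(\mathcal{S}')$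 and $V_g:=\sup_\nu\int\Phi_g\,\mathrm{d}(\nu\times\nu)$, the supremum being over all probability Radon measures $\nu$ on $\mathsf{P}^1$. The dynamical Green function of $f$ is $g_f:=g_F+V_{g_F}/2$, where $F$ is any non-degenerate homogeneous lift of $f$ to $K^2$ and $g_F:=\lim_{n\to\infty}d^{-n}T_{F^n}$, with $T_{F^n}$ the continuous extension to $\mathsf{P}^1$ of $\log\|F^n\|-d^n\log\|\cdot\|$; it does not depend on $F$. For $n\in\mathbb{N}=\{1,2,\dots\}$ let $\mathrm{Fix}(f^n)$ and $C(f^n)$ be the sets of fixed points and of critical points of $f^n$ in $\mathbb{P}^1$, let $[f^n=\mathrm{Id}]:=\sum_{w\in\mathbb{P}^1:\,f^n(w)=w}\delta_w$, counted with multiplicity, and let $\mathrm{SAT}(f):=\bigcup_{n\in\mathbb{N}}(\mathrm{Fix}(f^n)\cap C(f^n))$. Let $\delta>0$ be such that for every $a\in\mathrm{SAT}(f)$ and every $c\in C(f)$ with $\bigcup_{j\ge0}f^{-j}(c)\neq\{a\}$, every $w\in\bigl(\bigcup_{j\ge0}f^{-j}(c)\bigr)\setminus\{a\}$ satisfies $[a,w]\ge\delta$.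 Then $$\sup_{n\in\mathbb{N}}\ \sup_{c\in C(f^n)\setminus\mathrm{Fix}(f^n)}\left|\int_{\mathrm{SAT}(f)}\Phi_{g_f}(c,\cdot)\,\mathrm{d}[f^n=\mathrm{Id}](\cdot)\right|\le\Bigl(-\log\delta+2\sup_{\mathsf{P}^1}|g_f|\Bigr)\cdot\sup_{n\in\mathbb{N}}\bigl([f^n=\mathrm{Id}](\mathrm{SAT}(f))\bigr)<\infty,$$ where the supremum of an empty set of absolute values is $0$, and both suprema on the right are finite. -/
open Filter Topology MeasureTheory
open scoped ENNReal Polynomial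

noncomputable section

namespace RatDyn

variable (K : Type*) [NontriviallyNormedField K]

/-! ### The norm on `K²` and the chordal metric on `ℙ¹(K) = K ∪ {∞}` -/

open Classical in
/-- The norm of `(p₀, p₁) ∈ K²` as a function of `a = |p₀|`, `b = |p₁|`: the maximum norm if `K`
is non-archimedean, the Euclidean norm if `K` is archimedean. -/
def pairNorm (a b : ℝ) : ℝ :=
  if IsUltrametricDist K then max a b else Real.sqrt (a ^ 2 + b ^ 2)

variable {K}

/-- A representative in `K² \ {0}` of a point of `ℙ¹(K)`: `(z, 1)` for `z ∈ K` and `(1, 0)` for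
`∞`. -/
def rep : OnePoint K → K × K
  | .infty => (1, 0)
  | .some z => (z, 1)

/-- The normalized chordal metric `[z, w] = |p ∧ q| / (‖p‖ ‖q‖)`. -/
def chordal (z w : OnePoint K) : ℝ :=
  ‖(rep z).1 * (rep w).2 - (rep z).2 * (rep w).1‖ /
    (pairNorm K ‖(rep z).1‖ ‖(rep z).2‖ * pairNorm K ‖(rep w).1‖ ‖(rep w).2‖)

/-! ### The Berkovich projective line -/

variable (K) in
/-- The Berkovich affine line: multiplicative seminorms on `K[T]` that extend the absolute value
of `K`. -/
def BerkA1 : Type _ := {x : MulRingSeminorm K[X] // ∀ a : K, x (Polynomial.C a) = ‖a‖}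

/-- The coarsest topology for which `x ↦ |P|_x` is continuous for every `P ∈ K[T]`. -/
instance : TopologicalSpace (BerkA1 K) :=
  TopologicalSpace.induced (fun x (P : K[X]) => x.1 P) Pi.topologicalSpace

variable (K) in
/-- The Berkovich projective line `𝖯¹`, the one-point compactification of the Berkovich affine
line. -/
abbrev BerkP1 : Type _ := OnePoint (BerkA1 K)

instance : MeasurableSpace (BerkP1 K) := borel _

instance : BorelSpace (BerkP1 K) := ⟨rfl⟩

/-- The classical point of the Berkovich affine line attached to `z ∈ K`: `P ↦ |P(z)|`. -/
def evalPoint (z : K) : BerkA1 K :=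
  ⟨{ toFun := fun P => ‖P.eval z‖
     map_zero' := by simp
     add_le' := fun P Q => by simpa using norm_add_le (P.eval z) (Q.eval z)
     neg' := fun P => by simp
     map_one' := by simp
     map_mul' := fun P Q => by simp },
   fun a => by change ‖(Polynomial.C a).eval z‖ = ‖a‖; simp⟩

/-- The inclusion `ℙ¹ → 𝖯¹`. -/
def incl : OnePoint K → BerkP1 K
  | .infty => .infty
  | .some z => .some (evalPoint z)

/-- The generalized Hsia kernel `[S, S']_can` with respect to the canonical point: the upper
semicontinuous extension to `𝖯¹ × 𝖯¹` of the chordal metric on the dense subset `ℙ¹ × ℙ¹`, i.e.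
`limsup [z, w]` as `ℙ¹ × ℙ¹ ∋ (z, w) → (S, S')`. -/
def hsia (S S' : BerkP1 K) : ℝ≥0∞ :=
  limsup (fun p : OnePoint K × OnePoint K => ENNReal.ofReal (chordal p.1 p.2))
    (comap (Prod.map incl incl) (𝓝 (S, S')))

/-! ### Integrals and potential theory -/

/-- The integral `∫ φ dμ` of an extended real function, as the integral of the positive part minus
the integral of the negative part. -/
def eintegral {X : Type*} [MeasurableSpace X] (μ : Measure X) (φ : X → EReal) : EReal :=
  ((∫⁻ x, (φ x).toENNReal ∂μ : ℝ≥0∞) : EReal) - ((∫⁻ x, (-φ x).toENNReal ∂μ : ℝ≥0∞) : EReal)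

/-- The `g`-potential kernel `Φ_g(S, S') = log [S, S']_can - g(S) - g(S')`, with values in
`[-∞, ∞)`. -/
def Phi (g : BerkP1 K → ℝ) (S S' : BerkP1 K) : EReal :=
  ENNReal.log (hsia S S') - (g S : EReal) - (g S' : EReal)

/-- The energy `∫∫ Φ_g d(ν × ν)`, as an iterated integral. -/
def energy (g : BerkP1 K → ℝ) (ν : Measure (BerkP1 K)) : EReal :=
  eintegral ν fun S => eintegral ν fun S' => Phi g S S'

/-- The `g`-equilibrium energy `V_g`: the supremum of the energy over all probability Radon
measures on `𝖯¹`. -/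
def equilibriumEnergy (g : BerkP1 K → ℝ) : EReal :=
  ⨆ (ν : Measure (BerkP1 K)) (_ : IsProbabilityMeasure ν) (_ : ν.Regular), energy g ν

/-! ### Rational functions -/

/-- The degree of a rational function. -/
def ratDegree (f : RatFunc K) : ℕ := max f.num.natDegree f.denom.natDegree

open Classical in
/-- The self-map of `ℙ¹(K) = K ∪ {∞}` induced by a rational function. -/
def ratMap (f : RatFunc K) : OnePoint K → OnePoint K
  | .infty =>
    if f.denom.natDegree < f.num.natDegree then .infty
    else .some (f.num.coeff f.denom.natDegree / f.denom.leadingCoeff)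
  | .some z =>
    if f.denom.eval z = 0 then .infty else .some (f.num.eval z / f.denom.eval z)

/-- The non-degenerate homogeneous lift `F = (F₀, F₁)` of `f` given by the reduced numerator and
denominator, `F₀(p₀, p₁) = ∑ᵢ aᵢ p₀ⁱ p₁^(d-i)` and `F₁(p₀, p₁) = ∑ᵢ bᵢ p₀ⁱ p₁^(d-i)`, acting on
pairs of elements of a commutative `K`-algebra `A`. -/
def lift {A : Type*} [CommRing A] [Algebra K A] (f : RatFunc K) (p : A × A) : A × A :=
  (∑ i ∈ Finset.range (ratDegree f + 1), f.num.coeff i • (p.1 ^ i * p.2 ^ (ratDegree f - i)),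
   ∑ i ∈ Finset.range (ratDegree f + 1), f.denom.coeff i • (p.1 ^ i * p.2 ^ (ratDegree f - i)))

/-- The continuous function `T_{Fⁿ} = log ‖Fⁿ‖ - dⁿ log ‖·‖` on `𝖯¹`. At a point `x` of the
Berkovich affine line, the coordinates of `Fⁿ(T, 1) ∈ K[T]²` and of `(T, 1)` are measured by `x`;
at `∞`, the function is evaluated at `(1, 0)`. -/
def liftGrowth (f : RatFunc K) (n : ℕ) : BerkP1 K → ℝ
  | .infty =>
    Real.log (pairNorm K ‖((lift f)^[n] ((1 : K), (0 : K))).1‖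
        ‖((lift f)^[n] ((1 : K), (0 : K))).2‖)
      - (ratDegree f : ℝ) ^ n * Real.log (pairNorm K ‖(1 : K)‖ ‖(0 : K)‖)
  | .some x =>
    Real.log (pairNorm K (x.1 ((lift f)^[n] ((Polynomial.X : K[X]), (1 : K[X]))).1)
        (x.1 ((lift f)^[n] ((Polynomial.X : K[X]), (1 : K[X]))).2))
      - (ratDegree f : ℝ) ^ n * Real.log (pairNorm K (x.1 Polynomial.X) (x.1 1))

/-- `g_F = lim_{n → ∞} T_{Fⁿ} / dⁿ`. -/
def greenLift (f : RatFunc K) (S : BerkP1 K) : ℝ :=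
  limUnder atTop fun n : ℕ => liftGrowth f n S / (ratDegree f : ℝ) ^ n

/-- The dynamical Green function `g_f = g_F + V_{g_F} / 2`, the normalized weight (`V_{g_f} = 0`)
whose associated measure is the equilibrium measure `μ_f = Δ g_F + Ω_can`. -/
def green (f : RatFunc K) (S : BerkP1 K) : ℝ :=
  greenLift f S + (equilibriumEnergy (greenLift f)).toReal / 2

/-! ### Critical points, fixed points, multiplicities -/

open Classical in
/-- The local parametrization `t ↦ c + t` of `ℙ¹(K)` at `c ∈ K`, and `t ↦ 1 / t` at `c = ∞`. -/
def param : OnePoint K → K → OnePoint K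
  | .infty, t => if t = 0 then .infty else .some t⁻¹
  | .some c, t => .some (c + t)

/-- The local coordinate inverse to `param`: `y ↦ y - c` at `c ∈ K`, and `y ↦ 1 / y` at `c = ∞`
(only its values near `c` matter). -/
def coord : OnePoint K → OnePoint K → K
  | .infty, .infty => 0
  | .infty, .some y => y⁻¹
  | .some _, .infty => 0
  | .some c, .some y => y - c

/-- The expression of a self-map `φ` of `ℙ¹(K)` in the local coordinates at `c` and at `φ(c)`. -/
def localRep (φ : OnePoint K → OnePoint K) (c : OnePoint K) (t : K) : K :=
  coord (φ c) (φ (param c t))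

/-- The set `C(φ)` of critical points of `φ`: the derivative in local coordinates vanishes. -/
def critSet (φ : OnePoint K → OnePoint K) : Set (OnePoint K) :=
  {c | HasDerivAt (localRep φ c) 0 0}

/-- The set `Fix(φ)` of fixed points of `φ` in `ℙ¹(K)`. -/
def fixSet (φ : OnePoint K → OnePoint K) : Set (OnePoint K) := {w | φ w = w}

/-- The multiplicity of a fixed point `w` as a root of `φ = Id`: the order of vanishing of
`φ(t) - t` at `w`, in the local coordinate `t` at `w`. -/
def fixMult (φ : OnePoint K → OnePoint K) (w : OnePoint K) : ℕ∞ :=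
  analyticOrderAt (fun t : K => localRep φ w t - t) 0

/-- The measure `[φ = Id] = ∑_{φ(w) = w} δ_w` on `𝖯¹`, counted with multiplicity. -/
def fixMeasure (φ : OnePoint K → OnePoint K) : Measure (BerkP1 K) :=
  Measure.sum fun w : fixSet φ => (fixMult φ w : ℝ≥0∞) • Measure.dirac (incl (w : OnePoint K))

/-- The set `SAT(f) = ⋃_{n ≥ 1} (Fix(fⁿ) ∩ C(fⁿ))` of superattracting periodic points. -/
def SAT (f : RatFunc K) : Set (OnePoint K) :=
  ⋃ n : ℕ+, fixSet (ratMap f)^[n] ∩ critSet (ratMap f)^[n]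

/-- The backward orbit `⋃_{j ≥ 0} f^{-j}(c)`. -/
def backwardOrbit (f : RatFunc K) (c : OnePoint K) : Set (OnePoint K) :=
  ⋃ j : ℕ, (ratMap f)^[j] ⁻¹' {c}

/-- `sup_{𝖯¹} |g_f|`. -/
def supGreen (f : RatFunc K) : ℝ≥0∞ := ⨆ S : BerkP1 K, ‖green f S‖ₑ

/-- `sup_{n ≥ 1} [fⁿ = Id](SAT(f))`. -/
def supMass (f : RatFunc K) : ℝ≥0∞ := ⨆ n : ℕ+, fixMeasure (ratMap f)^[n] (incl '' SAT f)

end RatDyn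

end

open RatDyn

namespace RatDyn

section PairNorm

variable {K : Type*} [NontriviallyNormedField K]

lemma max_le_pairNorm {a b : ℝ} : max a b ≤ pairNorm K a b := by
  unfold pairNorm
  split_ifs with h
  · exact le_rfl
  · exact max_le (Real.le_sqrt_of_sq_le (by nlinarith [sq_nonneg b]))
      (Real.le_sqrt_of_sq_le (by nlinarith [sq_nonneg a]))

lemma pairNorm_le_two_mul_max {a b : ℝ} (ha : 0 ≤ a) (hb : 0 ≤ b) :
    pairNorm K a b ≤ 2 * max a b := by
  have h0 : 0 ≤ max a b := le_max_of_le_left ha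
  unfold pairNorm
  split_ifs with h
  · linarith
  · refine Real.sqrt_le_iff.2 ⟨by linarith, ?_⟩
    nlinarith [le_max_left a b, le_max_right a b]

lemma pairNorm_nonneg {a b : ℝ} (ha : 0 ≤ a) : 0 ≤ pairNorm K a b :=
  (le_max_of_le_left ha).trans max_le_pairNorm

lemma norm_wedge_le (a b c d : K) :
    ‖a * d - b * c‖ ≤ pairNorm K ‖a‖ ‖b‖ * pairNorm K ‖c‖ ‖d‖ := by
  unfold pairNorm
  split_ifs with h
  · rw [sub_eq_add_neg]
    refine (IsUltrametricDist.norm_add_le_max _ _).trans (max_le ?_ ?_)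
    · rw [norm_mul]
      exact mul_le_mul (le_max_left _ _) (le_max_right _ _) (norm_nonneg _)
        (le_max_of_le_left (norm_nonneg _))
    · rw [norm_neg, norm_mul]
      exact mul_le_mul (le_max_right _ _) (le_max_left _ _) (norm_nonneg _)
        (le_max_of_le_left (norm_nonneg _))
  · rw [← Real.sqrt_mul (by positivity)]
    refine (norm_sub_le _ _).trans (Real.le_sqrt_of_sq_le ?_)
    rw [norm_mul, norm_mul]
    nlinarith [sq_nonneg (‖a‖ * ‖c‖ - ‖b‖ * ‖d‖)]

lemma chordal_le_one (z w : OnePoint K) : chordal z w ≤ 1 :=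
  div_le_one_of_le₀ (norm_wedge_le _ _ _ _)
    (mul_nonneg (pairNorm_nonneg (norm_nonneg _)) (pairNorm_nonneg (norm_nonneg _)))

lemma chordal_comm (z w : OnePoint K) : chordal z w = chordal w z := by
  unfold chordal
  rw [← norm_neg, mul_comm (pairNorm K _ _)]
  congr 2
  ring

lemma hsia_le_one (S S' : BerkP1 K) : hsia S S' ≤ 1 :=
  limsup_le_of_le (by isBoundedDefault) (Eventually.of_forall fun _ =>
    ENNReal.ofReal_le_one.2 (chordal_le_one _ _))

lemma chordal_le_hsia (z w : OnePoint K) :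
    ENNReal.ofReal (chordal z w) ≤ hsia (incl z) (incl w) := by
  refine le_limsup_of_frequently_le ?_ (by isBoundedDefault)
  have h : pure (z, w) ≤ comap (Prod.map incl incl) (𝓝 (incl z, incl w)) := by
    rw [← map_le_iff_le_comap, map_pure]
    exact pure_le_nhds _
  exact Frequently.filter_mono (by simp) h

end PairNorm

section Lift

variable {K : Type*} [NontriviallyNormedField K] {A : Type*} [CommRing A] [Algebra K A]

/-- The value at `(x, y)` of the degree-`n` homogenization of `p`. -/
noncomputable def homEval (n : ℕ) (p : K[X]) (x y : A) : A :=
  ∑ i ∈ Finset.range (n + 1), p.coeff i • (x ^ i * y ^ (n - i))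

lemma homEval_eq_aeval (n : ℕ) (p : K[X]) (x y : A) :
    homEval n p x y = MvPolynomial.aeval ![x, y] (p.homogenize n) := by
  rw [homEval, Polynomial.homogenize, map_sum, Finset.Nat.sum_antidiagonal_eq_sum_range_succ_mk]
  refine Finset.sum_congr rfl fun i _ => ?_
  rw [MvPolynomial.aeval_monomial, Algebra.smul_def]
  congr 1
  rw [Finsupp.prod_fintype _ _ (by simp)]
  simp [Fin.prod_univ_two]

lemma homEval_add (n : ℕ) (p q : K[X]) (x y : A) :
    homEval n (p + q) x y = homEval n p x y + homEval n q x y := by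
  simp [homEval_eq_aeval]

lemma homEval_mul {m n : ℕ} {p q : K[X]} (hp : p.natDegree ≤ m) (hq : q.natDegree ≤ n) (x y : A) :
    homEval (m + n) (p * q) x y = homEval m p x y * homEval n q x y := by
  simp [homEval_eq_aeval, Polynomial.homogenize_mul p q hp hq]

lemma homEval_one (n : ℕ) (x y : A) : homEval n (1 : K[X]) x y = y ^ n := by
  simp [homEval_eq_aeval]

variable (K) in
/-- The seminorm `ν` on the `K`-algebra `A` extends the absolute value of `K`. -/
def ExtendsNorm (ν : MulRingSeminorm A) : Prop := ∀ (a : K) (x : A), ν (a • x) = ‖a‖ * ν x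

lemma map_sum_le_sum_map (ν : MulRingSeminorm A) {ι : Type*} (s : Finset ι) (g : ι → A) :
    ν (∑ i ∈ s, g i) ≤ ∑ i ∈ s, ν (g i) :=
  Finset.le_sum_of_subadditive ν (map_zero ν).le (map_add_le_add ν) s g

lemma map_monomial_le {ν : MulRingSeminorm A} {n i : ℕ} (hi : i ≤ n) (x y : A) :
    ν (x ^ i * y ^ (n - i)) ≤ max (ν x) (ν y) ^ n := by
  rw [map_mul, map_pow, map_pow]
  calc ν x ^ i * ν y ^ (n - i) ≤ max (ν x) (ν y) ^ i * max (ν x) (ν y) ^ (n - i) := by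
        have := apply_nonneg ν x
        have := apply_nonneg ν y
        gcongr
        · exact le_max_left _ _
        · exact le_max_right _ _
    _ = _ := by rw [← pow_add, Nat.add_sub_cancel' hi]

/-- The sum of the absolute values of the coefficients of index at most `n`. -/
noncomputable def coeffSum (n : ℕ) (p : K[X]) : ℝ := ∑ i ∈ Finset.range (n + 1), ‖p.coeff i‖

lemma coeffSum_nonneg (n : ℕ) (p : K[X]) : 0 ≤ coeffSum n p :=
  Finset.sum_nonneg fun _ _ => norm_nonneg _

lemma map_homEval_le {ν : MulRingSeminorm A} (hν : ExtendsNorm K ν) (n : ℕ) (p : K[X]) (x y : A) :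
    ν (homEval n p x y) ≤ coeffSum n p * max (ν x) (ν y) ^ n := by
  refine (map_sum_le_sum_map ν _ _).trans ?_
  rw [coeffSum, Finset.sum_mul]
  refine Finset.sum_le_sum fun i hi => ?_
  rw [hν]
  exact mul_le_mul_of_nonneg_left
    (map_monomial_le (Nat.lt_succ_iff.1 (Finset.mem_range.1 hi)) x y) (norm_nonneg _)

lemma pow_le_of_bezout {ν : MulRingSeminorm A} (hν : ExtendsNorm K ν) {m n : ℕ} {p q u v : K[X]}
    (hp : p.natDegree ≤ n) (hq : q.natDegree ≤ n) (hu : u.natDegree ≤ m) (hv : v.natDegree ≤ m)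
    (h : u * p + v * q = 1) (x y : A) :
    ν y ^ (m + n) ≤ (coeffSum m u + coeffSum m v) * max (ν x) (ν y) ^ m *
      max (ν (homEval n p x y)) (ν (homEval n q x y)) := by
  have key : y ^ (m + n) = homEval m u x y * homEval n p x y + homEval m v x y * homEval n q x y := by
    rw [← homEval_mul hu hp, ← homEval_mul hv hq, ← homEval_add, h, homEval_one]
  have hx : 0 ≤ max (ν x) (ν y) := le_max_of_le_left (apply_nonneg ν x)
  rw [← map_pow, key]
  refine (map_add_le_add ν _ _).trans ?_
  rw [map_mul, map_mul, add_mul, add_mul]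
  refine add_le_add ?_ ?_
  · exact mul_le_mul (map_homEval_le hν m u x y) (le_max_left _ _) (apply_nonneg ν _)
      (mul_nonneg (coeffSum_nonneg _ _) (pow_nonneg hx _))
  · exact mul_le_mul (map_homEval_le hν m v x y) (le_max_right _ _) (apply_nonneg ν _)
      (mul_nonneg (coeffSum_nonneg _ _) (pow_nonneg hx _))

lemma le_map_homEval_of_small {ν : MulRingSeminorm A} (hν : ExtendsNorm K ν) {n : ℕ} (p : K[X])
    {ε : ℝ} (hε : 0 ≤ ε) (hε1 : ε ≤ 1) (x y : A) (hxy : ν y ≤ ε * ν x) :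
    (‖p.coeff n‖ - ε * coeffSum n p) * ν x ^ n ≤ ν (homEval n p x y) := by
  have hx := apply_nonneg ν x
  have hy := apply_nonneg ν y
  have hyx : ν y ≤ ν x := hxy.trans (by nlinarith)
  have h1 : ν (∑ i ∈ Finset.range n, p.coeff i • (x ^ i * y ^ (n - i)))
      ≤ ε * coeffSum n p * ν x ^ n := by
    refine (map_sum_le_sum_map ν _ _).trans ?_
    have : ∀ i ∈ Finset.range n, ν (p.coeff i • (x ^ i * y ^ (n - i))) ≤
        ‖p.coeff i‖ * (ε * ν x ^ n) := by
      intro i hi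
      have hi := Finset.mem_range.1 hi
      rw [hν, map_mul, map_pow, map_pow]
      refine mul_le_mul_of_nonneg_left ?_ (norm_nonneg _)
      obtain ⟨k, rfl⟩ := Nat.exists_eq_add_of_lt hi
      rw [show i + k + 1 - i = k + 1 by omega]
      calc ν x ^ i * ν y ^ (k + 1) = ν x ^ i * (ν y ^ k * ν y) := by ring
        _ ≤ ν x ^ i * (ν x ^ k * (ε * ν x)) := by gcongr
        _ = _ := by ring
    refine (Finset.sum_le_sum this).trans ?_
    rw [← Finset.sum_mul, coeffSum, Finset.sum_range_succ]
    have := norm_nonneg (p.coeff n)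
    have : 0 ≤ ε * ν x ^ n := by positivity
    nlinarith
  have h2 : homEval n p x y - ∑ i ∈ Finset.range n, p.coeff i • (x ^ i * y ^ (n - i)) =
      p.coeff n • x ^ n := by
    rw [homEval, Finset.sum_range_succ]
    simp
  have h3 := map_sub_le_add ν (homEval n p x y)
    (∑ i ∈ Finset.range n, p.coeff i • (x ^ i * y ^ (n - i)))
  rw [h2, hν, map_pow] at h3
  linarith

lemma exists_le_max_map_homEval {n : ℕ} {p q : K[X]} (hpq : IsCoprime p q)
    (hp : p.natDegree ≤ n) (hq : q.natDegree ≤ n) (hn : p.coeff n ≠ 0 ∨ q.coeff n ≠ 0) :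
    ∃ C > 0, ∀ ν : MulRingSeminorm A, ExtendsNorm K ν → ∀ x y : A,
      C * max (ν x) (ν y) ^ n ≤ max (ν (homEval n p x y)) (ν (homEval n q x y)) := by
  obtain ⟨u, v, huv⟩ := hpq
  set m := max u.natDegree v.natDegree with hm
  obtain ⟨l, hl, hlpq⟩ : ∃ l : K[X], l.coeff n ≠ 0 ∧ (l = p ∨ l = q) := by
    rcases hn with h | h
    exacts [⟨p, h, .inl rfl⟩, ⟨q, h, .inr rfl⟩]
  have hl0 : 0 < ‖l.coeff n‖ := norm_pos_iff.2 hl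
  have hS := coeffSum_nonneg n l
  set ε : ℝ := min 1 (‖l.coeff n‖ / (2 * (coeffSum n l + 1))) with hεdef
  have hε : 0 < ε := lt_min one_pos (by positivity)
  have hε1 : ε ≤ 1 := min_le_left _ _
  have hε2 : ε * coeffSum n l ≤ ‖l.coeff n‖ / 2 := by
    have : ε ≤ ‖l.coeff n‖ / (2 * (coeffSum n l + 1)) := min_le_right _ _
    rw [le_div_iff₀ (by positivity)] at this
    nlinarith
  set C₁ : ℝ := coeffSum m u + coeffSum m v + 1 with hC₁
  have hC₁pos : 0 < C₁ := by
    have := coeffSum_nonneg m u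
    have := coeffSum_nonneg m v
    positivity
  refine ⟨min (‖l.coeff n‖ / 2) (ε ^ (m + n) / C₁), lt_min (by positivity) (by positivity), ?_⟩
  intro ν hν x y
  have hx := apply_nonneg ν x
  have hy := apply_nonneg ν y
  have hM : 0 ≤ max (ν x) (ν y) := le_max_of_le_left hx
  by_cases hxy : ν y ≤ ε * ν x
  · have hMx : max (ν x) (ν y) = ν x := max_eq_left (hxy.trans (by nlinarith))
    calc _ ≤ (‖l.coeff n‖ / 2) * ν x ^ n := by
          rw [hMx]
          gcongr
          exact min_le_left _ _
      _ ≤ (‖l.coeff n‖ - ε * coeffSum n l) * ν x ^ n := by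
          gcongr
          linarith
      _ ≤ ν (homEval n l x y) := le_map_homEval_of_small hν l hε.le hε1 x y hxy
      _ ≤ _ := by rcases hlpq with rfl | rfl <;> simp
  · have hy0 : ε * max (ν x) (ν y) ≤ ν y := by
      rw [mul_max_of_nonneg _ _ hε.le]
      exact max_le (not_le.1 hxy).le (by nlinarith)
    have hMpos : 0 < max (ν x) (ν y) :=
      lt_max_of_lt_right (lt_of_le_of_lt (by positivity) (not_le.1 hxy))
    have hb := pow_le_of_bezout hν hp hq (le_max_left _ _ : _ ≤ m) (le_max_right _ _) huv x y
    set F := max (ν (homEval n p x y)) (ν (homEval n q x y))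
    have hF : 0 ≤ F := le_max_of_le_left (apply_nonneg ν _)
    set M := max (ν x) (ν y)
    have h1 : ε ^ (m + n) * M ^ n * M ^ m ≤ C₁ * F * M ^ m := by
      calc ε ^ (m + n) * M ^ n * M ^ m = (ε * M) ^ (m + n) := by ring
        _ ≤ ν y ^ (m + n) := by gcongr
        _ ≤ _ := hb
        _ ≤ C₁ * M ^ m * F := by
            gcongr
            linarith
        _ = _ := by ring
    have h2 := le_of_mul_le_mul_right h1 (by positivity)
    calc _ ≤ ε ^ (m + n) / C₁ * M ^ n := by
          gcongr
          exact min_le_right _ _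
      _ = ε ^ (m + n) * M ^ n / C₁ := by ring
      _ ≤ F := by
          rw [div_le_iff₀ hC₁pos]
          linarith

lemma coeff_ratDegree_ne_zero (f : RatFunc K) :
    f.num.coeff (ratDegree f) ≠ 0 ∨ f.denom.coeff (ratDegree f) ≠ 0 := by
  rcases le_or_gt f.num.natDegree f.denom.natDegree with h | h
  · right
    rw [ratDegree, max_eq_right h]
    exact Polynomial.leadingCoeff_ne_zero.2 f.denom_ne_zero
  · left
    rw [ratDegree, max_eq_left h.le]
    refine Polynomial.leadingCoeff_ne_zero.2 ?_
    rintro h0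
    simp [h0] at h

variable (A) in
lemma exists_abs_log_lift_le (f : RatFunc K) :
    ∃ B : ℝ, ∀ ν : MulRingSeminorm A, ExtendsNorm K ν → ∀ p : A × A,
      0 < pairNorm K (ν p.1) (ν p.2) →
      0 < pairNorm K (ν (lift f p).1) (ν (lift f p).2) ∧
      |Real.log (pairNorm K (ν (lift f p).1) (ν (lift f p).2)) -
        ratDegree f * Real.log (pairNorm K (ν p.1) (ν p.2))| ≤ B := by
  set d := ratDegree f with hd
  obtain ⟨C, hC, hlow⟩ := exists_le_max_map_homEval (A := A) f.isCoprime_num_denom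
    (le_max_left _ _ : _ ≤ d) (le_max_right _ _ : _ ≤ d) (coeff_ratDegree_ne_zero f)
  set D : ℝ := coeffSum d f.num + coeffSum d f.denom + 1 with hD
  have hDpos : 0 < D := by
    have := coeffSum_nonneg d f.num
    have := coeffSum_nonneg d f.denom
    positivity
  refine ⟨|Real.log (C / 2 ^ d)| + |Real.log (2 * D)|, fun ν hν p hp => ?_⟩
  have h0 : ∀ x, 0 ≤ ν x := apply_nonneg ν
  set N := pairNorm K (ν p.1) (ν p.2) with hN
  set N' := pairNorm K (ν (lift f p).1) (ν (lift f p).2) with hN'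
  set M := max (ν p.1) (ν p.2) with hM
  have hM0 : 0 ≤ M := le_max_of_le_left (h0 _)
  have hMN : M ≤ N := max_le_pairNorm
  have hNM : N ≤ 2 * M := pairNorm_le_two_mul_max (h0 _) (h0 _)
  have hl : (lift f p).1 = homEval d f.num p.1 p.2 := rfl
  have hr : (lift f p).2 = homEval d f.denom p.1 p.2 := rfl
  have hlo : C / 2 ^ d * N ^ d ≤ N' := by
    calc C / 2 ^ d * N ^ d ≤ C / 2 ^ d * (2 * M) ^ d := by gcongr
      _ = C * M ^ d := by rw [mul_pow]; field_simp
      _ ≤ _ := hlow ν hν p.1 p.2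
      _ ≤ N' := max_le_pairNorm
  have hup : N' ≤ 2 * D * N ^ d := by
    have hMd : 0 ≤ M ^ d := by positivity
    have h1 := coeffSum_nonneg d f.num
    have h2 := coeffSum_nonneg d f.denom
    calc N' ≤ 2 * max (ν (lift f p).1) (ν (lift f p).2) := pairNorm_le_two_mul_max (h0 _) (h0 _)
      _ ≤ 2 * (D * M ^ d) := by
          gcongr
          refine max_le ?_ ?_
          · rw [hl]
            refine (map_homEval_le hν _ _ _ _).trans ?_
            gcongr
            linarith
          · rw [hr]
            refine (map_homEval_le hν _ _ _ _).trans ?_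
            gcongr
            linarith
      _ ≤ 2 * (D * N ^ d) := by gcongr
      _ = _ := by ring
  have hNd : 0 < N ^ d := by positivity
  have hpos : 0 < N' := lt_of_lt_of_le (by positivity) hlo
  refine ⟨hpos, ?_⟩
  have l1 := Real.log_le_log (by positivity) hlo
  have l2 := Real.log_le_log hpos hup
  rw [Real.log_mul (by positivity) (by positivity), Real.log_pow] at l1 l2
  rw [abs_le]
  constructor
  · have := neg_abs_le (Real.log (C / 2 ^ d))
    have := abs_nonneg (Real.log (2 * D))
    linarith
  · have := le_abs_self (Real.log (2 * D))
    have := abs_nonneg (Real.log (C / 2 ^ d))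
    linarith

end Lift

section Green

lemma abs_limUnder_le {d B : ℝ} (hd : 1 < d) {r : ℕ → ℝ}
    (hr : ∀ n, |r (n + 1) - d * r n| ≤ B) :
    |limUnder atTop fun n : ℕ => (r n - d ^ n * r 0) / d ^ n| ≤ B / d / (1 - 1 / d) := by
  set u : ℕ → ℝ := fun n => (r n - d ^ n * r 0) / d ^ n with hu
  have hd0 : 0 < d := by linarith
  have hstep : ∀ n, dist (u n) (u (n + 1)) ≤ B / d * (1 / d) ^ n := by
    intro n
    have : u n - u (n + 1) = -(r (n + 1) - d * r n) / d ^ (n + 1) := by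
      simp only [hu]
      field_simp
      ring
    rw [Real.dist_eq, this, abs_div, abs_neg, abs_of_pos (by positivity : 0 < d ^ (n + 1))]
    calc _ ≤ B / d ^ (n + 1) := by gcongr; exact hr n
      _ = _ := by rw [one_div_pow, pow_succ]; field_simp
  have h1 : 1 / d < 1 := by rw [div_lt_one hd0]; exact hd
  have hc := (cauchySeq_of_le_geometric _ _ h1 hstep).tendsto_limUnder
  have := dist_le_of_le_geometric_of_tendsto₀ _ _ h1 hstep hc
  have h0 : u 0 = 0 := by simp [hu]
  rwa [h0, dist_comm, Real.dist_eq, sub_zero] at this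

variable {K : Type*} [NontriviallyNormedField K]

/-- The absolute value of `K` as a multiplicative seminorm. -/
noncomputable def normSeminorm : MulRingSeminorm K where
  toFun := fun x => ‖x‖
  map_zero' := norm_zero
  add_le' := norm_add_le
  neg' := norm_neg
  map_one' := norm_one
  map_mul' := norm_mul

lemma abs_limUnder_iterate_lift_le {A : Type*} [CommRing A] [Algebra K A] {f : RatFunc K}
    (hf : 1 < ratDegree f) {ν : MulRingSeminorm A} {B : ℝ}
    (hB : ∀ p : A × A, 0 < pairNorm K (ν p.1) (ν p.2) →
      0 < pairNorm K (ν (lift f p).1) (ν (lift f p).2) ∧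
      |Real.log (pairNorm K (ν (lift f p).1) (ν (lift f p).2)) -
        ratDegree f * Real.log (pairNorm K (ν p.1) (ν p.2))| ≤ B)
    {p : A × A} (hp : 0 < pairNorm K (ν p.1) (ν p.2)) :
    |limUnder atTop fun n : ℕ =>
      (Real.log (pairNorm K (ν ((lift f)^[n] p).1) (ν ((lift f)^[n] p).2)) -
        (ratDegree f : ℝ) ^ n * Real.log (pairNorm K (ν p.1) (ν p.2))) / (ratDegree f : ℝ) ^ n| ≤
      B / ratDegree f / (1 - 1 / ratDegree f) := by
  have hpos : ∀ n, 0 < pairNorm K (ν ((lift f)^[n] p).1) (ν ((lift f)^[n] p).2) := by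
    intro n
    induction n with
    | zero => exact hp
    | succ n ih => rw [Function.iterate_succ_apply']; exact (hB _ ih).1
  refine abs_limUnder_le
    (r := fun n => Real.log (pairNorm K (ν ((lift f)^[n] p).1) (ν ((lift f)^[n] p).2)))
    (by exact_mod_cast hf) fun n => ?_
  simp only [Function.iterate_succ_apply']
  exact (hB _ (hpos n)).2

lemma exists_abs_greenLift_le {f : RatFunc K} (hf : 1 < ratDegree f) :
    ∃ B : ℝ, ∀ S : BerkP1 K, |greenLift f S| ≤ B := by
  obtain ⟨B₁, hB₁⟩ := exists_abs_log_lift_le K f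
  obtain ⟨B₂, hB₂⟩ := exists_abs_log_lift_le K[X] f
  refine ⟨max (B₁ / ratDegree f / (1 - 1 / ratDegree f))
    (B₂ / ratDegree f / (1 - 1 / ratDegree f)), fun S => ?_⟩
  induction S using OnePoint.rec with
  | infty =>
    refine le_max_of_le_left ?_
    exact abs_limUnder_iterate_lift_le (p := ((1 : K), (0 : K))) hf
      (hB₁ normSeminorm fun a x => norm_mul a x)
      (lt_of_lt_of_le (lt_max_of_lt_left (by simp [map_one])) max_le_pairNorm)
  | coe x =>
    refine le_max_of_le_right ?_
    exact abs_limUnder_iterate_lift_le (p := ((Polynomial.X : K[X]), (1 : K[X]))) hf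
      (hB₂ x.1 fun a P => by rw [Polynomial.smul_eq_C_mul, map_mul, x.2])
      (lt_of_lt_of_le (lt_max_of_lt_right (by simp [map_one])) max_le_pairNorm)

lemma supGreen_lt_top {f : RatFunc K} (hf : 1 < ratDegree f) : supGreen f < ⊤ := by
  obtain ⟨B, hB⟩ := exists_abs_greenLift_le hf
  set V := (equilibriumEnergy (greenLift f)).toReal / 2 with hV
  refine lt_of_le_of_lt (iSup_le fun S => ?_) (ENNReal.ofReal_lt_top (r := B + |V|))
  rw [Real.enorm_eq_ofReal_abs]
  exact ENNReal.ofReal_le_ofReal ((abs_add_le _ _).trans (by gcongr; exact hB S))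

end Green

section LocalDeriv

variable {K : Type*} [NontriviallyNormedField K]

lemma param_zero (c : OnePoint K) : param c 0 = c := by
  induction c using OnePoint.rec with
  | infty => exact if_pos rfl
  | coe z => exact congrArg OnePoint.some (add_zero z)

lemma param_infty_of_ne_zero {t : K} (ht : t ≠ 0) :
    param (.infty : OnePoint K) t = .some t⁻¹ := if_neg ht

lemma coord_self (c : OnePoint K) : coord c c = 0 := by
  induction c using OnePoint.rec with
  | infty => rfl
  | coe z => exact sub_self z

lemma localRep_zero (φ : OnePoint K → OnePoint K) (c : OnePoint K) : localRep φ c 0 = 0 := by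
  rw [localRep, param_zero, coord_self]

/-- `φ` has derivative `v` at `c` in the local coordinates, and maps points near `c` into the
domain of the local coordinate at `φ c`. -/
def HasLocalDeriv (φ : OnePoint K → OnePoint K) (c : OnePoint K) (v : K) : Prop :=
  HasDerivAt (localRep φ c) v 0 ∧ ∀ᶠ t in 𝓝 (0 : K), param (φ c) (localRep φ c t) = φ (param c t)

lemma HasLocalDeriv.mem_critSet_iff {φ : OnePoint K → OnePoint K} {c : OnePoint K} {v : K}
    (h : HasLocalDeriv φ c v) : c ∈ critSet φ ↔ v = 0 :=
  ⟨fun h' => h.1.unique h', fun h' => (h' ▸ h.1 : HasDerivAt (localRep φ c) 0 0)⟩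

lemma HasLocalDeriv.comp {φ ψ : OnePoint K → OnePoint K} {c : OnePoint K} {v w : K}
    (hφ : HasLocalDeriv φ (ψ c) w) (hψ : HasLocalDeriv ψ c v) :
    HasLocalDeriv (φ ∘ ψ) c (w * v) := by
  have h0 := localRep_zero ψ c
  have heq : localRep (φ ∘ ψ) c =ᶠ[𝓝 0] localRep φ (ψ c) ∘ localRep ψ c := by
    filter_upwards [hψ.2] with t ht
    simp only [localRep, Function.comp_apply] at ht ⊢
    rw [ht]
  have hcont : Tendsto (localRep ψ c) (𝓝 0) (𝓝 0) := by
    simpa [h0] using hψ.1.continuousAt.tendsto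
  refine ⟨HasDerivAt.congr_of_eventuallyEq ?_ heq, ?_⟩
  · refine HasDerivAt.comp (0 : K) ?_ hψ.1
    rw [h0]
    exact hφ.1
  · filter_upwards [hψ.2, heq, hcont.eventually hφ.2] with t h1 h2 h3
    rw [h2, Function.comp_apply, Function.comp_apply, h3, h1]
    rfl

lemma hasLocalDeriv_id (c : OnePoint K) : HasLocalDeriv id c 1 := by
  have key : ∀ t : K, localRep id c t = t := by
    intro t
    induction c using OnePoint.rec with
    | infty =>
      by_cases ht : t = 0
      · simp [ht, localRep_zero]
      · rw [localRep, param_infty_of_ne_zero ht]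
        exact inv_inv t
    | coe z => exact add_sub_cancel_left z t
  refine ⟨?_, Eventually.of_forall fun t => by rw [key]; rfl⟩
  rw [funext key]
  exact hasDerivAt_id 0

lemma hasLocalDeriv_iterate {φ : OnePoint K → OnePoint K} {v : OnePoint K → K}
    (h : ∀ c, HasLocalDeriv φ c (v c)) (n : ℕ) (c : OnePoint K) :
    HasLocalDeriv φ^[n] c (∏ j ∈ Finset.range n, v (φ^[j] c)) := by
  induction n with
  | zero => simpa using hasLocalDeriv_id c
  | succ n ih =>
    rw [Function.iterate_succ', Finset.prod_range_succ, mul_comm]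
    exact (h _).comp ih

lemma exists_mem_critSet_of_iterate {φ : OnePoint K → OnePoint K}
    (h : ∀ c, ∃ v, HasLocalDeriv φ c v) {n : ℕ} {c : OnePoint K} (hc : c ∈ critSet φ^[n]) :
    ∃ j < n, φ^[j] c ∈ critSet φ := by
  choose v hv using h
  rw [(hasLocalDeriv_iterate hv n c).mem_critSet_iff, Finset.prod_eq_zero_iff] at hc
  obtain ⟨j, hj, h0⟩ := hc
  exact ⟨j, Finset.mem_range.1 hj, (hv _).mem_critSet_iff.2 h0⟩

/-- A fixed point of `φⁿ` that is a superattracting fixed point of `φᵐ` is critical for `φⁿ`. -/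
lemma mem_critSet_iterate_of_fix {φ : OnePoint K → OnePoint K}
    (h : ∀ c, ∃ v, HasLocalDeriv φ c v) {m n : ℕ} (hn : n ≠ 0) {a : OnePoint K}
    (ham : φ^[m] a = a) (hac : a ∈ critSet φ^[m]) (han : φ^[n] a = a) : a ∈ critSet φ^[n] := by
  choose v hv using h
  obtain ⟨w, hw⟩ : ∃ w, HasLocalDeriv φ^[n] a w := ⟨_, hasLocalDeriv_iterate hv n a⟩
  have hm : HasLocalDeriv φ^[m] a 0 := by
    have := hasLocalDeriv_iterate hv m a
    rwa [this.mem_critSet_iff.1 hac] at this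
  have h1 : ∀ k, HasLocalDeriv (φ^[n])^[k] a (w ^ k) := by
    intro k
    induction k with
    | zero => simpa using hasLocalDeriv_id a
    | succ k ih =>
      rw [Function.iterate_succ, pow_succ]
      exact HasLocalDeriv.comp (by rwa [han]) hw
  have h2 : ∀ k, HasLocalDeriv (φ^[m])^[k + 1] a 0 := by
    intro k
    induction k with
    | zero => simpa using hm
    | succ k ih =>
      rw [Function.iterate_succ]
      simpa using HasLocalDeriv.comp (v := 0) (w := 0) (by rwa [ham]) hm
  obtain ⟨k, rfl⟩ := Nat.exists_eq_succ_of_ne_zero hn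
  have h3 := h1 m
  rw [← Function.iterate_mul, mul_comm, Function.iterate_mul] at h3
  rw [hw.mem_critSet_iff]
  exact eq_zero_of_pow_eq_zero (h3.1.unique (h2 k).1)

lemma fixMult_le_one {φ : OnePoint K → OnePoint K} {a : OnePoint K} (h : a ∈ critSet φ) :
    fixMult φ a ≤ 1 := by
  unfold fixMult
  by_cases ha : AnalyticAt K (fun t : K => localRep φ a t - t) 0
  · refine (ha.analyticOrderAt_eq_one_of_zero_deriv_ne_zero (by simp [localRep_zero]) ?_).le
    have : HasDerivAt (fun t : K => localRep φ a t - t) (0 - 1) 0 :=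
      HasDerivAt.sub h (hasDerivAt_id 0)
    simp [this.deriv]
  · simp [analyticOrderAt_of_not_analyticAt ha]

end LocalDeriv

section Proj

variable {K : Type*} [NontriviallyNormedField K]

open Classical in
/-- The point of `ℙ¹(K)` with homogeneous coordinates `(x, y)`. -/
noncomputable def proj (x y : K) : OnePoint K := if y = 0 then .infty else .some (x / y)

lemma proj_of_eq_zero {x y : K} (h : y = 0) : proj x y = .infty := if_pos h

lemma proj_of_ne_zero {x y : K} (h : y ≠ 0) : proj x y = .some (x / y) := if_neg h

lemma proj_mul {a : K} (ha : a ≠ 0) (x y : K) : proj (a * x) (a * y) = proj x y := by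
  by_cases hy : y = 0
  · rw [proj_of_eq_zero hy, proj_of_eq_zero (by simp [hy])]
  · rw [proj_of_ne_zero hy, proj_of_ne_zero (mul_ne_zero ha hy), mul_div_mul_left _ _ ha]

lemma hasLocalDeriv_of_proj {φ : OnePoint K → OnePoint K} {c : OnePoint K} {P Q : K[X]}
    (h : ∀ t, φ (param c t) = proj (P.eval t) (Q.eval t)) (h0 : P.eval 0 ≠ 0 ∨ Q.eval 0 ≠ 0) :
    ∃ s : K, s ≠ 0 ∧ HasLocalDeriv φ c (s * (Polynomial.wronskian P Q).eval 0) := by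
  have hW : (Polynomial.wronskian P Q).eval 0 =
      P.eval 0 * Q.derivative.eval 0 - P.derivative.eval 0 * Q.eval 0 := by
    simp [Polynomial.wronskian]
  have hφ : φ c = proj (P.eval 0) (Q.eval 0) := by rw [← h, param_zero]
  have dP := P.hasDerivAt (0 : K)
  have dQ := Q.hasDerivAt (0 : K)
  by_cases hQ : Q.eval 0 = 0
  · have hP : P.eval 0 ≠ 0 := h0.resolve_right (not_not.2 hQ)
    have hφ' : φ c = .infty := by rw [hφ, proj_of_eq_zero hQ]
    have hloc : localRep φ c = fun t => Q.eval t / P.eval t := by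
      funext t
      rw [localRep, hφ', h]
      by_cases ht : Q.eval t = 0
      · rw [proj_of_eq_zero ht, ht, zero_div]
        rfl
      · rw [proj_of_ne_zero ht]
        exact inv_div _ _
    refine ⟨(P.eval 0 ^ 2)⁻¹, inv_ne_zero (pow_ne_zero _ hP), ?_, ?_⟩
    · rw [hloc]
      refine (dQ.div dP hP).congr_deriv ?_
      rw [hW]
      field_simp
    · filter_upwards [P.continuous.continuousAt.eventually_ne hP] with t ht
      rw [h, hφ', hloc]
      by_cases hQt : Q.eval t = 0
      · simp only [hQt, zero_div, param_zero, proj_of_eq_zero]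
      · rw [proj_of_ne_zero hQt, param_infty_of_ne_zero (div_ne_zero hQt ht), inv_div]
  · have hφ' : φ c = .some (P.eval 0 / Q.eval 0) := by rw [hφ, proj_of_ne_zero hQ]
    have hev := Q.continuous.continuousAt.eventually_ne hQ
    have hloc : localRep φ c =ᶠ[𝓝 0] fun t => P.eval t / Q.eval t - P.eval 0 / Q.eval 0 := by
      filter_upwards [hev] with t ht
      rw [localRep, hφ', h, proj_of_ne_zero ht]
      rfl
    refine ⟨-(Q.eval 0 ^ 2)⁻¹, neg_ne_zero.2 (inv_ne_zero (pow_ne_zero _ hQ)), ?_, ?_⟩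
    · refine HasDerivAt.congr_of_eventuallyEq ?_ hloc
      refine ((dP.div dQ hQ).sub_const (P.eval 0 / Q.eval 0)).congr_deriv ?_
      rw [hW]
      field_simp
      ring
    · filter_upwards [hev, hloc] with t ht hl
      rw [h, hφ', hl, proj_of_ne_zero ht]
      exact congrArg OnePoint.some (add_sub_cancel _ _)

variable (f : RatFunc K)

lemma ratMap_param_coe (z t : K) :
    ratMap f (param (.some z) t) =
      proj ((f.num.comp (Polynomial.X + Polynomial.C z)).eval t)
        ((f.denom.comp (Polynomial.X + Polynomial.C z)).eval t) := by
  simp only [Polynomial.eval_comp, Polynomial.eval_add, Polynomial.eval_X, Polynomial.eval_C,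
    add_comm t z]
  rfl

lemma eval_reflect_eq {n : ℕ} {p : K[X]} (hp : p.natDegree ≤ n) {t : K} (ht : t ≠ 0) :
    (p.reflect n).eval t = t ^ n * p.eval t⁻¹ := by
  let _ : Invertible t⁻¹ := invertibleOfNonzero (inv_ne_zero ht)
  have := Polynomial.eval₂_reflect_mul_pow (RingHom.id K) t⁻¹ n p hp
  simp only [invOf_eq_inv, inv_inv, Polynomial.eval₂_id] at this
  rw [← this, mul_comm, mul_assoc, ← mul_pow, inv_mul_cancel₀ ht, one_pow, mul_one]

lemma eval_zero_reflect (n : ℕ) (p : K[X]) : (p.reflect n).eval 0 = p.coeff n := by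
  rw [← Polynomial.coeff_zero_eq_eval_zero, Polynomial.coeff_reflect, Polynomial.revAt_zero]

lemma natDegree_num_le_ratDegree : f.num.natDegree ≤ ratDegree f := le_max_left _ _

lemma natDegree_denom_le_ratDegree : f.denom.natDegree ≤ ratDegree f := le_max_right _ _

lemma ratMap_infty_eq_proj :
    ratMap f .infty = proj (f.num.coeff (ratDegree f)) (f.denom.coeff (ratDegree f)) := by
  by_cases h : f.denom.natDegree < f.num.natDegree
  · refine (if_pos h).trans ?_
    rw [proj_of_eq_zero]
    rw [ratDegree, max_eq_left h.le]
    exact Polynomial.coeff_eq_zero_of_natDegree_lt h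
  · refine (if_neg h).trans ?_
    rw [ratDegree, max_eq_right (not_lt.1 h), proj_of_ne_zero]
    · rfl
    · exact Polynomial.leadingCoeff_ne_zero.2 f.denom_ne_zero

lemma ratMap_param_infty (t : K) :
    ratMap f (param .infty t) =
      proj ((f.num.reflect (ratDegree f)).eval t) ((f.denom.reflect (ratDegree f)).eval t) := by
  by_cases ht : t = 0
  · rw [ht, param_zero, eval_zero_reflect, eval_zero_reflect, ratMap_infty_eq_proj]
  · rw [eval_reflect_eq (natDegree_num_le_ratDegree f) ht,
      eval_reflect_eq (natDegree_denom_le_ratDegree f) ht, proj_mul (pow_ne_zero _ ht),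
      param_infty_of_ne_zero ht]
    rfl

lemma eval_num_ne_zero_or (z : K) : f.num.eval z ≠ 0 ∨ f.denom.eval z ≠ 0 := by
  by_contra! h
  obtain ⟨u, v, huv⟩ := f.isCoprime_num_denom
  simpa [h.1, h.2] using congrArg (Polynomial.eval z) huv

lemma hasLocalDeriv_ratMap_coe (z : K) : ∃ s : K, s ≠ 0 ∧
    HasLocalDeriv (ratMap f) (.some z) (s * (Polynomial.wronskian f.num f.denom).eval z) := by
  obtain ⟨s, hs, h⟩ := hasLocalDeriv_of_proj (ratMap_param_coe f z)
    (by simpa using eval_num_ne_zero_or f z)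
  refine ⟨s, hs, ?_⟩
  convert h using 2
  simp [Polynomial.wronskian, Polynomial.derivative_comp]

lemma hasLocalDeriv_ratMap_infty : ∃ s : K, s ≠ 0 ∧
    HasLocalDeriv (ratMap f) .infty (s * (Polynomial.wronskian (f.num.reflect (ratDegree f))
      (f.denom.reflect (ratDegree f))).eval 0) :=
  hasLocalDeriv_of_proj (ratMap_param_infty f)
    (by simpa only [eval_zero_reflect] using coeff_ratDegree_ne_zero f)

lemma exists_hasLocalDeriv_ratMap (c : OnePoint K) : ∃ v, HasLocalDeriv (ratMap f) c v := by
  induction c using OnePoint.rec with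
  | infty => exact ⟨_, (hasLocalDeriv_ratMap_infty f).choose_spec.2⟩
  | coe z => exact ⟨_, (hasLocalDeriv_ratMap_coe f z).choose_spec.2⟩

lemma coe_mem_critSet_ratMap_iff (z : K) :
    (OnePoint.some z) ∈ critSet (ratMap f) ↔ (Polynomial.wronskian f.num f.denom).eval z = 0 := by
  obtain ⟨s, hs, h⟩ := hasLocalDeriv_ratMap_coe f z
  simp [h.mem_critSet_iff, hs]

lemma infty_mem_critSet_ratMap_iff :
    OnePoint.infty ∈ critSet (ratMap f) ↔
      (Polynomial.wronskian (f.num.reflect (ratDegree f))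
        (f.denom.reflect (ratDegree f))).eval 0 = 0 := by
  obtain ⟨s, hs, h⟩ := hasLocalDeriv_ratMap_infty f
  simp [h.mem_critSet_iff, hs]

end Proj

section Critical

variable {K : Type*} [NontriviallyNormedField K]

lemma coeff_mul_second {m n : ℕ} {p q : K[X]} (hp : p.natDegree ≤ m + 1)
    (hq : q.natDegree ≤ n + 1) :
    (p * q).coeff (m + n + 1) = p.coeff (m + 1) * q.coeff n + p.coeff m * q.coeff (n + 1) := by
  rw [Polynomial.coeff_mul, ← Finset.sum_subset (s₁ := {(m + 1, n), (m, n + 1)}),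
    Finset.sum_pair (by simp)]
  · intro x hx
    simp only [Finset.mem_insert, Finset.mem_singleton] at hx
    rcases hx with rfl | rfl <;> simp <;> omega
  · rintro ⟨i, j⟩ hx hx'
    have hij : i + j = m + n + 1 := Finset.HasAntidiagonal.mem_antidiagonal.1 hx
    simp only [Finset.mem_insert, Finset.mem_singleton, Prod.mk.injEq, not_or] at hx'
    rcases lt_or_ge (m + 1) i with h | h
    · rw [Polynomial.coeff_eq_zero_of_natDegree_lt (by omega), zero_mul]
    · rw [Polynomial.coeff_eq_zero_of_natDegree_lt (p := q) (by omega), mul_zero]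

/-- The top coefficient of the Wronskian is the value at `0` of the Wronskian in the coordinate at
infinity, up to sign. -/
lemma coeff_wronskian_eq {n : ℕ} {p q : K[X]} (hp : p.natDegree ≤ n + 2) (hq : q.natDegree ≤ n + 2) :
    (Polynomial.wronskian p q).coeff (2 * n + 2) =
      -(Polynomial.wronskian (p.reflect (n + 2)) (q.reflect (n + 2))).eval 0 := by
  have hp' : p.derivative.natDegree ≤ n + 1 := (Polynomial.natDegree_derivative_le p).trans (by omega)
  have hq' : q.derivative.natDegree ≤ n + 1 := (Polynomial.natDegree_derivative_le q).trans (by omega)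
  have e1 := coeff_mul_second (m := n + 1) (n := n) hp hq'
  have e2 := coeff_mul_second (m := n) (n := n + 1) hp' hq
  rw [show n + 1 + n + 1 = 2 * n + 2 by ring] at e1
  rw [show n + (n + 1) + 1 = 2 * n + 2 by ring] at e2
  have r : ∀ p : K[X], (p.reflect (n + 2)).derivative.eval 0 = p.coeff (n + 1) := by
    intro p
    rw [← Polynomial.coeff_zero_eq_eval_zero, Polynomial.coeff_derivative, Polynomial.coeff_reflect,
      Polynomial.revAt_le (by omega)]
    simp
  rw [Polynomial.wronskian, Polynomial.coeff_sub, e1, e2, Polynomial.wronskian, Polynomial.eval_sub,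
    Polynomial.eval_mul, Polynomial.eval_mul, r, r, eval_zero_reflect, eval_zero_reflect]
  simp only [Polynomial.coeff_derivative]
  push_cast
  ring

variable [CharZero K] {f : RatFunc K}

lemma wronskian_ne_zero (hf : 1 < ratDegree f) : Polynomial.wronskian f.num f.denom ≠ 0 := by
  intro h
  rw [f.isCoprime_num_denom.wronskian_eq_zero_iff] at h
  have h1 := Polynomial.derivative_eq_zero.1 h.1
  have h2 := Polynomial.derivative_eq_zero.1 h.2
  simp [ratDegree, h1, h2] at hf

lemma critSet_ratMap_finite (hf : 1 < ratDegree f) : (critSet (ratMap f)).Finite := by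
  have hfin : {z : K | (Polynomial.wronskian f.num f.denom).IsRoot z}.Finite :=
    Polynomial.finite_setOfPred_isRoot (wronskian_ne_zero hf)
  refine ((hfin.image OnePoint.some).insert .infty).subset fun c hc => ?_
  induction c using OnePoint.rec with
  | infty => exact Set.mem_insert _ _
  | coe z => exact .inr ⟨z, (coe_mem_critSet_ratMap_iff f z).1 hc, rfl⟩

lemma SAT_finite (hf : 1 < ratDegree f) : (SAT f).Finite := by
  set C : Set (OnePoint K) := {c | c ∈ critSet (ratMap f) ∧ c ∈ Function.periodicPts (ratMap f)}
  have hC : C.Finite := (critSet_ratMap_finite hf).subset fun c hc => hc.1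
  have horb : ∀ c ∈ C, (Set.range fun k => (ratMap f)^[k] c).Finite := by
    rintro c ⟨-, hc⟩
    refine ((Set.finite_lt_nat (Function.minimalPeriod (ratMap f) c)).image
      fun k => (ratMap f)^[k] c).subset ?_
    rintro _ ⟨k, rfl⟩
    exact ⟨k % Function.minimalPeriod (ratMap f) c,
      Nat.mod_lt _ (Function.minimalPeriod_pos_of_mem_periodicPts hc),
      Function.iterate_mod_minimalPeriod_eq⟩
  refine (hC.biUnion horb).subset fun a ha => ?_
  obtain ⟨n, hfix, hcrit⟩ := Set.mem_iUnion.1 ha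
  obtain ⟨j, hj, hjc⟩ := exists_mem_critSet_of_iterate (exists_hasLocalDeriv_ratMap f) hcrit
  have hper : Function.IsPeriodicPt (ratMap f) n a := hfix
  refine Set.mem_biUnion ⟨hjc, n, n.pos, hper.apply_iterate j⟩ ⟨n - j, ?_⟩
  change (ratMap f)^[n - j] ((ratMap f)^[j] a) = a
  rw [← Function.iterate_add_apply, Nat.sub_add_cancel hj.le]
  exact hfix

end Critical

section TotallyInvariant

lemma mem_backwardOrbit_iterate {K : Type*} [NontriviallyNormedField K] (f : RatFunc K) (j : ℕ)
    (c : OnePoint K) :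
    c ∈ backwardOrbit f ((ratMap f)^[j] c) :=
  Set.mem_iUnion.2 ⟨j, rfl⟩

open Polynomial in
lemma eq_C_mul_X_sub_C_pow {K : Type*} [Field K] [IsAlgClosed K] {p : K[X]} {α : K}
    (h : ∀ z, p.eval z = 0 → z = α) : p = C p.leadingCoeff * (X - C α) ^ p.natDegree := by
  by_cases hp : p = 0
  · simp [hp]
  have hs : p.Splits := IsAlgClosed.splits p
  have hr : p.roots = Multiset.replicate p.natDegree α := by
    rw [Multiset.eq_replicate]
    exact ⟨hs.natDegree_eq_card_roots.symm, fun z hz => h z (mem_roots hp |>.1 hz)⟩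
  conv_lhs => rw [hs.eq_prod_roots, hr]
  simp

variable {K : Type*} [NontriviallyNormedField K] [IsAlgClosed K] [CharZero K] {f : RatFunc K}

open Polynomial in
lemma exists_mem_critSet_ne_infty (hf : 1 < ratDegree f)
    (h : ∀ x, ratMap f x = .infty → x = .infty) : ∃ c ∈ critSet (ratMap f), c ≠ .infty := by
  have hd : f.denom.natDegree = 0 := by
    by_contra h0
    obtain ⟨z, hz⟩ := IsAlgClosed.exists_root f.denom
      (fun h1 => h0 (natDegree_eq_of_degree_eq_some h1))
    exact OnePoint.coe_ne_infty z (h (.some z) (if_pos hz))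
  have hn : f.num.natDegree ≠ 0 ∧ f.num.natDegree ≠ 1 := by
    simp only [ratDegree, hd] at hf
    omega
  have hroot : f.num.derivative.degree ≠ 0 := by
    intro h0
    have h1 : f.num.derivative.natDegree = 0 := natDegree_eq_of_degree_eq_some h0
    rw [natDegree_derivative] at h1
    omega
  obtain ⟨z, hz⟩ := IsAlgClosed.exists_root f.num.derivative hroot
  refine ⟨.some z, (coe_mem_critSet_ratMap_iff f z).2 ?_, OnePoint.coe_ne_infty z⟩
  have hz' : f.num.derivative.eval z = 0 := hz
  simp [wronskian, derivative_eq_zero.2 hd, hz']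

open Polynomial in
lemma exists_mem_critSet_ne_coe (hf : 1 < ratDegree f) {α : K}
    (h : ∀ x, ratMap f x = .some α → x = .some α) :
    ∃ c ∈ critSet (ratMap f), c ≠ .some α := by
  set H : K[X] := f.num - C α * f.denom with hH
  have hHd : H.natDegree ≤ ratDegree f :=
    (natDegree_sub_le _ _).trans (max_le (natDegree_num_le_ratDegree f)
      ((natDegree_C_mul_le _ _).trans (natDegree_denom_le_ratDegree f)))
  have hroots : ∀ z, H.eval z = 0 → z = α := by
    intro z hz
    simp only [hH, eval_sub, eval_mul, eval_C, sub_eq_zero] at hz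
    have hD : f.denom.eval z ≠ 0 := by
      intro h0
      rw [h0, mul_zero] at hz
      exact (eval_num_ne_zero_or f z).elim (· hz) (· h0)
    refine OnePoint.coe_injective (h (.some z) ((if_neg hD).trans ?_))
    rw [hz, mul_div_cancel_right₀ _ hD]
  have hcoeff : H.coeff (ratDegree f) ≠ 0 := by
    intro h0
    simp only [hH, coeff_sub, coeff_C_mul, sub_eq_zero] at h0
    have hD : f.denom.coeff (ratDegree f) ≠ 0 := by
      intro h1
      rw [h1, mul_zero] at h0
      exact (coeff_ratDegree_ne_zero f).elim (· h0) (· h1)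
    refine OnePoint.infty_ne_coe α (h .infty ?_)
    rw [ratMap_infty_eq_proj, proj_of_ne_zero hD, h0, mul_div_cancel_right₀ _ hD]
  have hdeg : H.natDegree = ratDegree f := le_antisymm hHd (le_natDegree_of_ne_zero hcoeff)
  obtain ⟨n, hn⟩ : ∃ n, ratDegree f = n + 2 := ⟨ratDegree f - 2, by omega⟩
  have hHeq := eq_C_mul_X_sub_C_pow hroots
  rw [hdeg, hn] at hHeq
  set l := H.leadingCoeff with hl
  set E : K[X] := (X - C α) * f.denom.derivative - C ((n : K) + 2) * f.denom with hE
  have hW : wronskian f.num f.denom = C l * (X - C α) ^ (n + 1) * E := by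
    have h1 : wronskian f.num f.denom = wronskian H f.denom := by
      simp only [wronskian, hH, derivative_sub, derivative_C_mul]
      ring
    rw [h1, hHeq, wronskian, hE]
    simp only [derivative_C_mul, derivative_X_sub_C_pow]
    simp only [Nat.cast_add, Nat.cast_ofNat, C_add, C_ofNat, map_natCast,
      show n + 2 - 1 = n + 1 from rfl]
    ring
  by_cases hEd : E.degree = 0
  · refine ⟨.infty, (infty_mem_critSet_ratMap_iff f).2 ?_, OnePoint.infty_ne_coe α⟩
    have hnum := natDegree_num_le_ratDegree f
    have hden := natDegree_denom_le_ratDegree f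
    rw [hn] at hnum hden ⊢
    rw [← neg_eq_zero, ← coeff_wronskian_eq hnum hden]
    refine coeff_eq_zero_of_natDegree_lt (lt_of_le_of_lt (b := n + 1) ?_ (by omega))
    rw [hW]
    refine natDegree_mul_le.trans ?_
    rw [natDegree_eq_of_degree_eq_some hEd]
    refine (natDegree_C_mul_le _ _).trans ?_
    rw [natDegree_pow, natDegree_X_sub_C, mul_one]
  · obtain ⟨z, hz⟩ := IsAlgClosed.exists_root E hEd
    have hz' : E.eval z = 0 := hz
    refine ⟨.some z, (coe_mem_critSet_ratMap_iff f z).2 (by simp [hW, hz']), ?_⟩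
    intro hzα
    have hzα : z = α := OnePoint.coe_injective hzα
    rw [hzα] at hz'
    have hD : f.denom.eval α = 0 := by
      have hn0 : (n : K) + 2 ≠ 0 := by exact_mod_cast (by omega : n + 2 ≠ 0)
      simpa [hE, hn0] using hz'
    have hHα : H.eval α = 0 := by rw [hHeq]; simp
    have hN : f.num.eval α = 0 := by simpa [hH, hD] using hHα
    exact (eval_num_ne_zero_or f α).elim (· hN) (· hD)

lemma exists_mem_critSet_ne (hf : 1 < ratDegree f) {a : OnePoint K}
    (h : ∀ x, ratMap f x = a → x = a) : ∃ c ∈ critSet (ratMap f), c ≠ a := by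
  induction a using OnePoint.rec with
  | infty => exact exists_mem_critSet_ne_infty hf h
  | coe α => exact exists_mem_critSet_ne_coe hf h

/-- A separation constant is at most `1` as soon as there is a superattracting periodic point. -/
lemma separation_le_one (hf : 1 < ratDegree f) {δ : ℝ} {a : OnePoint K} (ha : a ∈ SAT f)
    (hsep : ∀ c ∈ critSet (ratMap f), backwardOrbit f c ≠ {a} →
      ∀ w ∈ backwardOrbit f c \ {a}, δ ≤ chordal a w) : δ ≤ 1 := by
  by_contra hδ
  have horb : ∀ c ∈ critSet (ratMap f), ∀ w ∈ backwardOrbit f c, w = a := by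
    intro c hc w hw
    by_contra hwa
    exact hδ ((hsep c hc (fun h => hwa (h ▸ hw : w ∈ ({a} : Set _))) w ⟨hw, hwa⟩).trans
      (chordal_le_one _ _))
  have hca : ∀ c ∈ critSet (ratMap f), c = a := fun c hc =>
    horb c hc c (mem_backwardOrbit_iterate f 0 c)
  obtain ⟨n, -, hcrit⟩ := Set.mem_iUnion.1 ha
  obtain ⟨j, -, hj⟩ := exists_mem_critSet_of_iterate (exists_hasLocalDeriv_ratMap f) hcrit
  have haC : a ∈ critSet (ratMap f) := hca _ hj ▸ hj
  obtain ⟨c, hc, hne⟩ := exists_mem_critSet_ne hf (a := a) fun x hx =>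
    horb a haC x (hx ▸ mem_backwardOrbit_iterate f 1 x)
  exact hne (hca c hc)

end TotallyInvariant

section FixMeasure

variable {K : Type*} [NontriviallyNormedField K]

instance : T2Space (BerkA1 K) :=
  T2Space.of_injective_continuous (f := fun (x : BerkA1 K) (P : K[X]) => x.1 P)
    (fun _ _ h => Subtype.ext (DFunLike.coe_injective h)) continuous_induced_dom

lemma incl_injective : Function.Injective (incl : OnePoint K → BerkP1 K) := by
  intro z w h
  induction z using OnePoint.rec with
  | infty =>
    induction w using OnePoint.rec with
    | infty => rfl
    | coe w => exact absurd h (OnePoint.infty_ne_coe _)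
  | coe z =>
    induction w using OnePoint.rec with
    | infty => exact absurd h (OnePoint.coe_ne_infty _)
    | coe w =>
      have h1 : evalPoint z = evalPoint w := OnePoint.coe_injective h
      have h2 : ‖(Polynomial.X - Polynomial.C w).eval z‖ =
          ‖(Polynomial.X - Polynomial.C w).eval w‖ :=
        congrArg (fun x : BerkA1 K => x.1 (Polynomial.X - Polynomial.C w)) h1
      simp only [Polynomial.eval_sub, Polynomial.eval_X, Polynomial.eval_C, sub_self, norm_zero,
        norm_eq_zero, sub_eq_zero] at h2
      rw [h2]

lemma fixMeasure_image_apply (φ : OnePoint K → OnePoint K) {s : Set (OnePoint K)}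
    (hs : s.Finite) : fixMeasure φ (incl '' s) =
      ∑' w : fixSet φ, (fixMult φ w : ℝ≥0∞) * s.indicator 1 (w : OnePoint K) := by
  have hm : MeasurableSet (incl '' s : Set (BerkP1 K)) := (hs.image _).measurableSet
  rw [fixMeasure, Measure.sum_apply _ hm]
  refine tsum_congr fun w => ?_
  rw [Measure.smul_apply, Measure.dirac_apply' _ hm, smul_eq_mul]
  congr 1
  by_cases hw : (w : OnePoint K) ∈ s
  · rw [Set.indicator_of_mem hw, Set.indicator_of_mem (Set.mem_image_of_mem _ hw)]
    rfl
  · rw [Set.indicator_of_notMem hw, Set.indicator_of_notMem]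
    rwa [incl_injective.mem_set_image]

lemma ae_restrict_fixMeasure (φ : OnePoint K → OnePoint K) {s : Set (OnePoint K)}
    (hs : s.Finite) : ∀ᵐ S ∂(fixMeasure φ).restrict (incl '' s), S ∈ incl '' (s ∩ fixSet φ) := by
  have hm : MeasurableSet (incl '' s : Set (BerkP1 K)) := (hs.image _).measurableSet
  have h0 : fixMeasure φ (incl '' (s \ fixSet φ)) = 0 := by
    rw [fixMeasure_image_apply φ (hs.subset Set.sdiff_subset), ENNReal.tsum_eq_zero]
    intro w
    rw [Set.indicator_of_notMem (fun h => h.2 w.2), mul_zero]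
  rw [ae_restrict_iff' hm, ae_iff]
  refine measure_mono_null ?_ h0
  rintro S hS
  simp only [Set.mem_ofPred_eq, Classical.not_imp] at hS
  obtain ⟨⟨a, ha, rfl⟩, hS⟩ := hS
  exact ⟨a, ⟨ha, fun hfix => hS ⟨a, ⟨ha, hfix⟩, rfl⟩⟩, rfl⟩

lemma fixMeasure_image_le_card (φ : OnePoint K → OnePoint K) {s : Set (OnePoint K)}
    (hs : s.Finite) (h : ∀ w ∈ s, w ∈ fixSet φ → fixMult φ w ≤ 1) :
    fixMeasure φ (incl '' s) ≤ hs.toFinset.card := by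
  rw [fixMeasure_image_apply φ hs]
  calc _ ≤ ∑' w : fixSet φ, s.indicator (1 : OnePoint K → ℝ≥0∞) (w : OnePoint K) := by
        refine ENNReal.tsum_le_tsum fun w => ?_
        by_cases hw : (w : OnePoint K) ∈ s
        · refine mul_le_of_le_one_left' ?_
          exact_mod_cast h w hw w.2
        · simp [hw]
    _ ≤ ∑' w : OnePoint K, s.indicator (1 : OnePoint K → ℝ≥0∞) w :=
        ENNReal.tsum_comp_le_tsum_of_injective Subtype.val_injective _
    _ = ∑ w ∈ hs.toFinset, s.indicator (1 : OnePoint K → ℝ≥0∞) w :=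
        tsum_eq_sum fun w hw => Set.indicator_of_notMem (by simpa using hw) _
    _ = ∑ w ∈ hs.toFinset, 1 :=
        Finset.sum_congr rfl fun w hw => Set.indicator_of_mem (by simpa using hw) _
    _ = _ := by simp

lemma supMass_lt_top [CharZero K] {f : RatFunc K} (hf : 1 < ratDegree f) : supMass f < ⊤ := by
  refine lt_of_le_of_lt (iSup_le fun n => ?_)
    (ENNReal.natCast_lt_top (SAT_finite hf).toFinset.card)
  refine fixMeasure_image_le_card _ (SAT_finite hf) fun w hw hfix => fixMult_le_one ?_
  obtain ⟨m, hm, hc⟩ := Set.mem_iUnion.1 hw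
  exact mem_critSet_iterate_of_fix (exists_hasLocalDeriv_ratMap f) n.ne_zero hm hc hfix

end FixMeasure

section Integral

lemma abs_coe_sub_coe_le {x y b : ℝ≥0∞} (hb : b ≠ ⊤) (hx : x ≤ b) (hy : y ≤ b) :
    ((x : EReal) - (y : EReal)).abs ≤ b := by
  lift b to NNReal using hb
  lift x to NNReal using ne_top_of_le_ne_top ENNReal.coe_ne_top hx
  lift y to NNReal using ne_top_of_le_ne_top ENNReal.coe_ne_top hy
  have hx' : (x : ℝ) ≤ b := by exact_mod_cast hx
  have hy' : (y : ℝ) ≤ b := by exact_mod_cast hy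
  have : ((x : ℝ≥0∞) : EReal) - ((y : ℝ≥0∞) : EReal) = (((x : ℝ) - (y : ℝ) : ℝ) : EReal) := rfl
  rw [this, EReal.abs_def, ← ENNReal.ofReal_coe_nnreal]
  refine ENNReal.ofReal_le_ofReal (abs_le.2 ⟨?_, ?_⟩)
  · linarith [x.coe_nonneg]
  · linarith [y.coe_nonneg]

lemma abs_eintegral_le {X : Type*} [MeasurableSpace X] {μ : Measure X} [IsFiniteMeasure μ]
    {φ : X → EReal} {b : ℝ} (h : ∀ᵐ x ∂μ, ∃ r : ℝ, φ x = r ∧ |r| ≤ b) :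
    (eintegral μ φ).abs ≤ ENNReal.ofReal b * μ Set.univ := by
  refine abs_coe_sub_coe_le (ENNReal.mul_ne_top ENNReal.ofReal_ne_top (measure_ne_top _ _)) ?_ ?_
  · rw [← lintegral_const]
    refine lintegral_mono_ae ?_
    filter_upwards [h] with x hx
    obtain ⟨r, hr, hrb⟩ := hx
    rw [hr, EReal.real_coe_toENNReal]
    exact ENNReal.ofReal_le_ofReal ((le_abs_self r).trans hrb)
  · rw [← lintegral_const]
    refine lintegral_mono_ae ?_
    filter_upwards [h] with x hx
    obtain ⟨r, hr, hrb⟩ := hx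
    rw [hr, ← EReal.coe_neg, EReal.real_coe_toENNReal]
    exact ENNReal.ofReal_le_ofReal ((neg_le_abs r).trans hrb)

variable {K : Type*} [NontriviallyNormedField K]

lemma exists_Phi_eq_real {g : BerkP1 K → ℝ} {G δ : ℝ} (hg : ∀ S, |g S| ≤ G) (hδ : 0 < δ)
    {z w : OnePoint K} (h : δ ≤ chordal z w) :
    ∃ r : ℝ, Phi g (incl z) (incl w) = r ∧ |r| ≤ -Real.log δ + 2 * G := by
  have h1 : ((Real.log δ : ℝ) : EReal) ≤ ENNReal.log (hsia (incl z) (incl w)) := by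
    rw [← ENNReal.log_ofReal_of_pos hδ]
    exact ENNReal.log_le_log ((ENNReal.ofReal_le_ofReal h).trans (chordal_le_hsia z w))
  have h2 : ENNReal.log (hsia (incl z) (incl w)) ≤ ((0 : ℝ) : EReal) := by
    rw [EReal.coe_zero, ENNReal.log_le_zero_iff]
    exact hsia_le_one _ _
  unfold Phi
  generalize ENNReal.log (hsia (incl z) (incl w)) = l at h1 h2
  lift l to ℝ using
    ⟨ne_top_of_le_ne_top (EReal.coe_ne_top _) h2, ne_bot_of_le_ne_bot (EReal.coe_ne_bot _) h1⟩
  rw [EReal.coe_le_coe_iff] at h1 h2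
  refine ⟨l - g (incl z) - g (incl w), by simp only [EReal.coe_sub], ?_⟩
  have hz := abs_le.1 (hg (incl z))
  have hw := abs_le.1 (hg (incl w))
  exact abs_le.2 ⟨by linarith, by linarith⟩

lemma abs_green_le_supGreen {f : RatFunc K} (hf : 1 < ratDegree f) (S : BerkP1 K) :
    |green f S| ≤ (supGreen f).toReal := by
  rw [← Real.norm_eq_abs, ← toReal_enorm]
  exact ENNReal.toReal_mono (supGreen_lt_top hf).ne (le_iSup (fun S => ‖green f S‖ₑ) S)

end Integral

end RatDyn

open RatDyn

theorem superattracting_integral_bounded {K : Type*} [NontriviallyNormedField K]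
    [CompleteSpace K] [IsAlgClosed K] [CharZero K] (f : RatFunc K) (hf : 1 < ratDegree f)
    (δ : ℝ) (hδ : 0 < δ)
    (hsep : ∀ a ∈ SAT f, ∀ c ∈ critSet (ratMap f), backwardOrbit f c ≠ {a} →
      ∀ w ∈ backwardOrbit f c \ {a}, δ ≤ chordal a w) :
    ((⨆ n : ℕ+, ⨆ c ∈ critSet (ratMap f)^[n] \ fixSet (ratMap f)^[n],
        (eintegral ((fixMeasure (ratMap f)^[n]).restrict (incl '' SAT f))
          (Phi (green f) (incl c))).abs : ℝ≥0∞) : EReal)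
      ≤ (((-Real.log δ : ℝ) : EReal) + 2 * (supGreen f : EReal)) * (supMass f : EReal) ∧
    (((-Real.log δ : ℝ) : EReal) + 2 * (supGreen f : EReal)) * (supMass f : EReal) < ⊤ ∧
    supGreen f < ⊤ ∧ supMass f < ⊤ := by
  have hG := supGreen_lt_top hf
  have hM := supMass_lt_top hf
  set b : ℝ := -Real.log δ + 2 * (supGreen f).toReal with hb
  have hcoef : ((-Real.log δ : ℝ) : EReal) + 2 * (supGreen f : EReal) = (b : EReal) := by
    have h2 : (((supGreen f).toReal : ℝ) : EReal) = (supGreen f : EReal) := by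
      rw [← EReal.toReal_coe_ennreal]
      exact EReal.coe_toReal (by simpa using hG.ne) (EReal.coe_ennreal_ne_bot _)
    rw [hb, EReal.coe_add, EReal.coe_mul, h2]
    rfl
  have hbound : (⨆ n : ℕ+, ⨆ c ∈ critSet (ratMap f)^[n] \ fixSet (ratMap f)^[n],
      (eintegral ((fixMeasure (ratMap f)^[n]).restrict (incl '' SAT f))
        (Phi (green f) (incl c))).abs : ℝ≥0∞) ≤ ENNReal.ofReal b * supMass f := by
    refine iSup_le fun n => iSup₂_le fun c hc => ?_
    have hmass : fixMeasure (ratMap f)^[n] (incl '' SAT f) ≤ supMass f :=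
      le_iSup (fun n : ℕ+ => fixMeasure (ratMap f)^[n] (incl '' SAT f)) n
    have : IsFiniteMeasure ((fixMeasure (ratMap f)^[n]).restrict (incl '' SAT f)) :=
      ⟨by rw [Measure.restrict_apply_univ]; exact hmass.trans_lt hM⟩
    have hae : ∀ᵐ S ∂(fixMeasure (ratMap f)^[n]).restrict (incl '' SAT f),
        ∃ r : ℝ, Phi (green f) (incl c) S = r ∧ |r| ≤ b := by
      filter_upwards [ae_restrict_fixMeasure (ratMap f)^[n] (SAT_finite hf)] with S hS
      obtain ⟨a, ⟨haS, hafix⟩, rfl⟩ := hS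
      have hca : c ≠ a := fun h => hc.2 (h ▸ hafix)
      obtain ⟨j, -, hj⟩ := exists_mem_critSet_of_iterate (exists_hasLocalDeriv_ratMap f) hc.1
      have hmem := mem_backwardOrbit_iterate f j c
      refine exists_Phi_eq_real (abs_green_le_supGreen hf) hδ ?_
      rw [chordal_comm]
      exact hsep a haS _ hj (fun h => hca (h ▸ hmem : c ∈ ({a} : Set _))) c ⟨hmem, hca⟩
    refine (abs_eintegral_le hae).trans ?_
    rw [Measure.restrict_apply_univ]
    gcongr
  refine ⟨?_, ?_, hG, hM⟩
  · rw [hcoef]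
    rcases (SAT f).eq_empty_or_nonempty with hS | ⟨a, ha⟩
    · have h0 : supMass f = 0 := by simp [supMass, hS]
      rw [h0, mul_zero] at hbound
      rw [le_antisymm hbound zero_le, h0]
      simp
    · have hδ1 := separation_le_one hf ha (hsep a ha)
      have hb0 : 0 ≤ b := by
        have := Real.log_nonpos hδ.le hδ1
        have := ENNReal.toReal_nonneg (a := supGreen f)
        linarith
      have hbe : (b : EReal) = ((ENNReal.ofReal b : ℝ≥0∞) : EReal) := by
        rw [EReal.coe_ennreal_ofReal, max_eq_left hb0]
      rw [hbe, ← EReal.coe_ennreal_mul, EReal.coe_ennreal_le_coe_ennreal_iff]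
      exact hbound
  · rw [hcoef, ← ENNReal.ofReal_toReal hM.ne, EReal.coe_ennreal_ofReal, ← EReal.coe_mul]
    exact EReal.coe_lt_top _
end
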